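/- Let d ≥ 5 and let 𝒰 be the uniform spanning forest of Z^d. There exist constants c > 0 and C, depending only on d, such that for all λ > 0 and all integers n ≥ 1, P( |B_𝒰(0,n)| ≤ λ n² ) ≤ C exp( -c λ^{-1/5} ), where B_𝒰(0,n) is the ball of radius n around 0 in the intrinsic (graph) metric of 𝒰. -/

import Mathlib

open MeasureTheory
open scoped ENNReal Classical

namespace USFPaper

/-- Vertices of the nearest-neighbour integer lattice `ℤ^d`. -/
abbrev V (d : ℕ) := Fin d → ℤ

variable {d : ℕ}

/-- Nearest-neighbour adjacency in `ℤ^d`. -/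
def adj (x y : V d) : Prop := (∑ i, |x i - y i|) = 1

/-- The cube `Q(x,r) = { y : ‖x - y‖_∞ ≤ r }`. -/
def cube (x : V d) (r : ℕ) : Set (V d) := { y | ∀ i, |y i - x i| ≤ (r : ℤ) }

/-- Euclidean distance on `ℤ^d`. -/
noncomputable def eudist (x y : V d) : ℝ := Real.sqrt (∑ i, ((x i : ℝ) - (y i : ℝ)) ^ 2)

/-- Configurations: subgraphs of `ℤ^d`, encoded by the indicator of their edge set
(on unordered pairs of vertices). -/
abbrev Config (d : ℕ) := Sym2 (V d) → Bool

/-- `e` is an edge of the lattice `ℤ^d`. -/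
def isLatticeEdge (e : Sym2 (V d)) : Prop := ∃ a b : V d, e = s(a, b) ∧ adj a b

/-- Spanning trees of the wired graph `G_A^W` obtained from `ℤ^d` by collapsing the
complement of the finite set `A` to a single vertex: sets `T` of lattice edges, each
with at least one endpoint in `A`, with exactly `|A|` edges, and such that every
vertex of `A` is joined by a path of edges of `T` to the (collapsed) complement
of `A`. -/
def wiredSpanningTrees (A : Set (V d)) : Set (Set (Sym2 (V d))) :=
  { T | (∀ e ∈ T, isLatticeEdge e ∧ ∃ v ∈ e, v ∈ A) ∧
        T.ncard = A.ncard ∧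
        ∀ x ∈ A, ∃ l : List (V d),
          l.Chain' (fun u w => adj u w ∧ s(u, w) ∈ T) ∧
          l.head? = some x ∧ ∃ y, l.getLast? = some y ∧ y ∉ A }

/-- The cylinder event prescribing the configuration on the finite edge set `K`. -/
def cylEvent (K : Finset (Sym2 (V d))) (f : Sym2 (V d) → Bool) : Set (Config d) :=
  { ω | ∀ e ∈ K, ω e = f e }

/-- `μ` is the weak limit of the uniform spanning trees of the wired graphs of the
exhausting sequence `Dseq`: for every cylinder event, the proportion of wired spanning
trees of `Dseq r` compatible with it converges to its `μ`-probability. -/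
def IsWiredLimit (Dseq : ℕ → Set (V d)) (μ : Measure (Config d)) : Prop :=
  ∀ (K : Finset (Sym2 (V d))) (f : Sym2 (V d) → Bool),
    Filter.Tendsto
      (fun r : ℕ =>
        ((Set.ncard { T ∈ wiredSpanningTrees (Dseq r) |
            ∀ e ∈ K, (e ∈ T ↔ f e = true) } : ℝ) /
         (Set.ncard (wiredSpanningTrees (Dseq r)) : ℝ)))
      Filter.atTop
      (nhds ((μ (cylEvent K f)).toReal))

/-- `μ` is the uniform spanning forest of `ℤ^d`: the weak limit of the uniform
spanning trees of the (wired) boxes `Q_r`. -/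
def IsUSF (μ : Measure (Config d)) : Prop :=
  IsWiredLimit (fun r => cube (0 : V d) r) μ

/-- The ball `B_𝒰(0,n)` of radius `n` about the origin in the intrinsic (graph)
metric of the configuration `ω`. -/
def ballU (ω : Config d) (n : ℕ) : Set (V d) :=
  { y | ∃ l : List (V d),
      l.Chain' (fun u w => adj u w ∧ ω s(u, w) = true) ∧
      l.head? = some 0 ∧ l.getLast? = some y ∧ l.length ≤ n + 1 }

/-- The component `𝒰₀` of the origin in the configuration `ω`, for a domain `D`:
all vertices joined to `0` by a path of open edges not leaving `D` (i.e. not passing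
through the collapsed vertex `r_D`). -/
def comp0In (D : Set (V d)) (ω : Config d) : Set (V d) :=
  { y | ∃ l : List (V d),
      l.Chain' (fun u w => adj u w ∧ ω s(u, w) = true) ∧
      l.head? = some 0 ∧ l.getLast? = some y ∧ ∀ v ∈ l, v ∈ D }

section Gen
variable {X : Type} [Fintype X] [DecidableEq X]

def IsF (B : Finset X) (p : X → X) : Prop := (∀ x, x ∉ B → p x = x) ∧ ∀ x, ∃ k, p^[k] x ∉ B
def rch (p : X → X) (x w : X) : Prop := ∃ k, p^[k] x = w
noncomputable def wt (c : X → X → ℝ) (B : Finset X) (p : X → X) : ℝ := ∏ x ∈ B, c x (p x)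
noncomputable def FF (B : Finset X) : Finset (X → X) := Finset.univ.filter (IsF B)
noncomputable def S (c : X → X → ℝ) (B : Finset X) (Φ : (X → X) → ℝ) : ℝ :=
  ∑ p ∈ FF B, wt c B p * Φ p
noncomputable def Z (c : X → X → ℝ) (B : Finset X) : ℝ := S c B (fun _ => 1)
noncomputable def ind (P : Prop) : ℝ := if P then 1 else 0
noncomputable def res (B : Finset X) (p : X → X) (x : X) : X := if x ∈ B then p x else x

lemma ind_nonneg (P : Prop) : 0 ≤ ind P := by unfold ind; split_ifs <;> norm_num
lemma ind_le_one (P : Prop) : ind P ≤ 1 := by unfold ind; split_ifs <;> norm_num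
lemma ind_true {P : Prop} (h : P) : ind P = 1 := by simp [ind, h]
lemma ind_false {P : Prop} (h : ¬ P) : ind P = 0 := by simp [ind, h]
lemma ind_not (P : Prop) : ind (¬ P) = 1 - ind P := by unfold ind; split_ifs <;> norm_num
lemma ind_mono {P Q : Prop} (h : P → Q) : ind P ≤ ind Q := by
  unfold ind; split_ifs <;> norm_num; tauto

lemma mem_FF {B : Finset X} {p : X → X} : p ∈ FF B ↔ IsF B p := by simp [FF]

lemma iter_congr {p p' : X → X} {x : X} {k : ℕ}
    (h : ∀ j < k, p' (p^[j] x) = p (p^[j] x)) : p'^[k] x = p^[k] x := by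
  induction k with
  | zero => rfl
  | succ k ih =>
    rw [Function.iterate_succ_apply', Function.iterate_succ_apply',
      ih (fun j hj => h j (by omega)), h k (by omega)]

lemma first_hit {P : ℕ → Prop} (h : ∃ k, P k) : ∃ k, P k ∧ ∀ j < k, ¬ P j :=
  ⟨Nat.find h, Nat.find_spec h, fun _ hj => Nat.find_min h hj⟩

lemma rch_refl (p : X → X) (x : X) : rch p x x := ⟨0, rfl⟩
lemma rch_step (p : X → X) (x : X) : rch p x (p x) := ⟨1, rfl⟩
lemma rch_trans {p : X → X} {x y z : X} (h : rch p x y) (h' : rch p y z) : rch p x z := by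
  obtain ⟨k, rfl⟩ := h
  obtain ⟨l, rfl⟩ := h'
  exact ⟨l + k, Function.iterate_add_apply p l k x⟩
lemma rch_cases {p : X → X} {x w : X} (h : rch p x w) : x = w ∨ rch p (p x) w := by
  obtain ⟨k, rfl⟩ := h
  cases k with
  | zero => left; rfl
  | succ k => right; exact ⟨k, rfl⟩
lemma rch_total {p : X → X} {x v w : X} (h : rch p x v) (h' : rch p x w) :
    rch p v w ∨ rch p w v := by
  obtain ⟨k, rfl⟩ := h
  obtain ⟨l, rfl⟩ := h'
  rcases le_total k l with hkl | hkl
  · left; refine ⟨l - k, ?_⟩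
    rw [← Function.iterate_add_apply, Nat.sub_add_cancel hkl]
  · right; refine ⟨k - l, ?_⟩
    rw [← Function.iterate_add_apply, Nat.sub_add_cancel hkl]

lemma IsF.fix {B : Finset X} {p : X → X} (hp : IsF B p) {x : X} (hx : x ∉ B) (k : ℕ) :
    p^[k] x = x := Function.iterate_fixed (hp.1 x hx) k
lemma IsF.eq_of_rch {B : Finset X} {p : X → X} (hp : IsF B p) {x w : X} (hx : x ∉ B)
    (h : rch p x w) : w = x := by
  obtain ⟨k, rfl⟩ := h; exact hp.fix hx k
lemma IsF.no_cycle {B : Finset X} {p : X → X} (hp : IsF B p) {x : X} (hx : x ∈ B) :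
    ¬ rch p (p x) x := by
  rintro ⟨k, hk⟩
  have h1 : Function.IsPeriodicPt p (k+1) x := hk
  obtain ⟨j, hj⟩ := hp.2 x
  have h2 : p^[(k+1)*j] x = x := h1.mul_const j
  have h3 : (k+1)*j = k*j + j := by ring
  rw [h3, Function.iterate_add_apply, hp.fix hj] at h2
  exact hj (by rw [h2]; exact hx)
lemma IsF.antisymm {B : Finset X} {p : X → X} (hp : IsF B p) {x w : X} (h : rch p x w)
    (h' : rch p w x) : x = w := by
  by_cases hx : x ∈ B
  · rcases rch_cases h with h1 | h1
    · exact h1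
    · exact absurd (rch_trans h1 h') (hp.no_cycle hx)
  · exact (hp.eq_of_rch hx h).symm

lemma res_isF {B B' : Finset X} {p : X → X} (hp : IsF B p) (hB : B' ⊆ B) : IsF B' (res B' p) := by
  refine ⟨fun x hx => by simp [res, hx], fun x => ?_⟩
  obtain ⟨k, hk, hj⟩ := first_hit (P := fun k => p^[k] x ∉ B')
    (by obtain ⟨k, hk⟩ := hp.2 x; exact ⟨k, fun h => hk (hB h)⟩)
  refine ⟨k, ?_⟩
  rw [iter_congr (p := p) (fun j hj' => by have := hj j hj'; simp only [not_not] at this; simp [res, this])]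
  exact hk

lemma iter_update {p : X → X} {z w : X} (y : X) (h : ¬ rch p z w) (k : ℕ) :
    (Function.update p w y)^[k] z = p^[k] z :=
  iter_congr (fun j _ => Function.update_of_ne (fun e => h ⟨j, e⟩) _ _)

lemma isF_add {B : Finset X} {q : X → X} {w y : X} (hw : w ∈ B) (hq : IsF (B.erase w) q)
    (h : ¬ rch q y w) : IsF B (Function.update q w y) := by
  have hout : ∀ z, z ∉ B.erase w → z ≠ w → z ∉ B := fun z hz hzw hzB =>
    hz (Finset.mem_erase.2 ⟨hzw, hzB⟩)
  refine ⟨fun z hz => ?_, fun z => ?_⟩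
  · have : z ≠ w := fun e => hz (e ▸ hw)
    rw [Function.update_of_ne this]
    exact hq.1 z (fun h => hz (Finset.mem_of_mem_erase h))
  · by_cases hr : rch q z w
    · obtain ⟨k, hk, hj⟩ := first_hit hr
      have e : (Function.update q w y)^[k] z = w := by
        rw [iter_congr (p := q) (fun j hj' => Function.update_of_ne (hj j hj') _ _), hk]
      obtain ⟨l, hl⟩ := hq.2 y
      refine ⟨l + (1 + k), ?_⟩
      rw [Function.iterate_add_apply, Function.iterate_add_apply, e]
      simp only [Function.iterate_one, Function.update_self]
      rw [iter_update y h]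
      exact hout _ hl (fun e => h ⟨l, e⟩)
    · obtain ⟨k, hk⟩ := hq.2 z
      refine ⟨k, ?_⟩
      rw [iter_update y hr]
      exact hout _ hk (fun e => hr ⟨k, e⟩)

lemma isF_del {B : Finset X} {p : X → X} {w : X} (hp : IsF B p) :
    IsF (B.erase w) (Function.update p w w) := by
  have : Function.update p w w = res (B.erase w) p := by
    funext z
    by_cases hz : z = w
    · subst hz; simp [res]
    · rw [Function.update_of_ne hz]
      by_cases hzB : z ∈ B
      · simp [res, hz, hzB]
      · simp [res, hzB, hp.1 z hzB]
  rw [this]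
  exact res_isF hp (Finset.erase_subset _ _)

lemma del_not_rch {B : Finset X} {p : X → X} {w : X} (hp : IsF B p) (hw : w ∈ B) :
    ¬ rch (Function.update p w w) (p w) w := by
  intro h
  obtain ⟨k, hk, hj⟩ := first_hit h
  refine hp.no_cycle hw ⟨k, ?_⟩
  rw [iter_congr (p := Function.update p w w) (p' := p)]
  · exact hk
  · intro j hj'
    rw [Function.update_of_ne (hj j hj')]

lemma wt_update {c : X → X → ℝ} {B : Finset X} {w : X} (hw : w ∈ B) (q : X → X) (y : X) :
    wt c B (Function.update q w y) = c w y * wt c (B.erase w) q := by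
  unfold wt
  rw [← Finset.mul_prod_erase B _ hw, Function.update_self]
  congr 1
  refine Finset.prod_congr rfl fun x hx => ?_
  rw [Function.update_of_ne (Finset.ne_of_mem_erase hx)]

/-- one step decomposition -/
lemma S_step (c : X → X → ℝ) {B : Finset X} {w : X} (hw : w ∈ B) (Φ : (X → X) → ℝ) :
    S c B Φ = ∑ y, c w y * S c (B.erase w)
      (fun q => ind (¬ rch q y w) * Φ (Function.update q w y)) := by
  have hR : (∑ y, c w y * S c (B.erase w)
      (fun q => ind (¬ rch q y w) * Φ (Function.update q w y))) =
      ∑ yq ∈ ((Finset.univ : Finset X) ×ˢ FF (B.erase w)).filter (fun yq => ¬ rch yq.2 yq.1 w),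
        c w yq.1 * (wt c (B.erase w) yq.2 * Φ (Function.update yq.2 w yq.1)) := by
    rw [Finset.sum_filter, Finset.sum_product]
    refine Finset.sum_congr rfl fun y _ => ?_
    unfold S
    rw [Finset.mul_sum]
    refine Finset.sum_congr rfl fun q _ => ?_
    by_cases h : rch q y w <;> simp [ind, h]
  rw [hR]
  unfold S
  refine Finset.sum_nbij' (fun p => (p w, Function.update p w w))
    (fun yq => Function.update yq.2 w yq.1) ?_ ?_ ?_ ?_ ?_
  · intro p hp
    rw [mem_FF] at hp
    simp only [Finset.mem_filter, Finset.mem_product, Finset.mem_univ, true_and, mem_FF]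
    exact ⟨isF_del hp, del_not_rch hp hw⟩
  · rintro ⟨y, q⟩ hyq
    simp only [Finset.mem_filter, Finset.mem_product, Finset.mem_univ, true_and, mem_FF] at hyq
    rw [mem_FF]
    exact isF_add hw hyq.1 hyq.2
  · intro p _
    simp
  · rintro ⟨y, q⟩ hyq
    simp only [Finset.mem_filter, Finset.mem_product, Finset.mem_univ, true_and, mem_FF] at hyq
    have : q w = w := hyq.1.1 w (by simp)
    simp only [Function.update_self, Function.update_idem, Prod.mk.injEq, true_and]
    conv_rhs => rw [← Function.update_eq_self w q, this]
  · intro p _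
    have := wt_update (c := c) hw (Function.update p w w) (p w)
    simp only [Function.update_idem, Function.update_eq_self] at this ⊢
    rw [this]; ring

lemma S_congr {c : X → X → ℝ} {B : Finset X} {Φ Ψ : (X → X) → ℝ}
    (h : ∀ p, IsF B p → Φ p = Ψ p) : S c B Φ = S c B Ψ :=
  Finset.sum_congr rfl fun p hp => by rw [h p (mem_FF.1 hp)]
lemma wt_nonneg {c : X → X → ℝ} (hc : ∀ x y, 0 ≤ c x y) (B : Finset X) (p : X → X) :
    0 ≤ wt c B p := Finset.prod_nonneg fun x _ => hc _ _
lemma S_mono {c : X → X → ℝ} (hc : ∀ x y, 0 ≤ c x y) {B : Finset X} {Φ Ψ : (X → X) → ℝ}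
    (h : ∀ p, IsF B p → Φ p ≤ Ψ p) : S c B Φ ≤ S c B Ψ :=
  Finset.sum_le_sum fun p hp => mul_le_mul_of_nonneg_left (h p (mem_FF.1 hp)) (wt_nonneg hc _ _)
lemma S_nonneg {c : X → X → ℝ} (hc : ∀ x y, 0 ≤ c x y) {B : Finset X} {Φ : (X → X) → ℝ}
    (h : ∀ p, IsF B p → 0 ≤ Φ p) : 0 ≤ S c B Φ :=
  Finset.sum_nonneg fun p hp => mul_nonneg (wt_nonneg hc _ _) (h p (mem_FF.1 hp))
lemma S_add (c : X → X → ℝ) (B : Finset X) (Φ Ψ : (X → X) → ℝ) :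
    S c B (fun p => Φ p + Ψ p) = S c B Φ + S c B Ψ := by
  simp only [S, mul_add, Finset.sum_add_distrib]
lemma S_sub (c : X → X → ℝ) (B : Finset X) (Φ Ψ : (X → X) → ℝ) :
    S c B (fun p => Φ p - Ψ p) = S c B Φ - S c B Ψ := by
  simp only [S, mul_sub, Finset.sum_sub_distrib]
lemma S_mul (c : X → X → ℝ) (B : Finset X) (a : ℝ) (Φ : (X → X) → ℝ) :
    S c B (fun p => a * Φ p) = a * S c B Φ := by
  simp only [S, Finset.mul_sum]
  exact Finset.sum_congr rfl fun _ _ => by ring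
lemma S_const (c : X → X → ℝ) (B : Finset X) (a : ℝ) :
    S c B (fun _ => a) = a * Z c B := by
  unfold Z; rw [← S_mul]; simp
lemma S_sum {ι : Type} (c : X → X → ℝ) (B : Finset X) (s : Finset ι) (Φ : ι → (X → X) → ℝ) :
    S c B (fun p => ∑ i ∈ s, Φ i p) = ∑ i ∈ s, S c B (Φ i) := by
  simp only [S, Finset.mul_sum]
  exact Finset.sum_comm
lemma Z_nonneg {c : X → X → ℝ} (hc : ∀ x y, 0 ≤ c x y) (B : Finset X) : 0 ≤ Z c B :=
  S_nonneg hc fun _ _ => zero_le_one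
lemma S_zero_of_Z {c : X → X → ℝ} (hc : ∀ x y, 0 ≤ c x y) {B : Finset X} (h : Z c B = 0)
    (Φ : (X → X) → ℝ) : S c B Φ = 0 := by
  unfold Z S at h
  rw [Finset.sum_eq_zero_iff_of_nonneg (fun p _ => by simpa using wt_nonneg hc B p)] at h
  refine Finset.sum_eq_zero fun p hp => ?_
  have := h p hp
  simp only [mul_one] at this
  rw [this, zero_mul]

lemma Z_pos_iff {c : X → X → ℝ} (hc : ∀ x y, 0 ≤ c x y) {B : Finset X} :
    0 < Z c B ↔ ∃ p, IsF B p ∧ ∀ x ∈ B, 0 < c x (p x) := by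
  constructor
  · intro h
    obtain ⟨p, hp, h2⟩ := Finset.exists_ne_zero_of_sum_ne_zero (ne_of_gt h)
    refine ⟨p, mem_FF.1 hp, fun x hx => lt_of_le_of_ne (hc _ _) (fun e => h2 ?_)⟩
    unfold wt
    rw [Finset.prod_eq_zero hx e.symm, zero_mul]
  · rintro ⟨p, hp, h⟩
    have h1 : 0 < wt c B p := Finset.prod_pos h
    refine lt_of_lt_of_le ?_ (Finset.single_le_sum (f := fun p => wt c B p * 1) (fun q _ => by
      simpa using wt_nonneg hc B q) (mem_FF.2 hp))
    simpa using h1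

lemma Z_pos_mono {c : X → X → ℝ} (hc : ∀ x y, 0 ≤ c x y) {B B' : Finset X} (h : B' ⊆ B)
    (hZ : 0 < Z c B) : 0 < Z c B' := by
  rw [Z_pos_iff hc] at hZ ⊢
  obtain ⟨p, hp, h2⟩ := hZ
  refine ⟨res B' p, res_isF hp h, fun x hx => ?_⟩
  simp only [res, hx, if_true]
  exact h2 x (h hx)

/-- Laplacian -/
noncomputable def Lap (c : X → X → ℝ) (f : X → ℝ) (x : X) : ℝ := ∑ y, c x y * (f x - f y)

lemma Lap_sub (c : X → X → ℝ) (f g : X → ℝ) (x : X) :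
    Lap c (fun z => f z - g z) x = Lap c f x - Lap c g x := by
  unfold Lap; rw [← Finset.sum_sub_distrib]; exact Finset.sum_congr rfl fun _ _ => by ring
lemma Lap_mul (c : X → X → ℝ) (a : ℝ) (f : X → ℝ) (x : X) :
    Lap c (fun z => a * f z) x = a * Lap c f x := by
  unfold Lap; rw [Finset.mul_sum]; exact Finset.sum_congr rfl fun _ _ => by ring
lemma Lap_sum {ι : Type} (c : X → X → ℝ) (s : Finset ι) (f : ι → X → ℝ) (x : X) :
    Lap c (fun z => ∑ i ∈ s, f i z) x = ∑ i ∈ s, Lap c (f i) x := by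
  unfold Lap
  rw [Finset.sum_comm]
  refine Finset.sum_congr rfl fun y _ => ?_
  rw [← Finset.sum_sub_distrib, Finset.mul_sum]

lemma max_principle {c : X → X → ℝ} (hc : ∀ x y, 0 ≤ c x y) {B : Finset X} (hZ : 0 < Z c B)
    {f : X → ℝ} (h1 : ∀ x ∈ B, 0 ≤ Lap c f x) (h2 : ∀ x, x ∉ B → 0 ≤ f x) (x : X) : 0 ≤ f x := by
  obtain ⟨p, hp, hpos⟩ := (Z_pos_iff hc).1 hZ
  obtain ⟨x0, -, hx0⟩ := Finset.exists_min_image Finset.univ f ⟨x, Finset.mem_univ x⟩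
  by_contra hneg
  have hlt : f x0 < 0 := lt_of_le_of_lt (hx0 x (Finset.mem_univ _)) (not_le.1 hneg)
  have key : ∀ k, f (p^[k] x0) = f x0 := by
    intro k
    induction k with
    | zero => rfl
    | succ k ih =>
      rw [Function.iterate_succ_apply']
      set z := p^[k] x0
      have hz : z ∈ B := by
        by_contra hz
        have := h2 z hz
        linarith
      have hL := h1 z hz
      have hle : ∀ y ∈ Finset.univ, c z y * (f z - f y) ≤ 0 := fun y _ =>
        mul_nonpos_of_nonneg_of_nonpos (hc _ _) (by rw [ih]; linarith [hx0 y (Finset.mem_univ _)])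
      have h0 : Lap c f z = 0 := le_antisymm (Finset.sum_nonpos hle) hL
      have := (Finset.sum_eq_zero_iff_of_nonpos hle).1 h0 (p z) (Finset.mem_univ _)
      rcases mul_eq_zero.1 this with h | h
      · exact absurd h (ne_of_gt (hpos z hz))
      · linarith
  obtain ⟨k, hk⟩ := hp.2 x0
  have := h2 _ hk
  rw [key k] at this
  linarith

lemma max_le {c : X → X → ℝ} (hc : ∀ x y, 0 ≤ c x y) {B : Finset X} (hZ : 0 < Z c B)
    {f g : X → ℝ} (h1 : ∀ x ∈ B, Lap c f x ≤ Lap c g x) (h2 : ∀ x, x ∉ B → f x ≤ g x) (x : X) :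
    f x ≤ g x := by
  have := max_principle hc hZ (f := fun z => g z - f z)
    (fun x hx => by rw [Lap_sub]; linarith [h1 x hx]) (fun x hx => by linarith [h2 x hx]) x
  linarith

/-- hitting a set of roots -/
def att (Γ : Set X) (p : X → X) (x : X) : Prop := ∃ k, p^[k] x ∈ Γ

lemma att_update {Γ : Set X} {q : X → X} {x z y' : X} (hx : x ∉ Γ) (hqx : q x = x)
    (hy' : ¬ rch q y' x) :
    att Γ (Function.update q x y') z ↔ (att Γ q z ∨ (rch q z x ∧ att Γ q y')) := by
  have hfx : ∀ k, q^[k] x = x := fun k => Function.iterate_fixed hqx k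
  by_cases hr : rch q z x
  · obtain ⟨k, hk, hj⟩ := first_hit hr
    have e : (Function.update q x y')^[k] z = x := by
      rw [iter_congr (p := q) (fun j hj' => Function.update_of_ne (hj j hj') _ _), hk]
    have e2 : ∀ l, (Function.update q x y')^[l + (1 + k)] z = q^[l] y' := by
      intro l
      rw [Function.iterate_add_apply, Function.iterate_add_apply, e]
      simp only [Function.iterate_one, Function.update_self]
      rw [iter_update y' hy']
    have e3 : ∀ j, j < k + 1 → (Function.update q x y')^[j] z = q^[j] z := fun j hj' =>
      iter_congr (fun i hi => Function.update_of_ne (hj i (by omega)) _ _)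
    constructor
    · rintro ⟨l, hl⟩
      by_cases hlk : l < k + 1
      · left; exact ⟨l, by rw [← e3 l hlk]; exact hl⟩
      · right
        refine ⟨hr, l - (1 + k), ?_⟩
        rw [← e2, Nat.sub_add_cancel (by omega)]
        exact hl
    · rintro (⟨l, hl⟩ | ⟨-, l, hl⟩)
      · by_cases hlk : l < k + 1
        · exact ⟨l, by rw [e3 l hlk]; exact hl⟩
        · exfalso
          have : l = (l - k) + k := by omega
          rw [this, Function.iterate_add_apply, hk, hfx] at hl
          exact hx hl
      · exact ⟨_, by rw [e2]; exact hl⟩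
  · constructor
    · rintro ⟨l, hl⟩
      rw [iter_update y' hr] at hl
      exact Or.inl ⟨l, hl⟩
    · rintro (⟨l, hl⟩ | h)
      · exact ⟨l, by rw [iter_update y' hr]; exact hl⟩
      · exact absurd h.1 hr

lemma att_not_rch {Γ : Set X} {B : Finset X} {q : X → X} {x z : X} (hq : IsF B q)
    (hΓ : ∀ g ∈ Γ, g ∉ B) (hx : x ∉ Γ) (hqx : q x = x) (h : att Γ q z) : ¬ rch q z x := by
  intro hr
  obtain ⟨k, hk⟩ := h
  rcases rch_total hr ⟨k, rfl⟩ with h | h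
  · obtain ⟨l, hl⟩ := h
    rw [Function.iterate_fixed hqx] at hl
    exact hx (hl ▸ hk)
  · have := hq.eq_of_rch (hΓ _ hk) h
    exact hx (this ▸ hk)

lemma att_harmonic (c : X → X → ℝ) {B : Finset X} {Γ : Set X} (hΓ : ∀ g ∈ Γ, g ∉ B) {x : X}
    (hx : x ∈ B) : Lap c (fun z => S c B (fun p => ind (att Γ p z))) x = 0 := by
  have hxΓ : x ∉ Γ := fun h => hΓ x h hx
  have hΓ' : ∀ g ∈ Γ, g ∉ B.erase x := fun g hg h => hΓ g hg (Finset.mem_of_mem_erase h)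
  set T : X → X → ℝ := fun y y' => S c (B.erase x) (fun q => ind (att Γ q y') * ind (¬ rch q y x))
    with hT
  have h1 : ∀ y, S c B (fun p => ind (att Γ p x)) - S c B (fun p => ind (att Γ p y)) =
      ∑ y', c x y' * (T y y' - T y' y) := by
    intro y
    rw [← S_sub, S_step c hx]
    refine Finset.sum_congr rfl fun y' _ => ?_
    congr 1
    rw [hT]; simp only
    rw [← S_sub]
    refine S_congr fun q hq => ?_
    have hqx : q x = x := hq.1 x (by simp)
    by_cases hy' : rch q y' x
    · have : ¬ att Γ q y' := fun h => att_not_rch hq hΓ' hxΓ hqx h hy'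
      simp [ind, hy', this]
    · have e1 := att_update (z := x) hxΓ hqx hy'
      have e2 := att_update (z := y) hxΓ hqx hy'
      have e3 : ¬ att Γ q x := fun h => att_not_rch hq hΓ' hxΓ hqx h (rch_refl _ _)
      have e4 : att Γ q y → ¬ rch q y x := fun h => att_not_rch hq hΓ' hxΓ hqx h
      have e5 := rch_refl q x
      rw [e1, e2]
      by_cases a1 : att Γ q y <;> by_cases a2 : att Γ q y' <;> by_cases a3 : rch q y x <;>
        simp_all [ind]
  unfold Lap
  simp only [h1]
  simp only [Finset.mul_sum]
  have h2 : ∑ y, ∑ y', c x y * (c x y' * (T y y' - T y' y)) =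
      ∑ y, ∑ y', c x y * (c x y' * (T y' y - T y y')) := by
    rw [Finset.sum_comm]
    exact Finset.sum_congr rfl fun y _ => Finset.sum_congr rfl fun y' _ => by ring
  have h3 : ∑ y, ∑ y', c x y * (c x y' * (T y y' - T y' y)) =
      - ∑ y, ∑ y', c x y * (c x y' * (T y' y - T y y')) := by
    rw [← Finset.sum_neg_distrib]
    refine Finset.sum_congr rfl fun y _ => ?_
    rw [← Finset.sum_neg_distrib]
    exact Finset.sum_congr rfl fun y' _ => by ring
  linarith

lemma att_boundary (c : X → X → ℝ) {B : Finset X} (Γ : Set X) {x : X}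
    (hx : x ∉ B) : S c B (fun p => ind (att Γ p x)) = ind (x ∈ Γ) * Z c B := by
  rw [← S_const]
  refine S_congr fun p hp => ?_
  have : att Γ p x ↔ x ∈ Γ := by
    unfold att; simp [hp.fix hx]
  rw [this]

lemma rch_att (p : X → X) (x w : X) : rch p x w ↔ att {w} p x := Iff.rfl

end Gen

section Gen2
variable {X : Type} [Fintype X] [DecidableEq X]

noncomputable def Gr (c : X → X → ℝ) (B : Finset X) (x w : X) : ℝ :=
  S c (B.erase w) (fun q => ind (rch q x w)) / Z c B
noncomputable def PP (c : X → X → ℝ) (B : Finset X) (Γ : Set X) (x : X) : ℝ :=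
  S c B (fun p => ind (att Γ p x)) / Z c B

lemma Gr_nonneg {c : X → X → ℝ} (hc : ∀ x y, 0 ≤ c x y) (B : Finset X) (x w : X) :
    0 ≤ Gr c B x w := div_nonneg (S_nonneg hc fun _ _ => ind_nonneg _) (Z_nonneg hc _)
lemma PP_nonneg {c : X → X → ℝ} (hc : ∀ x y, 0 ≤ c x y) (B : Finset X) (Γ : Set X) (x : X) :
    0 ≤ PP c B Γ x := div_nonneg (S_nonneg hc fun _ _ => ind_nonneg _) (Z_nonneg hc _)
lemma PP_le_one {c : X → X → ℝ} (hc : ∀ x y, 0 ≤ c x y) (B : Finset X) (Γ : Set X) (x : X) :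
    PP c B Γ x ≤ 1 :=
  div_le_one_of_le₀ (S_mono hc fun _ _ => ind_le_one _) (Z_nonneg hc _)
lemma Lap_div (c : X → X → ℝ) (a : ℝ) (f : X → ℝ) (x : X) :
    Lap c (fun z => f z / a) x = Lap c f x / a := by
  have := Lap_mul c a⁻¹ f x
  simp only [div_eq_inv_mul]; exact this
lemma PP_Lap (c : X → X → ℝ) {B : Finset X} {Γ : Set X} (hΓ : ∀ g ∈ Γ, g ∉ B) {x : X}
    (hx : x ∈ B) : Lap c (PP c B Γ) x = 0 := by
  unfold PP; rw [Lap_div, att_harmonic c hΓ hx, zero_div]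
lemma PP_out {c : X → X → ℝ} {B : Finset X} (hZ : 0 < Z c B) (Γ : Set X) {x : X}
    (hx : x ∉ B) : PP c B Γ x = ind (x ∈ Γ) := by
  unfold PP; rw [att_boundary c Γ hx, mul_div_cancel_right₀ _ hZ.ne']

lemma Gr_out {c : X → X → ℝ} {B : Finset X} {x w : X} (hx : x ∉ B) (hw : w ∈ B) :
    Gr c B x w = 0 := by
  unfold Gr
  have := att_boundary c (B := B.erase w) {w} (x := x) (fun h => hx (Finset.mem_of_mem_erase h))
  simp only [← rch_att] at this
  rw [this, ind_false, zero_mul, zero_div]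
  simp only [Set.mem_singleton_iff]
  exact fun e => hx (e ▸ hw)

lemma Gr_diag (c : X → X → ℝ) (B : Finset X) (w : X) :
    Gr c B w w = Z c (B.erase w) / Z c B := by
  unfold Gr Z; congr 1
  exact S_congr fun p _ => ind_true (rch_refl _ _)

lemma Gr_Lap {c : X → X → ℝ} {B : Finset X} (hZ : 0 < Z c B) {x w : X} (hx : x ∈ B)
    (hw : w ∈ B) : Lap c (fun z => Gr c B z w) x = if x = w then 1 else 0 := by
  unfold Gr
  rw [Lap_div]
  split_ifs with h
  · subst h
    rw [div_eq_one_iff_eq hZ.ne']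
    unfold Lap
    conv_rhs => rw [Z, S_step c hw]
    refine Finset.sum_congr rfl fun y _ => ?_
    rw [← S_sub]
    congr 1
    refine S_congr fun q hq => ?_
    rw [ind_not, ind_true (rch_refl q x), mul_one]
  · have := att_harmonic c (B := B.erase w) (Γ := {w}) (by simp) (x := x)
      (Finset.mem_erase.2 ⟨h, hx⟩)
    simp only [← rch_att] at this
    rw [this, zero_div]

lemma Lap_selfadj {c : X → X → ℝ} (hs : ∀ x y, c x y = c y x) (f g : X → ℝ) :
    ∑ z, Lap c f z * g z = ∑ z, f z * Lap c g z := by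
  unfold Lap
  have e1 : ∑ z, (∑ y, c z y * (f z - f y)) * g z
      = ∑ z, ∑ y, c z y * f z * g z - ∑ z, ∑ y, c z y * f y * g z := by
    rw [← Finset.sum_sub_distrib]
    refine Finset.sum_congr rfl fun z _ => ?_
    rw [Finset.sum_mul, ← Finset.sum_sub_distrib]
    exact Finset.sum_congr rfl fun y _ => by ring
  have e2 : ∑ z, f z * (∑ y, c z y * (g z - g y))
      = ∑ z, ∑ y, c z y * f z * g z - ∑ z, ∑ y, c z y * f z * g y := by
    rw [← Finset.sum_sub_distrib]
    refine Finset.sum_congr rfl fun z _ => ?_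
    rw [Finset.mul_sum, ← Finset.sum_sub_distrib]
    exact Finset.sum_congr rfl fun y _ => by ring
  rw [e1, e2]
  congr 1
  rw [Finset.sum_comm]
  exact Finset.sum_congr rfl fun z _ => Finset.sum_congr rfl fun y _ => by rw [hs]

lemma Gr_symm {c : X → X → ℝ} (hs : ∀ x y, c x y = c y x) {B : Finset X} (hZ : 0 < Z c B)
    {x w : X} (hx : x ∈ B) (hw : w ∈ B) : Gr c B x w = Gr c B w x := by
  have h := Lap_selfadj hs (fun z => Gr c B z x) (fun z => Gr c B z w)
  have e1 : ∑ z, Lap c (fun z => Gr c B z x) z * Gr c B z w = Gr c B x w := by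
    rw [Finset.sum_eq_single x]
    · rw [Gr_Lap hZ hx hx]; simp
    · intro z _ hz
      by_cases hzB : z ∈ B
      · rw [Gr_Lap hZ hzB hx]; simp [hz]
      · rw [Gr_out hzB hw, mul_zero]
    · simp
  have e2 : ∑ z, Gr c B z x * Lap c (fun z => Gr c B z w) z = Gr c B w x := by
    rw [Finset.sum_eq_single w]
    · rw [Gr_Lap hZ hw hw]; simp
    · intro z _ hz
      by_cases hzB : z ∈ B
      · rw [Gr_Lap hZ hzB hw]; simp [hz]
      · rw [Gr_out hzB hx, zero_mul]
    · simp
  rw [← e1, ← e2, h]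

lemma Gr_sum_Lap {c : X → X → ℝ} {B : Finset X} (hZ : 0 < Z c B) (φ : X → ℝ) {x : X}
    (hx : x ∈ B) : Lap c (fun z => ∑ w ∈ B, Gr c B z w * φ w) x = φ x := by
  rw [Lap_sum]
  rw [Finset.sum_eq_single x]
  · have := Lap_mul c (φ x) (fun z => Gr c B z x) x
    rw [Gr_Lap hZ hx hx] at this
    simp only [mul_comm (φ x)] at this
    rw [this]; simp
  · intro w hw hne
    have := Lap_mul c (φ w) (fun z => Gr c B z w) x
    rw [Gr_Lap hZ hx hw] at this
    simp only [mul_comm (φ w)] at this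
    rw [this]; simp [hne.symm]
  · intro h; exact absurd hx h

lemma Gr_sum_out {c : X → X → ℝ} {B : Finset X} (φ : X → ℝ) {x : X}
    (hx : x ∉ B) : ∑ w ∈ B, Gr c B x w * φ w = 0 :=
  Finset.sum_eq_zero fun w hw => by rw [Gr_out hx hw, zero_mul]

lemma Gr_super {c : X → X → ℝ} (hc : ∀ x y, 0 ≤ c x y) {B : Finset X} (hZ : 0 < Z c B)
    {φ f : X → ℝ} (h1 : ∀ x ∈ B, φ x ≤ Lap c f x) (h2 : ∀ x, x ∉ B → 0 ≤ f x) (x : X) :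
    ∑ w ∈ B, Gr c B x w * φ w ≤ f x :=
  max_le hc hZ (f := fun x => ∑ w ∈ B, Gr c B x w * φ w)
    (fun x hx => by rw [Gr_sum_Lap hZ φ hx]; exact h1 x hx)
    (fun x hx => by rw [Gr_sum_out φ hx]; exact h2 x hx) x

lemma Gr_sub {c : X → X → ℝ} (hc : ∀ x y, 0 ≤ c x y) {B : Finset X} (hZ : 0 < Z c B)
    {φ f : X → ℝ} (h1 : ∀ x ∈ B, Lap c f x ≤ φ x) (h2 : ∀ x, x ∉ B → f x ≤ 0) (x : X) :
    f x ≤ ∑ w ∈ B, Gr c B x w * φ w :=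
  max_le hc hZ (g := fun x => ∑ w ∈ B, Gr c B x w * φ w)
    (fun x hx => by rw [Gr_sum_Lap hZ φ hx]; exact h1 x hx)
    (fun x hx => by rw [Gr_sum_out φ hx]; exact h2 x hx) x

lemma Gr_diag_deg {c : X → X → ℝ} (hc : ∀ x y, 0 ≤ c x y) {B : Finset X} (hZ : 0 < Z c B)
    {Δ : ℝ} (hΔ : ∀ x ∈ B, ∑ y, c x y ≤ Δ) {w : X} (hw : w ∈ B) : 1 ≤ Δ * Gr c B w w := by
  have h := Gr_Lap hZ hw hw
  simp only [if_true] at h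
  have h2 : Lap c (fun z => Gr c B z w) w ≤ (∑ y, c w y) * Gr c B w w := by
    unfold Lap; rw [Finset.sum_mul]
    exact Finset.sum_le_sum fun y _ => mul_le_mul_of_nonneg_left
      (by linarith [Gr_nonneg hc B y w]) (hc _ _)
  have := mul_le_mul_of_nonneg_right (hΔ w hw) (Gr_nonneg hc B w w)
  linarith

lemma PP_le_Gr {c : X → X → ℝ} (hc : ∀ x y, 0 ≤ c x y) {A B : Finset X} (hZ : 0 < Z c A)
    (hBA : B ⊆ A) {Δ : ℝ} (hΔ0 : 0 ≤ Δ) (hΔ : ∀ x ∈ A, ∑ y, c x y ≤ Δ) {w : X} (hw : w ∈ A) (hwB : w ∉ B)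
    (x : X) : PP c B {w} x ≤ Δ * Gr c A x w := by
  have hZB := Z_pos_mono hc hBA hZ
  refine max_le hc hZB (f := PP c B {w}) (g := fun x => Δ * Gr c A x w) ?_ ?_ x
  · intro x hx
    rw [PP_Lap c (by simpa using hwB) hx, Lap_mul, Gr_Lap hZ (hBA hx) hw, if_neg (fun e : x = w => hwB (e ▸ hx))]
    simp
  · intro x hx
    rw [PP_out hZB _ hx]
    by_cases e : x = w
    · subst e; exact (ind_le_one _).trans (Gr_diag_deg hc hZ hΔ hw)
    · rw [ind_false (by simpa using e)]
      exact mul_nonneg hΔ0 (Gr_nonneg hc _ _ _)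

lemma Gr_mono {c : X → X → ℝ} (hc : ∀ x y, 0 ≤ c x y) {A B : Finset X} (hZ : 0 < Z c A)
    (hBA : B ⊆ A) {w : X} (hw : w ∈ B) (x : X) : Gr c B x w ≤ Gr c A x w := by
  have hZB := Z_pos_mono hc hBA hZ
  refine max_le hc hZB (f := fun x => Gr c B x w) (g := fun x => Gr c A x w) ?_ ?_ x
  · intro x hx
    rw [Gr_Lap hZB hx hw, Gr_Lap hZ (hBA hx) (hBA hw)]
  · intro x hx
    rw [Gr_out hx hw]; exact Gr_nonneg hc _ _ _

/-- the path of `w` inside `B` -/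
noncomputable def Pa (B : Finset X) (p : X → X) (w : X) : Finset X := B.filter (fun v => rch p w v)
noncomputable def glue (π : Finset X) (p q : X → X) (z : X) : X := if z ∈ π then p z else q z
noncomputable def cl (B : Finset X) (w : X) (p : X → X) : X → X := res (Pa B p w) p
noncomputable def EE (B : Finset X) (w : X) : Finset (X → X) := (FF B).image (cl B w)

lemma mem_Pa {B : Finset X} {p : X → X} {w v : X} : v ∈ Pa B p w ↔ v ∈ B ∧ rch p w v := by
  simp [Pa]
lemma Pa_sub (B : Finset X) (p : X → X) (w : X) : Pa B p w ⊆ B := Finset.filter_subset _ _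

/-- two maps agreeing along the path have the same iterates and path -/
lemma Pa_congr {B : Finset X} {p p' : X → X} {w : X} (hp : IsF B p)
    (h : ∀ z ∈ Pa B p w, p' z = p z) (h' : ∀ z, z ∉ B → p' z = z) (k : ℕ) :
    p'^[k] w = p^[k] w :=
  iter_congr fun j _ => by
    by_cases hz : p^[j] w ∈ B
    · exact h _ (mem_Pa.2 ⟨hz, j, rfl⟩)
    · rw [h' _ hz, hp.1 _ hz]
lemma Pa_eq_of_iter {B : Finset X} {p p' : X → X} {w : X} (h : ∀ k, p'^[k] w = p^[k] w) :
    Pa B p' w = Pa B p w := by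
  ext v; simp [mem_Pa, rch, h]

lemma glue_isF {B : Finset X} {p q : X → X} {w : X} (hp : IsF B p)
    (hq : IsF (B \ Pa B p w) q) : IsF B (glue (Pa B p w) p q) := by
  have hout : ∀ z, z ∉ B → glue (Pa B p w) p q z = z := by
    intro z hz
    have h1 : z ∉ Pa B p w := fun h => hz (Pa_sub _ _ _ h)
    have h2 : z ∉ B \ Pa B p w := fun h => hz (Finset.mem_sdiff.1 h).1
    simp [glue, h1, hq.1 z h2]
  refine ⟨hout, fun z => ?_⟩
  have hpath : ∀ z ∈ Pa B p w, ∃ k, (glue (Pa B p w) p q)^[k] z ∉ B := by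
    intro z hz
    obtain ⟨k, hk, hj⟩ := first_hit (hp.2 z)
    refine ⟨k, ?_⟩
    rw [iter_congr (p := p)]
    · exact hk
    · intro j hj'
      have h1 := hj j hj'
      simp only [not_not] at h1
      have : p^[j] z ∈ Pa B p w := mem_Pa.2 ⟨h1, rch_trans (mem_Pa.1 hz).2 ⟨j, rfl⟩⟩
      simp [glue, this]
  obtain ⟨k, hk, hj⟩ := first_hit (hq.2 z)
  have e : (glue (Pa B p w) p q)^[k] z = q^[k] z := by
    refine iter_congr fun j hj' => ?_
    have h1 := hj j hj'
    simp only [not_not] at h1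
    simp [glue, (Finset.mem_sdiff.1 h1).2]
  by_cases hkB : q^[k] z ∈ B
  · have : q^[k] z ∈ Pa B p w := by
      by_contra h; exact hk (Finset.mem_sdiff.2 ⟨hkB, h⟩)
    obtain ⟨l, hl⟩ := hpath _ this
    refine ⟨l + k, ?_⟩
    rw [Function.iterate_add_apply, e]; exact hl
  · exact ⟨k, by rw [e]; exact hkB⟩

lemma cl_iter {B : Finset X} {p : X → X} (w : X) (hp : IsF B p) (k : ℕ) :
    (cl B w p)^[k] w = p^[k] w :=
  Pa_congr hp (fun z hz => by simp [cl, res, hz])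
    (fun z hz => by simp [cl, res, mem_Pa, hz]) k
lemma cl_isF {B : Finset X} {p : X → X} (w : X) (hp : IsF B p) : IsF (Pa B p w) (cl B w p) :=
  res_isF hp (Pa_sub _ _ _)
lemma cl_Pa {B : Finset X} {p : X → X} (w : X) (hp : IsF B p) : Pa B (cl B w p) w = Pa B p w :=
  Pa_eq_of_iter (cl_iter w hp)
lemma glue_cl {B : Finset X} (w : X) (p q : X → X) :
    glue (Pa B p w) (cl B w p) q = glue (Pa B p w) p q := by
  funext z; unfold glue cl res; split_ifs <;> rfl
lemma glue_iter {B : Finset X} {p q : X → X} {w : X} (hp : IsF B p)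
    (hq : IsF (B \ Pa B p w) q) (k : ℕ) : (glue (Pa B p w) p q)^[k] w = p^[k] w :=
  Pa_congr hp (fun z hz => by simp [glue, hz]) (glue_isF hp hq).1 k

/-- disintegration along a path -/
lemma S_path (c : X → X → ℝ) (B : Finset X) (w : X) (Φ : (X → X) → ℝ) :
    S c B Φ = ∑ η ∈ EE B w, wt c (Pa B η w) η *
      S c (B \ Pa B η w) (fun q => Φ (glue (Pa B η w) η q)) := by
  unfold S
  simp only [Finset.mul_sum]
  rw [Finset.sum_sigma']
  symm
  refine Finset.sum_nbij' (fun s => glue (Pa B s.1 w) s.1 s.2)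
    (fun p => ⟨cl B w p, res (B \ Pa B p w) p⟩) ?_ ?_ ?_ ?_ ?_
  · rintro ⟨η, q⟩ h
    simp only [Finset.mem_sigma, EE, Finset.mem_image, mem_FF] at h ⊢
    obtain ⟨⟨p, hp, rfl⟩, hq⟩ := h
    rw [cl_Pa w hp] at hq ⊢
    rw [glue_cl]; exact glue_isF hp hq
  · intro p hp
    simp only [Finset.mem_sigma, EE, Finset.mem_image, mem_FF] at hp ⊢
    refine ⟨⟨p, hp, rfl⟩, ?_⟩
    rw [cl_Pa w hp]
    exact res_isF hp Finset.sdiff_subset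
  · rintro ⟨η, q⟩ h
    simp only [Finset.mem_sigma, EE, Finset.mem_image, mem_FF] at h ⊢
    obtain ⟨⟨p, hp, rfl⟩, hq⟩ := h
    rw [cl_Pa w hp] at hq ⊢
    rw [glue_cl]
    have e : Pa B (glue (Pa B p w) p q) w = Pa B p w := Pa_eq_of_iter (glue_iter hp hq)
    congr 1
    · unfold cl; rw [e]; funext z; unfold res glue; split_ifs <;> rfl
    · rw [e]; funext z; unfold res glue
      by_cases h1 : z ∈ B \ Pa B p w
      · simp [h1, (Finset.mem_sdiff.1 h1).2]
      · rw [if_neg h1, hq.1 z h1]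
  · intro p hp
    rw [mem_FF] at hp
    simp only [cl_Pa w hp]
    rw [glue_cl]
    funext z
    unfold glue res
    by_cases h1 : z ∈ Pa B p w
    · simp [h1]
    · by_cases h2 : z ∈ B
      · simp [h1, h2]
      · simp [h1, h2, hp.1 z h2]
  · rintro ⟨η, q⟩ h
    simp only [Finset.mem_sigma, EE, Finset.mem_image, mem_FF] at h ⊢
    obtain ⟨⟨p, hp, rfl⟩, hq⟩ := h
    rw [cl_Pa w hp] at hq ⊢
    rw [glue_cl, ← mul_assoc]
    congr 1
    unfold wt
    rw [← Finset.prod_sdiff (Pa_sub B p w), mul_comm]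
    congr 1
    · refine Finset.prod_congr rfl fun z hz => ?_
      simp [glue, (Finset.mem_sdiff.1 hz).2]
    · refine Finset.prod_congr rfl fun z hz => ?_
      simp [glue, cl, res, hz]

/-- properties of η ∈ EE -/
lemma EE_spec {B : Finset X} {w : X} {η : X → X} (h : η ∈ EE B w) :
    IsF (Pa B η w) η ∧ ∀ q, IsF (B \ Pa B η w) q → IsF B (glue (Pa B η w) η q) ∧
      (∀ k, (glue (Pa B η w) η q)^[k] w = η^[k] w) := by
  simp only [EE, Finset.mem_image, mem_FF] at h
  obtain ⟨p, hp, rfl⟩ := h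
  rw [cl_Pa w hp]
  refine ⟨cl_isF w hp, fun q hq => ?_⟩
  rw [glue_cl]
  exact ⟨glue_isF hp hq, fun k => by rw [glue_iter hp hq, cl_iter w hp]⟩

lemma S_path_le {c : X → X → ℝ} (hc : ∀ x y, 0 ≤ c x y) {B : Finset X} (w : X)
    {Φ Ψ : (X → X) → ℝ}
    (h : ∀ η ∈ EE B w, S c (B \ Pa B η w) (fun q => Φ (glue (Pa B η w) η q)) ≤
      S c (B \ Pa B η w) (fun q => Ψ (glue (Pa B η w) η q))) : S c B Φ ≤ S c B Ψ := by
  rw [S_path c B w Φ, S_path c B w Ψ]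
  exact Finset.sum_le_sum fun η hη => mul_le_mul_of_nonneg_left (h η hη) (wt_nonneg hc _ _)

lemma glue_of_not_mem {π : Finset X} (p q : X → X) {z : X} (h : z ∉ π) : glue π p q z = q z := by
  simp [glue, h]
lemma glue_of_mem {π : Finset X} (p q : X → X) {z : X} (h : z ∈ π) : glue π p q z = p z := by
  simp [glue, h]

/-- before hitting π the glued map equals q -/
lemma glue_first {π : Finset X} {p q : X → X} {x : X} {j : ℕ}
    (h : ∀ i < j, (glue π p q)^[i] x ∉ π) : q^[j] x = (glue π p q)^[j] x :=
  iter_congr fun i hi => by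
    exact (glue_of_not_mem p q (h i hi)).symm
lemma glue_first' {π : Finset X} {p q : X → X} {x : X} {j : ℕ}
    (h : ∀ i < j, q^[i] x ∉ π) : (glue π p q)^[j] x = q^[j] x :=
  iter_congr fun i hi => by
    exact glue_of_not_mem p q (h i hi)

/-- K-inequality -/
lemma K_ineq {c : X → X → ℝ} (hc : ∀ x y, 0 ≤ c x y) {B : Finset X} {x w : X} (hw : w ∈ B)
    {I : Set ℕ} (hI : IsLowerSet I) {F : (X → X) → ℝ} (hF0 : ∀ p, 0 ≤ F p)
    (hF : ∀ p p' : X → X, (∀ k, p'^[k] w = p^[k] w) → F p' = F p) {h : ℝ}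
    (hh : ∀ π ⊆ B, w ∈ π → S c (B \ π) (fun q => ind (∃ k ∈ I, q^[k] x = w)) ≤ h * Z c (B \ π)) :
    S c B (fun p => ind (∃ k ∈ I, p^[k] x = w) * F p) ≤ h * S c B F := by
  rw [← S_mul]
  refine S_path_le hc w fun η hη => ?_
  obtain ⟨hη1, hη2⟩ := EE_spec hη
  have hwπ : w ∈ Pa B η w := mem_Pa.2 ⟨hw, rch_refl _ _⟩
  calc S c (B \ Pa B η w) (fun q => ind (∃ k ∈ I, (glue (Pa B η w) η q)^[k] x = w) *
        F (glue (Pa B η w) η q))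
      ≤ S c (B \ Pa B η w) (fun q => F η * ind (∃ k ∈ I, q^[k] x = w)) := by
        refine S_mono hc fun q hq => ?_
        rw [hF η _ (hη2 q hq).2, mul_comm]
        refine mul_le_mul_of_nonneg_left (ind_mono ?_) (hF0 _)
        rintro ⟨k, hkI, hk⟩
        obtain ⟨j, hj, hj'⟩ := first_hit (P := fun j => (glue (Pa B η w) η q)^[j] x ∈ Pa B η w)
          ⟨k, by rw [hk]; exact hwπ⟩
        have hjk : j ≤ k := by
          by_contra hlt
          exact hj' k (by omega) (by rw [hk]; exact hwπ)
        refine ⟨j, hI hjk hkI, ?_⟩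
        rw [glue_first hj']
        have h1 : rch (glue (Pa B η w) η q) w ((glue (Pa B η w) η q)^[j] x) := by
          obtain ⟨l, hl⟩ := (mem_Pa.1 hj).2
          exact ⟨l, by rw [(hη2 q hq).2, hl]⟩
        have h2 : rch (glue (Pa B η w) η q) ((glue (Pa B η w) η q)^[j] x) w :=
          ⟨k - j, by rw [← Function.iterate_add_apply, Nat.sub_add_cancel hjk, hk]⟩
        exact (hη2 q hq).1.antisymm h2 h1
    _ = F η * S c (B \ Pa B η w) (fun q => ind (∃ k ∈ I, q^[k] x = w)) := S_mul _ _ _ _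
    _ ≤ F η * (h * Z c (B \ Pa B η w)) :=
        mul_le_mul_of_nonneg_left (hh _ (Pa_sub _ _ _) hwπ) (hF0 _)
    _ = S c (B \ Pa B η w) (fun q => h * F (glue (Pa B η w) η q)) := by
        rw [← mul_assoc, ← S_const]
        refine S_congr fun q hq => ?_
        rw [hF η _ (hη2 q hq).2, mul_comm]

/-- unrestricted version with Green function bound -/
lemma K_green {c : X → X → ℝ} (hc : ∀ x y, 0 ≤ c x y) {A B : Finset X} (hZ : 0 < Z c A)
    (hBA : B ⊆ A) {Δ : ℝ} (hΔ0 : 0 ≤ Δ) (hΔ : ∀ x ∈ A, ∑ y, c x y ≤ Δ) {x w : X} (hw : w ∈ B)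
    {F : (X → X) → ℝ} (hF0 : ∀ p, 0 ≤ F p)
    (hF : ∀ p p' : X → X, (∀ k, p'^[k] w = p^[k] w) → F p' = F p) :
    S c B (fun p => ind (rch p x w) * F p) ≤ (Δ * Gr c A x w) * S c B F := by
  have := K_ineq hc (x := x) hw (I := Set.univ) (fun _ _ _ _ => trivial) hF0 hF
    (h := Δ * Gr c A x w) (by
      intro π hπ hwπ
      have h1 := PP_le_Gr hc hZ (B := B \ π) (Finset.sdiff_subset.trans hBA) hΔ0 hΔ (hBA hw)
        (fun h => (Finset.mem_sdiff.1 h).2 hwπ) x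
      unfold PP at h1
      rw [div_le_iff₀ (Z_pos_mono hc (Finset.sdiff_subset.trans hBA) hZ)] at h1
      simpa [rch_att, att] using h1)
  simpa [rch] using this

end Gen2

section Gen3
variable {X : Type} [Fintype X] [DecidableEq X]

noncomputable def Qf (ψ : X → ℝ) (B : Finset X) (p : X → X) (x : X) : ℝ :=
  ∏ v ∈ Pa B p x, (1 + ψ v)

lemma Pa_step {B : Finset X} (p : X → X) {x : X} (hx : x ∈ B) :
    Pa B p x = insert x (Pa B p (p x)) := by
  ext v
  simp only [mem_Pa, Finset.mem_insert]
  constructor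
  · rintro ⟨h1, h2⟩
    rcases rch_cases h2 with h | h
    · left; exact h.symm
    · right; exact ⟨h1, h⟩
  · rintro (rfl | ⟨h1, h2⟩)
    · exact ⟨hx, rch_refl _ _⟩
    · exact ⟨h1, rch_trans (rch_step _ _) h2⟩
lemma Pa_out {B : Finset X} {p : X → X} (hp : IsF B p) {x : X} (hx : x ∉ B) : Pa B p x = ∅ := by
  ext v
  simp only [mem_Pa, Finset.notMem_empty, iff_false, not_and]
  intro h1 h2
  exact hx (hp.eq_of_rch hx h2 ▸ h1)

lemma Qf_pos {ψ : X → ℝ} (hψ : ∀ v, 0 ≤ ψ v) (B : Finset X) (p : X → X) (x : X) :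
    0 ≤ Qf ψ B p x := Finset.prod_nonneg fun v _ => by linarith [hψ v]

lemma Qf_le {ψ : X → ℝ} (hψ : ∀ v, 0 ≤ ψ v) {B : Finset X} {p : X → X} (hp : IsF B p) (x : X) :
    Qf ψ B p x ≤ 1 + ∑ v ∈ Pa B p x, ψ v * Qf ψ B p v := by
  obtain ⟨k, hk⟩ := hp.2 x
  induction k generalizing x with
  | zero =>
    simp only [Function.iterate_zero, id_eq] at hk
    simp [Qf, Pa_out hp hk]
  | succ k ih =>
    by_cases hx : x ∈ B
    · have h1 := ih (p x) hk
      have hn : x ∉ Pa B p (p x) := fun h => hp.no_cycle hx (mem_Pa.1 h).2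
      have e : Qf ψ B p x = (1 + ψ x) * Qf ψ B p (p x) := by
        unfold Qf; rw [Pa_step p hx, Finset.prod_insert hn]
      have h0 := Qf_pos hψ B p (p x)
      have h2 : Qf ψ B p (p x) ≤ Qf ψ B p x := by
        rw [e]; nlinarith [hψ x]
      rw [Pa_step p hx, Finset.sum_insert hn]
      have h3 := mul_le_mul_of_nonneg_left h2 (hψ x)
      nlinarith
    · simp [Qf, Pa_out hp hx]

lemma E_Qf {c : X → X → ℝ} (hc : ∀ x y, 0 ≤ c x y) {B : Finset X} (hZ : 0 < Z c B)
    {Δ : ℝ} (hΔ0 : 0 ≤ Δ) (hΔ : ∀ x ∈ B, ∑ y, c x y ≤ Δ) {ψ : X → ℝ} (hψ : ∀ v, 0 ≤ ψ v)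
    (hG : ∀ x, ∑ v ∈ B, ψ v * (Δ * Gr c B x v) ≤ 1 / 2) (x : X) :
    S c B (fun p => Qf ψ B p x) ≤ 2 * Z c B := by
  have hm0 : ∀ x, 0 ≤ S c B (fun p => Qf ψ B p x) := fun x =>
    S_nonneg hc fun p _ => Qf_pos hψ B p x
  obtain ⟨x0, -, hx0⟩ := Finset.exists_max_image Finset.univ
    (fun x => S c B (fun p => Qf ψ B p x)) ⟨x, Finset.mem_univ x⟩
  have key : ∀ x, S c B (fun p => Qf ψ B p x) ≤
      Z c B + 1 / 2 * S c B (fun p => Qf ψ B p x0) := by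
    intro x
    calc S c B (fun p => Qf ψ B p x)
        ≤ S c B (fun p => 1 + ∑ v ∈ B, ψ v * (ind (rch p x v) * Qf ψ B p v)) := by
          refine S_mono hc fun p hp => (Qf_le hψ hp x).trans ?_
          have : ∑ v ∈ Pa B p x, ψ v * Qf ψ B p v
              = ∑ v ∈ B, ψ v * (ind (rch p x v) * Qf ψ B p v) := by
            unfold Pa; rw [Finset.sum_filter]
            refine Finset.sum_congr rfl fun v _ => ?_
            unfold ind; split_ifs <;> simp [Pa]
          linarith
      _ = Z c B + ∑ v ∈ B, ψ v * S c B (fun p => ind (rch p x v) * Qf ψ B p v) := by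
          rw [S_add, S_sum]; unfold Z; congr 1
          exact Finset.sum_congr rfl fun v _ => S_mul _ _ _ _
      _ ≤ Z c B + ∑ v ∈ B, ψ v * (Δ * Gr c B x v) * S c B (fun p => Qf ψ B p x0) := by
          refine add_le_add_right (Finset.sum_le_sum fun v hv => ?_) _
          rw [mul_assoc]
          refine mul_le_mul_of_nonneg_left ?_ (hψ v)
          refine (K_green hc hZ (Finset.Subset.refl B) hΔ0 hΔ hv (F := fun p => Qf ψ B p v)
            (fun p => Qf_pos hψ B p v) ?_).trans ?_
          · intro p p' h; unfold Qf; rw [Pa_eq_of_iter h]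
          · exact mul_le_mul_of_nonneg_left (hx0 v (Finset.mem_univ _))
              (mul_nonneg hΔ0 (Gr_nonneg hc _ _ _))
      _ ≤ _ := by
          rw [← Finset.sum_mul]
          have := mul_le_mul_of_nonneg_right (hG x) (hm0 x0)
          linarith
  have h1 := key x
  have h2 := key x0
  linarith

/-- monotone domination -/
lemma domination {c : X → X → ℝ} (hc : ∀ x y, 0 ≤ c x y) {Γ : Set X} {f : (X → X) → ℝ}
    (hf : ∀ p p' : X → X, (∀ x k, p^[k] x ∈ Γ → p'^[k] x ∈ Γ) → f p' ≤ f p)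
    (hf0 : ∀ p, 0 ≤ f p) :
    ∀ (n : ℕ) (B : Finset X), B.card ≤ n → (∀ g ∈ Γ, g ∉ B) → 0 < Z c B → ∀ B' ⊆ B,
      S c B f * Z c B' ≤ S c B' f * Z c B := by
  intro n
  induction n with
  | zero =>
    intro B hB hΓ hZ B' hB'
    have h1 : B = ∅ := Finset.card_eq_zero.1 (by omega)
    subst h1
    rw [Finset.subset_empty.1 hB']
  | succ n ih =>
    intro B hB hΓ hZ B' hB'
    by_cases hEq : B' = B
    · rw [hEq]
    obtain ⟨u, huB, huB'⟩ : ∃ u ∈ B, u ∉ B' := by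
      by_contra h; push Not at h
      exact hEq (Finset.Subset.antisymm hB' h)
    set D := B.erase u with hD
    have hDB : D ⊆ B := Finset.erase_subset _ _
    have hDc : D.card ≤ n := by
      rw [hD, Finset.card_erase_of_mem huB]; omega
    have hΓD : ∀ g ∈ Γ, g ∉ D := fun g hg h => hΓ g hg (hDB h)
    have huΓ : u ∉ Γ := fun h => hΓ u h huB
    have hZD : 0 < Z c D := Z_pos_mono hc hDB hZ
    have hB'D : B' ⊆ D := fun z hz => Finset.mem_erase.2 ⟨fun e => huB' (e ▸ hz), hB' hz⟩
    have hI := ih D hDc hΓD hZD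
    -- key correlation
    have corr : ∀ y, S c D (fun q => ind (¬ rch q y u) * f q) * Z c D ≤
        S c D f * S c D (fun q => ind (¬ rch q y u)) := by
      intro y
      have h1 : S c D f * S c D (fun q => ind (rch q y u)) ≤
          S c D (fun q => ind (rch q y u) * f q) * Z c D := by
        rw [mul_comm (S c D (fun q => ind (rch q y u) * f q)), ← S_mul, ← S_mul]
        refine S_path_le hc y fun η hη => ?_
        obtain ⟨hη1, hη2⟩ := EE_spec hη
        have hr : ∀ q, IsF (D \ Pa D η y) q →
            (rch (glue (Pa D η y) η q) y u ↔ rch η y u) := fun q hq => by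
          unfold rch; simp only [(hη2 q hq).2]
        by_cases hyu : rch η y u
        · calc S c (D \ Pa D η y) (fun q => S c D f * ind (rch (glue (Pa D η y) η q) y u))
              ≤ S c (D \ Pa D η y) (fun _ => S c D f) := by
                refine S_mono hc fun q hq => ?_
                rw [ind_true ((hr q hq).2 hyu), mul_one]
            _ = S c D f * Z c (D \ Pa D η y) := S_const _ _ _
            _ ≤ S c (D \ Pa D η y) f * Z c D := hI _ Finset.sdiff_subset
            _ = S c (D \ Pa D η y) (fun q => Z c D * f q) := by rw [S_mul, mul_comm]
            _ ≤ _ := by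
                refine S_mono hc fun q hq => ?_
                rw [ind_true ((hr q hq).2 hyu), one_mul]
                refine mul_le_mul_of_nonneg_left (hf _ _ ?_) hZD.le
                intro x k hk
                have hbad : ∀ i, (glue (Pa D η y) η q)^[i] x ∈ Pa D η y → i ≤ k → False := by
                  intro i hi hik
                  obtain ⟨l, hl⟩ := (mem_Pa.1 hi).2
                  have e1 : (glue (Pa D η y) η q)^[k] x = (glue (Pa D η y) η q)^[(k - i) + l] y := by
                    rw [Function.iterate_add_apply, (hη2 q hq).2 l, hl,
                      ← Function.iterate_add_apply, Nat.sub_add_cancel hik]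
                  have hgF := (hη2 q hq).1
                  rcases rch_total ((hr q hq).2 hyu) ⟨(k - i) + l, e1.symm⟩ with h | h
                  · have := hgF.eq_of_rch (by simp [hD]) h
                    rw [this] at hk; exact huΓ hk
                  · by_cases hz : (glue (Pa D η y) η q)^[k] x ∈ D
                    · exact hΓD _ hk hz
                    · have := hgF.eq_of_rch hz h
                      rw [← this] at hk; exact huΓ hk
                rw [glue_first (fun i hi h => hbad i h hi.le)]
                exact hk
        · refine le_of_eq (S_congr fun q hq => ?_)
          rw [ind_false (fun h => hyu ((hr q hq).1 h))]; ring
      have e1 : S c D (fun q => ind (¬ rch q y u) * f q) =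
          S c D f - S c D (fun q => ind (rch q y u) * f q) := by
        rw [← S_sub]; exact S_congr fun q _ => by rw [ind_not]; ring
      have e2 : S c D (fun q => ind (¬ rch q y u)) =
          Z c D - S c D (fun q => ind (rch q y u)) := by
        unfold Z; rw [← S_sub]; exact S_congr fun q _ => by rw [ind_not]
      rw [e1, e2]; nlinarith
    have step : S c B f * Z c D ≤ S c D f * Z c B := by
      rw [S_step c huB f]
      conv_rhs => rw [Z, S_step c huB]
      rw [Finset.sum_mul, Finset.mul_sum]
      refine Finset.sum_le_sum fun y _ => ?_
      have h1 : S c D (fun q => ind (¬ rch q y u) * f (Function.update q u y)) ≤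
          S c D (fun q => ind (¬ rch q y u) * f q) := by
        refine S_mono hc fun q hq => mul_le_mul_of_nonneg_left (hf _ _ ?_) (ind_nonneg _)
        intro x k hk
        rw [iter_congr (p := q)]
        · exact hk
        · intro j hj
          refine Function.update_of_ne (fun e => ?_) _ _
          have : k = (k - j) + j := by omega
          rw [this, Function.iterate_add_apply, e, hq.fix (by simp [hD])] at hk
          exact huΓ hk
      have h2 := corr y
      have h3 := mul_le_mul_of_nonneg_right h1 hZD.le
      have h4 := mul_le_mul_of_nonneg_left (h3.trans h2) (hc u y)
      simp only [mul_one]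
      linarith
    have h5 := hI B' hB'D
    have hZB' : 0 < Z c B' := Z_pos_mono hc hB' hZ
    have h6 := mul_le_mul_of_nonneg_right step hZB'.le
    have h7 := mul_le_mul_of_nonneg_right h5 hZ.le
    have : (S c B f * Z c B') * Z c D ≤ (S c B' f * Z c B) * Z c D := by nlinarith
    exact le_of_mul_le_mul_right this hZD

lemma res_res {B B' : Finset X} (h : B' ⊆ B) (p : X → X) : res B' (res B p) = res B' p := by
  funext z; unfold res
  by_cases hz : z ∈ B'
  · simp [hz, h hz]
  · simp [hz]
lemma res_self {B : Finset X} {p : X → X} (hp : IsF B p) : res B p = p := by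
  funext z; unfold res
  by_cases hz : z ∈ B
  · simp [hz]
  · simp [hz, hp.1 z hz]

lemma S_union_le {c : X → X → ℝ} (hc : ∀ x y, 0 ≤ c x y) {B₁ B₂ : Finset X}
    (hd : Disjoint B₁ B₂) {g₁ g₂ : (X → X) → ℝ} (h₁ : ∀ p, 0 ≤ g₁ p) (h₂ : ∀ p, 0 ≤ g₂ p) :
    S c (B₁ ∪ B₂) (fun p => g₁ (res B₁ p) * g₂ (res B₂ p)) ≤ S c B₁ g₁ * S c B₂ g₂ := by
  set G : (X → X) × (X → X) → ℝ := fun x => wt c B₁ x.1 * g₁ x.1 * (wt c B₂ x.2 * g₂ x.2) with hG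
  have hG0 : ∀ x, 0 ≤ G x := fun x => mul_nonneg (mul_nonneg (wt_nonneg hc _ _) (h₁ _))
    (mul_nonneg (wt_nonneg hc _ _) (h₂ _))
  have e1 : S c B₁ g₁ * S c B₂ g₂ = ∑ x ∈ FF B₁ ×ˢ FF B₂, G x := by
    unfold S; rw [Finset.sum_mul_sum, ← Finset.sum_product']
  have e2 : S c (B₁ ∪ B₂) (fun p => g₁ (res B₁ p) * g₂ (res B₂ p)) =
      ∑ p ∈ FF (B₁ ∪ B₂), G (res B₁ p, res B₂ p) := by
    unfold S
    refine Finset.sum_congr rfl fun p _ => ?_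
    have : wt c (B₁ ∪ B₂) p = wt c B₁ (res B₁ p) * wt c B₂ (res B₂ p) := by
      unfold wt; rw [Finset.prod_union hd]
      congr 1 <;> exact Finset.prod_congr rfl fun z hz => by simp [res, hz]
    rw [this, hG]; ring
  have hinj : Set.InjOn (fun p => (res B₁ p, res B₂ p)) (FF (B₁ ∪ B₂) : Set (X → X)) := by
    intro p hp p' hp' h
    simp only [Finset.mem_coe, mem_FF] at hp hp'
    simp only [Prod.mk.injEq] at h
    funext z
    by_cases h1 : z ∈ B₁
    · have := congrFun h.1 z; simpa [res, h1] using this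
    · by_cases h2 : z ∈ B₂
      · have := congrFun h.2 z; simpa [res, h2] using this
      · rw [hp.1 z (by simp [h1, h2]), hp'.1 z (by simp [h1, h2])]
  rw [e1, e2, ← Finset.sum_image (f := G) hinj]
  refine Finset.sum_le_sum_of_subset_of_nonneg ?_ (fun x _ _ => hG0 x)
  intro x hx
  simp only [Finset.mem_image, mem_FF] at hx
  obtain ⟨p, hp, rfl⟩ := hx
  simp only [Finset.mem_product, mem_FF]
  exact ⟨res_isF hp Finset.subset_union_left, res_isF hp Finset.subset_union_right⟩

lemma glue2_isF {B₁ B₂ : Finset X} {p q : X → X} (hp : IsF B₁ p) (hq : IsF B₂ q)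
    (h1 : ∀ x ∈ B₁, p x ∉ B₂) (hd : Disjoint B₁ B₂) : IsF (B₁ ∪ B₂) (glue B₁ p q) := by
  have hout : ∀ z, z ∉ B₁ ∪ B₂ → glue B₁ p q z = z := by
    intro z hz
    rw [Finset.mem_union, not_or] at hz
    rw [glue_of_not_mem _ _ hz.1, hq.1 z hz.2]
  refine ⟨hout, fun z => ?_⟩
  have hB1 : ∀ z ∈ B₁, ∃ k, (glue B₁ p q)^[k] z ∉ B₁ ∪ B₂ := by
    intro z hz
    obtain ⟨k, hk, hj⟩ := first_hit (hp.2 z)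
    have e : (glue B₁ p q)^[k] z = p^[k] z := iter_congr fun j hj' => by
      have := hj j hj'
      simp only [not_not] at this
      exact glue_of_mem _ _ this
    refine ⟨k, ?_⟩
    rw [e, Finset.mem_union, not_or]
    refine ⟨hk, ?_⟩
    cases k with
    | zero => exact absurd hz hk
    | succ k =>
      have := hj k (by omega)
      simp only [not_not] at this
      rw [Function.iterate_succ_apply']
      exact h1 _ this
  by_cases hz : ∃ k, q^[k] z ∈ B₁
  · obtain ⟨k, hk, hj⟩ := first_hit hz
    obtain ⟨l, hl⟩ := hB1 _ hk
    refine ⟨l + k, ?_⟩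
    rw [Function.iterate_add_apply, glue_first' hj]; exact hl
  · push Not at hz
    obtain ⟨k, hk⟩ := hq.2 z
    refine ⟨k, ?_⟩
    rw [glue_first' (fun i _ => hz i), Finset.mem_union, not_or]
    exact ⟨hz k, hk⟩

lemma Z_union_ge {c : X → X → ℝ} (hc : ∀ x y, 0 ≤ c x y) {B₁ B₂ : Finset X}
    (hd : Disjoint B₁ B₂) (h0 : ∀ x ∈ B₁, ∀ y ∈ B₂, c x y = 0) :
    Z c B₁ * Z c B₂ ≤ Z c (B₁ ∪ B₂) := by
  set P1 := (FF B₁).filter (fun p => ∀ x ∈ B₁, p x ∉ B₂) with hP1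
  have e0 : Z c B₁ = ∑ p ∈ P1, wt c B₁ p := by
    unfold Z S; simp only [mul_one]
    rw [hP1]; symm
    refine Finset.sum_filter_of_ne fun p _ h x hx hpx => h ?_
    unfold wt; exact Finset.prod_eq_zero hx (h0 x hx _ hpx)
  have e1 : Z c B₁ * Z c B₂ = ∑ x ∈ P1 ×ˢ FF B₂, wt c B₁ x.1 * wt c B₂ x.2 := by
    rw [e0]; unfold Z S; simp only [mul_one]
    rw [Finset.sum_mul_sum, ← Finset.sum_product']
  have e2 : Z c (B₁ ∪ B₂) = ∑ p ∈ FF (B₁ ∪ B₂), wt c (B₁ ∪ B₂) p := by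
    unfold Z S; simp only [mul_one]
  have hd' : ∀ z ∈ B₂, z ∉ B₁ := fun z hz h => (Finset.disjoint_left.1 hd h) hz
  have e3 : ∀ x ∈ P1 ×ˢ FF B₂, wt c B₁ x.1 * wt c B₂ x.2 = wt c (B₁ ∪ B₂) (glue B₁ x.1 x.2) := by
    intro x _
    unfold wt; rw [Finset.prod_union hd]
    congr 1
    · exact Finset.prod_congr rfl fun z hz => by rw [glue_of_mem _ _ hz]
    · exact Finset.prod_congr rfl fun z hz => by rw [glue_of_not_mem _ _ (hd' z hz)]
  rw [e1, e2, Finset.sum_congr rfl e3]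
  have hinj : Set.InjOn (fun x : (X → X) × (X → X) => glue B₁ x.1 x.2) (P1 ×ˢ FF B₂ : Finset _) := by
    rintro ⟨p, q⟩ h ⟨p', q'⟩ h' e
    simp only [hP1, Finset.coe_product, Set.mem_prod, Finset.mem_coe, Finset.mem_filter, mem_FF] at h h'
    simp only at e
    have hz : ∀ z, glue B₁ p q z = glue B₁ p' q' z := fun z => congrFun e z
    ext z
    · by_cases hzB : z ∈ B₁
      · have := hz z; rwa [glue_of_mem _ _ hzB, glue_of_mem _ _ hzB] at this
      · simp only; rw [h.1.1.1 z hzB, h'.1.1.1 z hzB]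
    · by_cases hzB : z ∈ B₁
      · have h2 : z ∉ B₂ := fun hh => hd' z hh hzB
        simp only; rw [h.2.1 z h2, h'.2.1 z h2]
      · have := hz z; rwa [glue_of_not_mem _ _ hzB, glue_of_not_mem _ _ hzB] at this
  rw [← Finset.sum_image (f := fun p => wt c (B₁ ∪ B₂) p) hinj]
  refine Finset.sum_le_sum_of_subset_of_nonneg ?_ (fun x _ _ => wt_nonneg hc _ _)
  intro r hr
  rw [Finset.mem_image] at hr
  obtain ⟨⟨p, q⟩, h, rfl⟩ := hr
  simp only [hP1, Finset.mem_product, Finset.mem_filter, mem_FF] at h ⊢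
  exact glue2_isF h.1.1 h.2 h.1.2 hd

lemma S_biUnion {ι : Type} {c : X → X → ℝ} (hc : ∀ x y, 0 ≤ c x y) (s : Finset ι)
    (B : ι → Finset X) (g : ι → (X → X) → ℝ) (hg : ∀ i p, 0 ≤ g i p)
    (hd : ∀ i ∈ s, ∀ j ∈ s, i ≠ j → ∀ x ∈ B i, ∀ y ∈ B j, x ≠ y ∧ c x y = 0) :
    S c (s.biUnion B) (fun p => ∏ i ∈ s, g i (res (B i) p)) ≤ ∏ i ∈ s, S c (B i) (g i) ∧
    ∏ i ∈ s, Z c (B i) ≤ Z c (s.biUnion B) := by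
  induction s using Finset.induction_on with
  | empty =>
    have h : S c (∅ : Finset X) (fun _ => 1) = 1 := by
      unfold S
      have : FF (∅ : Finset X) = {id} := by
        ext p; simp only [mem_FF, Finset.mem_singleton]
        constructor
        · intro h; funext x; exact h.1 x (by simp)
        · rintro rfl; exact ⟨by simp, fun x => ⟨0, by simp⟩⟩
      rw [this]; simp [wt]
    simp [Z, h]
  | insert a s ha ih =>
    obtain ⟨ih1, ih2⟩ := ih (fun i hi j hj => hd i (Finset.mem_insert_of_mem hi) j
      (Finset.mem_insert_of_mem hj))
    have hne : ∀ j ∈ s, a ≠ j := fun j hj e => ha (e ▸ hj)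
    have hdis : Disjoint (B a) (s.biUnion B) := by
      rw [Finset.disjoint_left]
      intro x hx hx'
      obtain ⟨j, hj, hxj⟩ := Finset.mem_biUnion.1 hx'
      exact (hd a (Finset.mem_insert_self _ _) j (Finset.mem_insert_of_mem hj) (hne j hj) x hx x hxj).1 rfl
    rw [Finset.biUnion_insert, Finset.prod_insert ha, Finset.prod_insert ha]
    constructor
    · have h1 := S_union_le hc hdis (g₁ := g a) (g₂ := fun p => ∏ i ∈ s, g i (res (B i) p))
        (hg a) (fun p => Finset.prod_nonneg fun i _ => hg _ _)
      refine le_trans (le_of_eq ?_) (h1.trans (mul_le_mul_of_nonneg_left ih1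
        (S_nonneg hc fun p _ => hg a p)))
      refine S_congr fun p _ => ?_
      rw [Finset.prod_insert ha]
      congr 1
      exact Finset.prod_congr rfl fun i hi => by
        rw [res_res (Finset.subset_biUnion_of_mem B hi)]
    · refine le_trans (mul_le_mul_of_nonneg_left ih2 (Z_nonneg hc _)) (Z_union_ge hc hdis ?_)
      intro x hx y hy
      obtain ⟨j, hj, hyj⟩ := Finset.mem_biUnion.1 hy
      exact (hd a (Finset.mem_insert_self _ _) j (Finset.mem_insert_of_mem hj) (hne j hj) x hx y hyj).2

end Gen3

section Gen4
variable {X : Type} [Fintype X] [DecidableEq X]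

lemma len_le_Pa {B : Finset X} {p : X → X} (hp : IsF B p) {x : X} {k : ℕ}
    (h : ∀ j < k, p^[j] x ∈ B) : k ≤ (Pa B p x).card := by
  have hinj : ∀ i j, i < j → j < k → p^[i] x ≠ p^[j] x := by
    intro i j hij hjk e
    refine hp.no_cycle (h i (by omega)) ⟨j - i - 1, ?_⟩
    rw [← Function.iterate_succ_apply' p, ← Function.iterate_add_apply, e]
    congr 1; congr 1; omega
  calc k = (Finset.range k).card := by simp
    _ ≤ _ := Finset.card_le_card_of_injOn (fun j => p^[j] x) (fun j hj => by
        have hj : j < k := by simpa using hj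
        exact mem_Pa.2 ⟨h j hj, j, rfl⟩) (by
        intro i hi j hj e
        have hi : i < k := by simpa using hi
        have hj : j < k := by simpa using hj
        rcases lt_trichotomy i j with hlt | heq | hlt
        · exact absurd e (hinj i j hlt hj)
        · exact heq
        · exact absurd e.symm (hinj j i hlt hi))

/-- short attachments -/
def attS (Γ : Set X) (ℓ : ℕ) (p : X → X) (x : X) : Prop := ∃ k ≤ ℓ, p^[k] x ∈ Γ
noncomputable def VS (D : Finset X) (Γ : Set X) (ℓ : ℕ) (p : X → X) : ℝ :=
  ∑ x ∈ D, ind (attS Γ ℓ p x)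

lemma attS_ge {B : Finset X} {Γ : Set X} (hΓ : ∀ g ∈ Γ, g ∉ B) {p : X → X} (hp : IsF B p) {ℓ : ℕ} (hℓ : 0 < ℓ)
    (x : X) : ind (att Γ p x) - ind (att Γ p x) * ((Pa B p x).card : ℝ) / ℓ ≤ ind (attS Γ ℓ p x) := by
  have hℓ' : (0:ℝ) < ℓ := by exact_mod_cast hℓ
  by_cases h : att Γ p x
  · rw [ind_true h]
    obtain ⟨k, hk, hj⟩ := first_hit h
    by_cases hkl : k ≤ ℓ
    · rw [ind_true ⟨k, hkl, hk⟩]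
      have : 0 ≤ 1 * ((Pa B p x).card : ℝ) / ℓ := by positivity
      linarith
    · have h1 : k ≤ (Pa B p x).card := len_le_Pa hp fun j hj' => by
        by_contra hB
        have e : k = (k - j) + j := by omega
        rw [e, Function.iterate_add_apply, hp.fix hB] at hk
        exact hj j hj' hk
      have h2 : 1 ≤ 1 * ((Pa B p x).card : ℝ) / ℓ := by
        rw [le_div_iff₀ hℓ', one_mul, one_mul]
        exact_mod_cast (by omega : ℓ ≤ (Pa B p x).card)
      linarith [ind_nonneg (attS Γ ℓ p x)]
  · rw [ind_false h]; simp [ind_nonneg]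

lemma attS_le (Γ : Set X) (ℓ : ℕ) (p : X → X) (x : X) :
    ind (attS Γ ℓ p x) ≤ ind (att Γ p x) := ind_mono fun ⟨k, _, hk⟩ => ⟨k, hk⟩

lemma att_congr {Γ : Set X} {p p' : X → X} {x : X} (h : ∀ k, p'^[k] x = p^[k] x) :
    att Γ p' x ↔ att Γ p x := by unfold att; simp only [h]

lemma PP_S {c : X → X → ℝ} {B : Finset X} (hZ : 0 < Z c B) (Γ : Set X) (x : X) :
    S c B (fun p => ind (att Γ p x)) = PP c B Γ x * Z c B := by
  unfold PP; rw [div_mul_cancel₀ _ hZ.ne']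

lemma Pa_card (B : Finset X) (p : X → X) (x : X) :
    ((Pa B p x).card : ℝ) = ∑ w ∈ B, ind (rch p x w) := by
  unfold Pa ind; simp

lemma region_len {c : X → X → ℝ} (hc : ∀ x y, 0 ≤ c x y) {D : Finset X} (hZ : 0 < Z c D)
    {Δ : ℝ} (hΔ0 : 0 ≤ Δ) (hΔ : ∀ x ∈ D, ∑ y, c x y ≤ Δ) {T : ℝ}
    (hT : ∀ w ∈ D, ∑ x ∈ D, Gr c D x w ≤ T) (Γ : Finset X) :
    ∑ x ∈ D, S c (D \ Γ) (fun p => ind (att ↑Γ p x) * ((Pa (D \ Γ) p x).card : ℝ)) ≤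
      Δ * T * (∑ x ∈ D, PP c (D \ Γ) ↑Γ x) * Z c (D \ Γ) := by
  set B := D \ Γ with hB
  have hBD : B ⊆ D := Finset.sdiff_subset
  have hZB := Z_pos_mono hc hBD hZ
  have hT0 : ∀ w ∈ D, 0 ≤ T := fun w hw =>
    (Finset.sum_nonneg fun x _ => Gr_nonneg hc D x w).trans (hT w hw)
  have h1 : ∀ x, S c B (fun p => ind (att ↑Γ p x) * ((Pa B p x).card : ℝ)) ≤
      ∑ w ∈ B, (Δ * Gr c D x w) * (PP c B ↑Γ w * Z c B) := by
    intro x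
    calc S c B (fun p => ind (att ↑Γ p x) * ((Pa B p x).card : ℝ))
        ≤ S c B (fun p => ∑ w ∈ B, ind (rch p x w) * ind (att ↑Γ p w)) := by
          refine S_mono hc fun p hp => ?_
          rw [Pa_card, Finset.mul_sum]
          refine Finset.sum_le_sum fun w hw => ?_
          by_cases hr : rch p x w
          · rw [ind_true hr, one_mul, mul_one]
            refine ind_mono ?_
            rintro ⟨k, hk⟩
            rcases rch_total hr ⟨k, rfl⟩ with h | h
            · obtain ⟨l, hl⟩ := h
              exact ⟨l, by rw [hl]; exact hk⟩
            · have hn : p^[k] x ∉ B := fun h => (Finset.mem_sdiff.1 h).2 hk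
              have := hp.eq_of_rch hn h
              exact absurd (this ▸ hw) hn
          · rw [ind_false hr]; simp
      _ = ∑ w ∈ B, S c B (fun p => ind (rch p x w) * ind (att ↑Γ p w)) := S_sum _ _ _ _
      _ ≤ _ := by
          refine Finset.sum_le_sum fun w hw => ?_
          rw [← PP_S hZB]
          exact K_green hc hZ hBD hΔ0 hΔ hw (F := fun p => ind (att ↑Γ p w))
            (fun p => ind_nonneg _) (fun p p' h => by rw [att_congr h])
  calc _ ≤ ∑ x ∈ D, ∑ w ∈ B, (Δ * Gr c D x w) * (PP c B ↑Γ w * Z c B) :=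
        Finset.sum_le_sum fun x _ => h1 x
    _ = ∑ w ∈ B, Δ * (∑ x ∈ D, Gr c D x w) * (PP c B ↑Γ w * Z c B) := by
        rw [Finset.sum_comm]
        refine Finset.sum_congr rfl fun w _ => ?_
        rw [Finset.mul_sum, Finset.sum_mul]
    _ ≤ ∑ w ∈ B, Δ * T * (PP c B ↑Γ w * Z c B) := by
        refine Finset.sum_le_sum fun w hw => ?_
        refine mul_le_mul_of_nonneg_right (mul_le_mul_of_nonneg_left (hT w (hBD hw)) hΔ0)
          (mul_nonneg (PP_nonneg hc _ _ _) hZB.le)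
    _ ≤ ∑ w ∈ D, Δ * T * (PP c B ↑Γ w * Z c B) := by
        refine Finset.sum_le_sum_of_subset_of_nonneg hBD fun w hw _ => ?_
        exact mul_nonneg (mul_nonneg hΔ0 (hT0 w hw)) (mul_nonneg (PP_nonneg hc _ _ _) hZB.le)
    _ = _ := by
        rw [← Finset.mul_sum, ← Finset.sum_mul]; ring

lemma PP_union_le {c : X → X → ℝ} (hc : ∀ x y, 0 ≤ c x y) {D : Finset X} (hZ : 0 < Z c D)
    {Δ : ℝ} (hΔ0 : 0 ≤ Δ) (hΔ : ∀ x ∈ D, ∑ y, c x y ≤ Δ) {B π Γ : Finset X} (hBD : B ⊆ D)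
    (hΓ : ∀ g ∈ Γ, g ∉ B) (hπ : π ⊆ B) (x : X) :
    PP c (B \ π) (↑Γ ∪ ↑π) x ≤ PP c B ↑Γ x + ∑ w ∈ π, Δ * Gr c D x w := by
  have hZB := Z_pos_mono hc hBD hZ
  have hZB' := Z_pos_mono hc (Finset.sdiff_subset (s := B) (t := π)) hZB
  have hpos : ∀ x, 0 ≤ ∑ w ∈ π, Δ * Gr c D x w := fun x =>
    Finset.sum_nonneg fun w _ => mul_nonneg hΔ0 (Gr_nonneg hc _ _ _)
  have hEq : ∀ x, PP c B ↑Γ x + ∑ w ∈ π, Δ * Gr c D x w =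
      PP c B ↑Γ x - ∑ w ∈ π, (-Δ) * Gr c D x w := by
    intro x; simp [Finset.sum_neg_distrib]
  rw [hEq x]
  refine max_le hc hZB' (f := PP c (B \ π) (↑Γ ∪ ↑π))
    (g := fun x => PP c B ↑Γ x - ∑ w ∈ π, (-Δ) * Gr c D x w) ?_ ?_ x
  · intro x hx
    have hx' := Finset.mem_sdiff.1 hx
    rw [PP_Lap c _ hx, Lap_sub, PP_Lap c (by simpa using hΓ) hx'.1, Lap_sum,
      Finset.sum_eq_zero, sub_zero]
    · intro w hw
      rw [Lap_mul, Gr_Lap hZ (hBD hx'.1) (hBD (hπ hw)), if_neg (fun e : x = w => hx'.2 (e ▸ hw)), mul_zero]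
    · rintro g (hg | hg) hgB
      · exact hΓ g hg (Finset.mem_sdiff.1 hgB).1
      · exact (Finset.mem_sdiff.1 hgB).2 hg
  · intro x hx
    show _ ≤ PP c B ↑Γ x - ∑ w ∈ π, (-Δ) * Gr c D x w
    rw [← hEq x, PP_out hZB' _ hx]
    by_cases h1 : x ∈ π
    · have h2 := Gr_diag_deg hc hZ hΔ (hBD (hπ h1))
      have h3 : Δ * Gr c D x x ≤ ∑ w ∈ π, Δ * Gr c D x w :=
        Finset.single_le_sum (f := fun w => Δ * Gr c D x w)
          (fun w _ => mul_nonneg hΔ0 (Gr_nonneg hc _ _ _)) h1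
      linarith [ind_le_one (x ∈ (↑Γ ∪ ↑π : Set X)), PP_nonneg hc B ↑Γ x]
    · have hxB : x ∉ B := fun h => hx (Finset.mem_sdiff.2 ⟨h, h1⟩)
      rw [PP_out hZB _ hxB]
      have : ind (x ∈ (↑Γ ∪ ↑π : Set X)) ≤ ind (x ∈ (↑Γ : Set X)) := ind_mono fun h => by
        rcases h with h | h
        · exact h
        · exact absurd h h1
      linarith [hpos x]

lemma region_sq {c : X → X → ℝ} (hc : ∀ x y, 0 ≤ c x y) {D : Finset X} (hZ : 0 < Z c D)
    {Δ : ℝ} (hΔ0 : 0 ≤ Δ) (hΔ : ∀ x ∈ D, ∑ y, c x y ≤ Δ) {T : ℝ}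
    (hT0 : 0 ≤ T) (hT : ∀ w ∈ D, ∑ x ∈ D, Gr c D x w ≤ T) (Γ : Finset X) :
    S c (D \ Γ) (fun p => (∑ x ∈ D, ind (att ↑Γ p x)) ^ 2) ≤
      ((∑ x ∈ D, PP c (D \ Γ) ↑Γ x) ^ 2 + (Δ * T) ^ 2 * (∑ x ∈ D, PP c (D \ Γ) ↑Γ x))
        * Z c (D \ Γ) := by
  have hlen := region_len hc hZ hΔ0 hΔ hT Γ
  set B := D \ Γ with hB
  have hBD : B ⊆ D := Finset.sdiff_subset
  have hZB := Z_pos_mono hc hBD hZ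
  have hΓB : ∀ g ∈ Γ, g ∉ B := fun g hg h => (Finset.mem_sdiff.1 h).2 hg
  set H := ∑ x ∈ D, PP c B ↑Γ x with hH
  have h1 : ∀ x, S c B (fun p => ind (att ↑Γ p x) * ∑ x' ∈ D, ind (att ↑Γ p x')) ≤
      S c B (fun p => ind (att ↑Γ p x) * (H + (Δ * T) * ((Pa B p x).card : ℝ))) := by
    intro x
    refine S_path_le hc x fun η hη => ?_
    obtain ⟨hη1, hη2⟩ := EE_spec hη
    have hP : ∀ q, IsF (B \ Pa B η x) q → Pa B (glue (Pa B η x) η q) x = Pa B η x := fun q hq =>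
      Pa_eq_of_iter (hη2 q hq).2
    set π := Pa B η x with hπ
    have hπB : π ⊆ B := Pa_sub _ _ _
    have hZπ := Z_pos_mono hc (Finset.sdiff_subset (s := B) (t := π)) hZB
    calc S c (B \ π) (fun q => ind (att ↑Γ (glue π η q) x) * ∑ x' ∈ D, ind (att ↑Γ (glue π η q) x'))
        ≤ S c (B \ π) (fun q => ind (att ↑Γ η x) * ∑ x' ∈ D, ind (att (↑Γ ∪ ↑π) q x')) := by
          refine S_mono hc fun q hq => ?_
          rw [att_congr (hη2 q hq).2]
          refine mul_le_mul_of_nonneg_left (Finset.sum_le_sum fun x' _ => ind_mono ?_) (ind_nonneg _)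
          rintro ⟨k, hk⟩
          by_cases hh : ∃ i, i ≤ k ∧ (glue π η q)^[i] x' ∈ π
          · obtain ⟨i, ⟨hi, hi2⟩, hj⟩ := first_hit hh
            refine ⟨i, Or.inr ?_⟩
            rw [glue_first (fun j hj' h => hj j hj' ⟨by omega, h⟩)]
            exact hi2
          · push Not at hh
            refine ⟨k, Or.inl ?_⟩
            rw [glue_first (fun j hj' h => hh j hj'.le h)]
            exact hk
      _ = ind (att ↑Γ η x) * ∑ x' ∈ D, PP c (B \ π) (↑Γ ∪ ↑π) x' * Z c (B \ π) := by
          rw [S_mul, S_sum]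
          congr 1
          exact Finset.sum_congr rfl fun x' _ => PP_S hZπ _ _
      _ ≤ ind (att ↑Γ η x) * ((H + (Δ * T) * (π.card : ℝ)) * Z c (B \ π)) := by
          refine mul_le_mul_of_nonneg_left ?_ (ind_nonneg _)
          rw [← Finset.sum_mul]
          refine mul_le_mul_of_nonneg_right ?_ hZπ.le
          calc _ ≤ ∑ x' ∈ D, (PP c B ↑Γ x' + ∑ w ∈ π, Δ * Gr c D x' w) :=
                Finset.sum_le_sum fun x' _ => PP_union_le hc hZ hΔ0 hΔ hBD hΓB hπB x'
            _ = H + ∑ w ∈ π, Δ * ∑ x' ∈ D, Gr c D x' w := by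
                rw [Finset.sum_add_distrib, Finset.sum_comm]
                simp only [Finset.mul_sum, hH]
            _ ≤ H + ∑ w ∈ π, Δ * T := by
                refine add_le_add_right (Finset.sum_le_sum fun w hw => ?_) _
                exact mul_le_mul_of_nonneg_left (hT w (hBD (hπB hw))) hΔ0
            _ = _ := by rw [Finset.sum_const, nsmul_eq_mul]; ring
      _ = _ := by
          rw [← mul_assoc, ← S_const]
          refine S_congr fun q hq => ?_
          rw [att_congr (hη2 q hq).2, hP q hq]
  have h2 : ∀ x, S c B (fun p => ind (att ↑Γ p x) * (H + (Δ * T) * ((Pa B p x).card : ℝ))) =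
      H * (PP c B ↑Γ x * Z c B) +
      (Δ * T) * S c B (fun p => ind (att ↑Γ p x) * ((Pa B p x).card : ℝ)) := by
    intro x
    rw [← PP_S hZB, ← S_mul, ← S_mul, ← S_add]
    exact S_congr fun p _ => by ring
  calc S c B (fun p => (∑ x ∈ D, ind (att ↑Γ p x)) ^ 2)
      = ∑ x ∈ D, S c B (fun p => ind (att ↑Γ p x) * ∑ x' ∈ D, ind (att ↑Γ p x')) := by
        rw [← S_sum]
        refine S_congr fun p _ => ?_
        rw [sq, Finset.sum_mul]
    _ ≤ ∑ x ∈ D, (H * (PP c B ↑Γ x * Z c B) +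
      (Δ * T) * S c B (fun p => ind (att ↑Γ p x) * ((Pa B p x).card : ℝ))) :=
        Finset.sum_le_sum fun x _ => (h1 x).trans (h2 x).le
    _ = H * (H * Z c B) + (Δ * T) * ∑ x ∈ D, S c B
          (fun p => ind (att ↑Γ p x) * ((Pa B p x).card : ℝ)) := by
        rw [Finset.sum_add_distrib, ← Finset.mul_sum, ← Finset.mul_sum, ← Finset.sum_mul]
    _ ≤ H * (H * Z c B) + (Δ * T) * (Δ * T * H * Z c B) :=
        add_le_add_right (mul_le_mul_of_nonneg_left hlen (mul_nonneg hΔ0 hT0)) _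
    _ = _ := by ring

lemma exp_ineq {u β : ℝ} (hu : 0 ≤ u) :
    Real.exp (-u) ≤ 1 - 2 * β * u + β ^ 2 * (u + u ^ 2) := by
  have h1 : Real.exp (-u) ≤ 1 / (1 + u) := by
    rw [Real.exp_neg, inv_eq_one_div]
    exact one_div_le_one_div_of_le (by linarith) (by linarith [Real.add_one_le_exp u])
  have h2 : 1 / (1 + u) ≤ 1 - 2 * β * u + β ^ 2 * (u + u ^ 2) := by
    rw [div_le_iff₀ (by linarith)]
    nlinarith [mul_nonneg hu (sq_nonneg (1 - β * (1 + u)))]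
  linarith

lemma region_exp {c : X → X → ℝ} (hc : ∀ x y, 0 ≤ c x y) {D : Finset X} (hZ : 0 < Z c D)
    {Δ : ℝ} (hΔ0 : 0 ≤ Δ) (hΔ : ∀ x ∈ D, ∑ y, c x y ≤ Δ) {T : ℝ}
    (hT0 : 0 ≤ T) (hT : ∀ w ∈ D, ∑ x ∈ D, Gr c D x w ≤ T) (Γ : Finset X) {ℓ : ℕ} (hℓ : 0 < ℓ)
    (hℓT : 2 * Δ * T ≤ ℓ) {t a : ℝ} (ht : 0 < t) (ha : (Δ * T) ^ 2 ≤ a * t) {θ : ℝ} (hθ0 : 0 ≤ θ)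
    (hθ : θ * t ≤ ∑ x ∈ D, PP c (D \ Γ) ↑Γ x) :
    S c (D \ Γ) (fun p => Real.exp (- (VS D ↑Γ ℓ p / t))) ≤
      Real.exp (- (θ / (4 * (1 + a + θ)))) * Z c (D \ Γ) := by
  have hlen := region_len hc hZ hΔ0 hΔ hT Γ
  have hsq := region_sq hc hZ hΔ0 hΔ hT0 hT Γ
  set B := D \ Γ with hB
  have hBD : B ⊆ D := Finset.sdiff_subset
  have hZB := Z_pos_mono hc hBD hZ
  have hΓB : ∀ g ∈ (↑Γ : Set X), g ∉ B := fun g hg h => (Finset.mem_sdiff.1 h).2 hg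
  set H := ∑ x ∈ D, PP c B ↑Γ x with hH
  have hℓ' : (0:ℝ) < ℓ := by exact_mod_cast hℓ
  have ha0 : 0 ≤ a := by
    by_contra h; push Not at h
    nlinarith [sq_nonneg (Δ * T)]
  have hH0 : 0 ≤ H := Finset.sum_nonneg fun x _ => PP_nonneg hc _ _ _
  have hV0 : ∀ p, 0 ≤ VS D ↑Γ ℓ p := fun p => Finset.sum_nonneg fun x _ => ind_nonneg _
  have hVN : ∀ p, VS D ↑Γ ℓ p ≤ ∑ x ∈ D, ind (att ↑Γ p x) := fun p =>
    Finset.sum_le_sum fun x _ => attS_le _ _ _ _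
  have hN : S c B (fun p => ∑ x ∈ D, ind (att ↑Γ p x)) = H * Z c B := by
    rw [S_sum, hH, Finset.sum_mul]
    exact Finset.sum_congr rfl fun x _ => PP_S hZB _ _
  have hE1 : H / 2 * Z c B ≤ S c B (VS D ↑Γ ℓ) := by
    have h1 : S c B (fun p => (∑ x ∈ D, ind (att ↑Γ p x)) -
        (1 / (ℓ:ℝ)) * ∑ x ∈ D, ind (att ↑Γ p x) * ((Pa B p x).card : ℝ)) ≤ S c B (VS D ↑Γ ℓ) := by
      refine S_mono hc fun p hp => ?_
      rw [Finset.mul_sum, ← Finset.sum_sub_distrib]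
      refine Finset.sum_le_sum fun x _ => ?_
      have := attS_ge hΓB hp hℓ x
      rw [mul_div_assoc] at this
      refine le_trans (le_of_eq ?_) this
      ring
    rw [S_sub, hN, S_mul, S_sum] at h1
    have h2 : (1 / (ℓ:ℝ)) * ∑ x ∈ D, S c B (fun p => ind (att ↑Γ p x) * ((Pa B p x).card : ℝ))
        ≤ H / 2 * Z c B := by
      have h3 : (1 / (ℓ:ℝ)) * ∑ x ∈ D, S c B (fun p => ind (att ↑Γ p x) * ((Pa B p x).card : ℝ))
        ≤ (1 / (ℓ:ℝ)) * (Δ * T * H * Z c B) := mul_le_mul_of_nonneg_left hlen (by positivity)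
      refine h3.trans ?_
      rw [one_div, inv_mul_le_iff₀ hℓ']
      have := mul_le_mul_of_nonneg_right hℓT (mul_nonneg hH0 hZB.le)
      linarith
    linarith
  have hE2 : S c B (fun p => VS D ↑Γ ℓ p ^ 2) ≤ (H ^ 2 + (Δ * T) ^ 2 * H) * Z c B := by
    refine le_trans (S_mono hc fun p _ => ?_) hsq
    exact pow_le_pow_left₀ (hV0 p) (hVN p) 2
  have hE3 : S c B (VS D ↑Γ ℓ) ≤ H * Z c B := by
    rw [← hN]; exact S_mono hc fun p _ => hVN p
  set θ' := H / t with hθ'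
  have hθθ : θ ≤ θ' := by rw [hθ', le_div_iff₀ ht]; exact hθ
  have hθ'0 : 0 ≤ θ' := hθ0.trans hθθ
  have hHt : H = θ' * t := by rw [hθ']; field_simp
  set β := 1 / (2 * (1 + a + θ')) with hβ
  have hβ0 : 0 < β := by positivity
  have key : S c B (fun p => Real.exp (- (VS D ↑Γ ℓ p / t))) ≤
      (1 - β * θ' + β ^ 2 * (θ' + θ' ^ 2 + a * θ')) * Z c B := by
    calc S c B (fun p => Real.exp (- (VS D ↑Γ ℓ p / t)))
        ≤ S c B (fun p => (1 + (- (2 * β / t) + β ^ 2 / t) * VS D ↑Γ ℓ p) +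
            (β ^ 2 / t ^ 2) * VS D ↑Γ ℓ p ^ 2) := by
          refine S_mono hc fun p _ => ?_
          refine (exp_ineq (β := β) (div_nonneg (hV0 p) ht.le)).trans (le_of_eq ?_)
          field_simp
          ring
      _ = Z c B + (- (2 * β / t)) * S c B (VS D ↑Γ ℓ) + (β ^ 2 / t) * S c B (VS D ↑Γ ℓ)
            + (β ^ 2 / t ^ 2) * S c B (fun p => VS D ↑Γ ℓ p ^ 2) := by
          rw [S_add, S_add, S_mul, S_mul]; unfold Z; ring
      _ ≤ Z c B + (- (2 * β / t)) * (H / 2 * Z c B) + (β ^ 2 / t) * (H * Z c B)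
            + (β ^ 2 / t ^ 2) * ((H ^ 2 + (Δ * T) ^ 2 * H) * Z c B) := by
          have i1 := mul_le_mul_of_nonneg_left hE1 (show 0 ≤ 2 * β / t by positivity)
          have i2 := mul_le_mul_of_nonneg_left hE3 (show 0 ≤ β ^ 2 / t by positivity)
          have i3 := mul_le_mul_of_nonneg_left hE2 (show 0 ≤ β ^ 2 / t ^ 2 by positivity)
          linarith
      _ ≤ Z c B + (- (2 * β / t)) * (H / 2 * Z c B) + (β ^ 2 / t) * (H * Z c B)
            + (β ^ 2 / t ^ 2) * ((H ^ 2 + (a * t) * H) * Z c B) := by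
          gcongr
      _ = _ := by
          rw [hHt]; field_simp; ring
  refine key.trans (mul_le_mul_of_nonneg_right ?_ hZB.le)
  have h1 : 1 - β * θ' + β ^ 2 * (θ' + θ' ^ 2 + a * θ') = 1 - θ' / (4 * (1 + a + θ')) := by
    rw [hβ]; field_simp; ring
  have h2 : θ / (4 * (1 + a + θ)) ≤ θ' / (4 * (1 + a + θ')) := by
    rw [div_le_div_iff₀ (by positivity) (by positivity)]
    nlinarith
  rw [h1]
  have h3 := Real.add_one_le_exp (-(θ / (4 * (1 + a + θ))))
  linarith

lemma region_H {c : X → X → ℝ} (hc : ∀ x y, 0 ≤ c x y) {D : Finset X} (hZ : 0 < Z c D)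
    {Γ g : Finset X} (hgΓ : g ⊆ Γ) (hgD : g ⊆ D) {m b : ℝ} (hm : 0 < m)
    (h1 : ∀ w ∈ g, ∑ v ∈ g, Gr c D w v ≤ m) (h2 : ∀ w ∈ g, b ≤ ∑ x ∈ D, Gr c D x w) :
    g.card * b / m ≤ ∑ x ∈ D, PP c (D \ Γ) ↑Γ x := by
  have hLu : ∀ x ∈ D, x ∉ g → Lap c (fun x => ∑ v ∈ g, Gr c D x v) x = 0 := by
    intro x hx hxg
    rw [Lap_sum]
    refine Finset.sum_eq_zero fun v hv => ?_
    rw [Gr_Lap hZ hx (hgD hv), if_neg (fun e : x = v => hxg (e ▸ hv))]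
  have hu0 : ∀ x, x ∉ D → ∑ v ∈ g, Gr c D x v = 0 := fun x hx =>
    Finset.sum_eq_zero fun v hv => Gr_out hx (hgD hv)
  have hLc : ∀ (a : ℝ) x, Lap c (fun _ => a) x = 0 := fun a x => by simp [Lap]
  have hum : ∀ x, ∑ v ∈ g, Gr c D x v ≤ m := by
    intro x
    refine max_le hc (Z_pos_mono hc (Finset.sdiff_subset (s := D) (t := g)) hZ)
      (f := fun x => ∑ v ∈ g, Gr c D x v) (g := fun _ => m) ?_ ?_ x
    · intro x hx
      have hx := Finset.mem_sdiff.1 hx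
      rw [hLu x hx.1 hx.2, hLc]
    · intro x hx
      by_cases hxg : x ∈ g
      · exact h1 x hxg
      · show ∑ v ∈ g, Gr c D x v ≤ m
        rw [hu0 x (fun h => hx (Finset.mem_sdiff.2 ⟨h, hxg⟩))]; exact hm.le
  have hZB := Z_pos_mono hc (Finset.sdiff_subset (s := D) (t := Γ)) hZ
  have hle : ∀ x, (∑ v ∈ g, Gr c D x v) / m ≤ PP c (D \ Γ) ↑Γ x := by
    intro x
    refine max_le hc hZB (f := fun x => (∑ v ∈ g, Gr c D x v) / m) (g := PP c (D \ Γ) ↑Γ) ?_ ?_ x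
    · intro x hx
      rw [PP_Lap c (fun g hg h => (Finset.mem_sdiff.1 h).2 hg) hx]
      have hx := Finset.mem_sdiff.1 hx
      rw [Lap_div, hLu x hx.1 (fun h => hx.2 (hgΓ h)), zero_div]
    · intro x hx
      show (∑ v ∈ g, Gr c D x v) / m ≤ PP c (D \ Γ) ↑Γ x
      rw [PP_out hZB _ hx]
      by_cases hxΓ : x ∈ Γ
      · rw [ind_true (by simpa using hxΓ), div_le_one hm]; exact hum x
      · rw [hu0 x (fun h => hx (Finset.mem_sdiff.2 ⟨h, hxΓ⟩)), zero_div]; exact ind_nonneg _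
  calc g.card * b / m = (∑ w ∈ g, b) / m := by rw [Finset.sum_const, nsmul_eq_mul]
    _ ≤ (∑ w ∈ g, ∑ x ∈ D, Gr c D x w) / m :=
        div_le_div_of_nonneg_right (Finset.sum_le_sum h2) hm.le
    _ = ∑ x ∈ D, (∑ v ∈ g, Gr c D x v) / m := by
        rw [Finset.sum_comm, Finset.sum_div]
    _ ≤ _ := Finset.sum_le_sum fun x _ => hle x

end Gen4

section Gen5
variable {X : Type} [Fintype X] [DecidableEq X]

/-- killed conductances -/
noncomputable def ce (c : X → X → ℝ) (y0 : X) (ε : ℝ) (x y : X) : ℝ :=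
  c x y + if y = y0 then ε else 0

lemma ce_nonneg {c : X → X → ℝ} (hc : ∀ x y, 0 ≤ c x y) (y0 : X) {ε : ℝ} (hε : 0 ≤ ε) (x y : X) :
    0 ≤ ce c y0 ε x y := by
  unfold ce; split_ifs <;> linarith [hc x y]
lemma ce_ge {c : X → X → ℝ} (y0 : X) {ε : ℝ} (hε : 0 ≤ ε) (x y : X) :
    c x y ≤ ce c y0 ε x y := by
  unfold ce; split_ifs <;> linarith
lemma ce_Lap (c : X → X → ℝ) (y0 : X) (ε : ℝ) (f : X → ℝ) (x : X) :
    Lap (ce c y0 ε) f x = Lap c f x + ε * (f x - f y0) := by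
  unfold Lap ce
  simp only [add_mul, Finset.sum_add_distrib, ite_mul, zero_mul]
  simp
lemma ce_deg {c : X → X → ℝ} (y0 : X) (ε : ℝ) {Δ : ℝ} {x : X} (h : ∑ y, c x y ≤ Δ) :
    ∑ y, ce c y0 ε x y ≤ Δ + ε := by
  unfold ce
  simp only [Finset.sum_add_distrib]
  simp; linarith
lemma ce_Z {c : X → X → ℝ} (hc : ∀ x y, 0 ≤ c x y) (y0 : X) {ε : ℝ} (hε : 0 ≤ ε) {B : Finset X}
    (hZ : 0 < Z c B) : 0 < Z (ce c y0 ε) B := by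
  obtain ⟨p, hp, h⟩ := (Z_pos_iff hc).1 hZ
  exact (Z_pos_iff (ce_nonneg hc y0 hε)).2 ⟨p, hp, fun x hx => (h x hx).trans_le (ce_ge y0 hε _ _)⟩

lemma ce_sum {c : X → X → ℝ} (hc : ∀ x y, 0 ≤ c x y) {y0 : X} {ε : ℝ} (hε : 0 < ε) {A : Finset X}
    (hZ : 0 < Z c A) (hy : y0 ∉ A) (x : X) : ∑ w ∈ A, Gr (ce c y0 ε) A x w ≤ 1 / ε := by
  have h := Gr_super (ce_nonneg hc y0 hε.le) (ce_Z hc y0 hε.le hZ) (φ := fun _ => 1)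
    (f := fun z => if z = y0 then 0 else 1 / ε) (fun x hx => by
      rw [ce_Lap]
      have hne : x ≠ y0 := fun e => hy (e ▸ hx)
      have : 0 ≤ Lap c (fun z => if z = y0 then 0 else 1 / ε) x := by
        unfold Lap
        refine Finset.sum_nonneg fun y _ => mul_nonneg (hc _ _) ?_
        simp only [if_neg hne]
        split_ifs
        · simp; exact hε.le
        · simp
      simp only [if_neg hne, if_true]
      have e : ε * (1 / ε - 0) = 1 := by field_simp; simp
      rw [e]; linarith)
    (fun x _ => by split_ifs <;> positivity) x
  simp only [mul_one] at h
  refine h.trans ?_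
  split_ifs
  · positivity
  · exact le_rfl

lemma kill_diag {c : X → X → ℝ} (hc : ∀ x y, 0 ≤ c x y) {y0 : X} {ε : ℝ} (hε : 0 ≤ ε) {B : Finset X}
    (hZ : 0 < Z c B) (hy : y0 ∉ B) {Δ Cv : ℝ} (hΔ : ∀ x ∈ B, ∑ y, c x y ≤ Δ) {w : X} (hw : w ∈ B)
    (hCv0 : 0 ≤ Cv)
    (hCv : ∑ z ∈ B, Gr c B w z * Gr c B z w ≤ Cv) :
    (1 - ε * Cv * Δ) * Gr c B w w ≤ Gr (ce c y0 ε) B w w := by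
  have h := max_le (ce_nonneg hc y0 hε) (ce_Z hc y0 hε hZ)
    (f := fun x => Gr c B x w - ε * ∑ z ∈ B, Gr c B x z * Gr c B z w)
    (g := fun x => Gr (ce c y0 ε) B x w) (fun x hx => by
      rw [Gr_Lap (ce_Z hc y0 hε hZ) hx hw, ce_Lap, Lap_sub, Lap_mul,
        Gr_sum_Lap hZ (fun z => Gr c B z w) hx, Gr_Lap hZ hx hw, Gr_out hy hw,
        Gr_sum_out (fun z => Gr c B z w) hy]
      have : 0 ≤ ε * (ε * ∑ z ∈ B, Gr c B x z * Gr c B z w) :=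
        mul_nonneg hε (mul_nonneg hε (Finset.sum_nonneg fun z _ =>
          mul_nonneg (Gr_nonneg hc _ _ _) (Gr_nonneg hc _ _ _)))
      nlinarith) (fun x hx => by
      rw [Gr_out hx hw, Gr_out hx hw, Gr_sum_out (fun z => Gr c B z w) hx]; simp) w
  have h1 := Gr_diag_deg hc hZ hΔ hw
  have h2 := mul_le_mul_of_nonneg_left hCv hε
  have h3 := mul_le_mul_of_nonneg_left h1 (mul_nonneg hε hCv0)
  nlinarith

lemma kill_ratio {c : X → X → ℝ} (hc : ∀ x y, 0 ≤ c x y) {y0 : X} {ε : ℝ} (hε : 0 ≤ ε) {A : Finset X}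
    (hZ : 0 < Z c A) (hy : y0 ∉ A) {Δ Cv : ℝ} (hΔ : ∀ x ∈ A, ∑ y, c x y ≤ Δ)
    (hCv0 : 0 ≤ Cv) (hδ : ε * Cv * Δ ≤ 1)
    (hCv : ∀ B ⊆ A, ∀ w ∈ B, ∑ z ∈ B, Gr c B w z * Gr c B z w ≤ Cv) {B : Finset X} (hB : B ⊆ A)
    (π : Finset X) (hπ : π ⊆ B) :
    (1 - ε * Cv * Δ) ^ π.card * Z c (B \ π) * Z (ce c y0 ε) B ≤ Z (ce c y0 ε) (B \ π) * Z c B := by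
  induction π using Finset.induction_on with
  | empty => simp [mul_comm]
  | insert w π hwπ ih =>
    have ih := ih ((Finset.subset_insert _ _).trans hπ)
    have hwB : w ∈ B \ π := Finset.mem_sdiff.2 ⟨hπ (Finset.mem_insert_self _ _), hwπ⟩
    have hsub : B \ π ⊆ A := Finset.sdiff_subset.trans hB
    have e : B \ insert w π = (B \ π).erase w := by
      ext v; simp only [Finset.mem_sdiff, Finset.mem_insert, Finset.mem_erase]; tauto
    have hZ1 := Z_pos_mono hc hsub hZ
    have hZ2 := ce_Z hc y0 hε hZ1
    have k := kill_diag hc hε hZ1 (fun h => hy (hsub h)) (fun x hx => hΔ x (hsub hx)) hwB hCv0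
      (hCv _ hsub w hwB)
    rw [Gr_diag, Gr_diag, ← e, mul_div_assoc', div_le_div_iff₀ hZ1 hZ2] at k
    rw [Finset.card_insert_of_notMem hwπ]
    set δ := 1 - ε * Cv * Δ
    have hδ' : 0 ≤ δ := by simp only [δ]; linarith
    have a1 := mul_le_mul_of_nonneg_left k (pow_nonneg hδ' π.card)
    have a0 := Z_nonneg (ce_nonneg hc y0 hε) (B \ insert w π)
    have b0 := Z_nonneg hc (B \ insert w π)
    have hZB : 0 < Z (ce c y0 ε) B := ce_Z hc y0 hε (Z_pos_mono hc hB hZ)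
    -- multiply
    have key : (δ ^ (π.card + 1) * Z c (B \ insert w π) * Z (ce c y0 ε) B) *
        (Z c (B \ π) * Z (ce c y0 ε) (B \ π)) ≤
        (Z (ce c y0 ε) (B \ insert w π) * Z c B) * (Z c (B \ π) * Z (ce c y0 ε) (B \ π)) := by
      calc _ = (δ * Z c (B \ insert w π) * Z (ce c y0 ε) (B \ π)) *
            (δ ^ π.card * Z c (B \ π) * Z (ce c y0 ε) B) := by ring
        _ ≤ (Z (ce c y0 ε) (B \ insert w π) * Z c (B \ π)) *
            (Z (ce c y0 ε) (B \ π) * Z c B) :=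
          mul_le_mul k ih (by positivity) (by positivity)
        _ = _ := by ring
    exact le_of_mul_le_mul_right key (mul_pos hZ1 hZ2)

/-- short reach -/
lemma kill_reach {c : X → X → ℝ} (hc : ∀ x y, 0 ≤ c x y) {y0 : X} {ε : ℝ} (hε : 0 ≤ ε) {A : Finset X}
    (hZ : 0 < Z c A) (hy : y0 ∉ A) {Δ Cv : ℝ} (hΔ0 : 0 ≤ Δ) (hΔ : ∀ x ∈ A, ∑ y, c x y ≤ Δ)
    (hCv0 : 0 ≤ Cv) {M : ℕ} (hM : 1 ≤ M) (hδ : M * (ε * Cv * Δ) ≤ 1 / 2)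
    (hCv : ∀ B ⊆ A, ∀ w ∈ B, ∑ z ∈ B, Gr c B w z * Gr c B z w ≤ Cv) {B : Finset X} (hB : B ⊆ A)
    (x : X) {w : X} (hw : w ∈ A) (hwB : w ∉ B) :
    S c B (fun p => ind (∃ k ∈ Set.Iic M, p^[k] x = w)) ≤
      (2 * (Δ + ε) * Gr (ce c y0 ε) A x w) * Z c B := by
  have hM' : (1:ℝ) ≤ M := by exact_mod_cast hM
  have hδ0 : 0 ≤ ε * Cv * Δ := by positivity
  have hδ1 : ε * Cv * Δ ≤ 1 := by nlinarith
  have hZB := Z_pos_mono hc hB hZ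
  have hZe := ce_Z hc y0 hε hZB
  have hce := ce_nonneg hc y0 hε
  set Φ : (X → X) → ℝ := fun p => ind (∃ k ∈ Set.Iic M, p^[k] x = w)
  have main : S c B Φ * Z (ce c y0 ε) B ≤ 2 * Z c B * S (ce c y0 ε) B Φ := by
    rw [S_path c B x, S_path (ce c y0 ε) B x, Finset.sum_mul, Finset.mul_sum]
    refine Finset.sum_le_sum fun η hη => ?_
    obtain ⟨hη1, hη2⟩ := EE_spec hη
    have ev : ∀ c' : X → X → ℝ, S c' (B \ Pa B η x) (fun q => Φ (glue (Pa B η x) η q)) =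
        ind (∃ k ∈ Set.Iic M, η^[k] x = w) * Z c' (B \ Pa B η x) := by
      intro c'
      rw [Z, ← S_mul]
      refine S_congr fun q hq => ?_
      simp only [Φ, (hη2 q hq).2, mul_one]
    rw [ev, ev]
    have hwt : wt c (Pa B η x) η ≤ wt (ce c y0 ε) (Pa B η x) η :=
      Finset.prod_le_prod (fun _ _ => hc _ _) fun _ _ => ce_ge y0 hε _ _
    by_cases h : ∃ k ∈ Set.Iic M, η^[k] x = w
    swap
    · rw [ind_false h]; simp
    rw [ind_true h]
    obtain ⟨k, hk, hkw⟩ := h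
    have hk : k ≤ M := hk
    have hwP : w ∉ Pa B η x := fun h => hwB (Pa_sub _ _ _ h)
    have hcard : (Pa B η x).card ≤ M := by
      have : Pa B η x ⊆ (Finset.range k).image (fun j => η^[j] x) := by
        intro v hv
        obtain ⟨hvB, j, hj⟩ := mem_Pa.1 hv
        by_cases hjk : j < k
        · exact Finset.mem_image.2 ⟨j, Finset.mem_range.2 hjk, hj⟩
        · exfalso
          have e : j = (j - k) + k := by omega
          rw [e, Function.iterate_add_apply, hkw, hη1.fix hwP] at hj
          exact hwP (hj ▸ hv)
      exact (Finset.card_le_card this).trans (Finset.card_image_le.trans (by simpa using hk))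
    have hr := kill_ratio hc hε hZ hy hΔ hCv0 hδ1 hCv hB (Pa B η x) (Pa_sub _ _ _)
    have hpow : (1:ℝ) / 2 ≤ (1 - ε * Cv * Δ) ^ (Pa B η x).card := by
      have h1 := one_add_mul_le_pow (a := -(ε * Cv * Δ)) (by linarith) (Pa B η x).card
      have h2 : ((Pa B η x).card : ℝ) * (ε * Cv * Δ) ≤ M * (ε * Cv * Δ) :=
        mul_le_mul_of_nonneg_right (by exact_mod_cast hcard) hδ0
      rw [← sub_eq_add_neg] at h1
      linarith
    have hZ0 := Z_nonneg hc (B \ Pa B η x)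
    have hZ1 := Z_nonneg hce (B \ Pa B η x)
    have h3 : Z c (B \ Pa B η x) * Z (ce c y0 ε) B ≤ 2 * (Z (ce c y0 ε) (B \ Pa B η x) * Z c B) := by
      have : (1:ℝ)/2 * (Z c (B \ Pa B η x) * Z (ce c y0 ε) B) ≤
        (1 - ε * Cv * Δ) ^ (Pa B η x).card * (Z c (B \ Pa B η x) * Z (ce c y0 ε) B) :=
        mul_le_mul_of_nonneg_right hpow (by positivity)
      linarith
    calc wt c (Pa B η x) η * (1 * Z c (B \ Pa B η x)) * Z (ce c y0 ε) B
        = wt c (Pa B η x) η * (Z c (B \ Pa B η x) * Z (ce c y0 ε) B) := by ring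
      _ ≤ wt (ce c y0 ε) (Pa B η x) η * (2 * (Z (ce c y0 ε) (B \ Pa B η x) * Z c B)) :=
        mul_le_mul hwt h3 (by positivity) (wt_nonneg hce _ _)
      _ = _ := by ring
  have h2 := PP_le_Gr hce (ce_Z hc y0 hε hZ) hB (Δ := Δ + ε) (by linarith)
    (fun x hx => ce_deg y0 ε (hΔ x hx)) hw hwB x
  unfold PP at h2
  rw [div_le_iff₀ hZe] at h2
  have h3 : S (ce c y0 ε) B Φ ≤ S (ce c y0 ε) B (fun p => ind (att {w} p x)) :=
    S_mono hce fun p _ => ind_mono fun ⟨k, _, hk⟩ => ⟨k, hk⟩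
  have h4 : S c B Φ * Z (ce c y0 ε) B ≤
      ((2 * (Δ + ε) * Gr (ce c y0 ε) A x w) * Z c B) * Z (ce c y0 ε) B := by
    have := mul_le_mul_of_nonneg_left (h3.trans h2) (by positivity : 0 ≤ 2 * Z c B)
    calc _ ≤ _ := main
      _ ≤ _ := this
      _ = _ := by ring
  exact le_of_mul_le_mul_right h4 hZe

end Gen5

section Num
lemma pow_bd {y : ℝ} (hy : 0 < y) (h1 : 99/100 ≤ y^4) (h2 : y^4 ≤ 101/100) : 997/1000 ≤ y ∧ y ≤ 1003/1000 := by
  constructor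
  · by_contra h; push Not at h
    have : y^4 ≤ (997/1000)^4 := by gcongr
    norm_num at this; linarith
  · by_contra h; push Not at h
    have : (1003/1000)^4 ≤ y^4 := by gcongr
    norm_num at this; linarith

lemma poly1 {y : ℝ} (hy : 0 < y) (h1 : 99/100 ≤ y^4) (h2 : y^4 ≤ 101/100) :
    y⁻¹ ≤ 1 - (1/4) * (y^4-1) + (1/4) * (y^4-1)^2 := by
  obtain ⟨a, b⟩ := pow_bd hy h1 h2
  rw [inv_le_iff_one_le_mul₀ hy]
  have m1 : 3 ≤ y^3+y^2+y+1 := by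
    have : (997/1000)^3 ≤ y^3 := by gcongr
    have : (997/1000)^2 ≤ y^2 := by gcongr
    norm_num at *; linarith
  have m2 : y^2 ≤ 11/10 := by
    have : y^2 ≤ (1003/1000)^2 := by gcongr
    norm_num at *; linarith
  have m3 : (997/1000)*3 ≤ y * (y^3+y^2+y+1) := by gcongr
  have m4 : 11/10 ≤ (3/5 : ℝ) * 3 := by norm_num
  have m5 : 0 ≤ y*(y^3+y^2+y+1)^2 - (y^3+y^2+y+1) - (y^2+2*y+3) := by
    have k : 3*(y * (y^3+y^2+y+1) - 1) ≤ (y^3+y^2+y+1) * (y * (y^3+y^2+y+1) - 1) :=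
      mul_le_mul_of_nonneg_right m1 (by linarith)
    have m1' : 3.9 ≤ y^3+y^2+y+1 := by
      have : (997/1000)^3 ≤ y^3 := by gcongr
      have : (997/1000)^2 ≤ y^2 := by gcongr
      norm_num at *; linarith
    have m3' : (997/1000)*3.9 ≤ y * (y^3+y^2+y+1) := by gcongr
    norm_num at *
    nlinarith
  have := mul_nonneg (sq_nonneg (y-1)) m5
  nlinarith

lemma poly5 {y : ℝ} (hy : 0 < y) (h1 : 99/100 ≤ y^4) (h2 : y^4 ≤ 101/100) :
    (y^5)⁻¹ ≤ 1 - (5/4) * (y^4-1) + (3/2) * (y^4-1)^2 := by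
  obtain ⟨a, b⟩ := pow_bd hy h1 h2
  rw [inv_le_iff_one_le_mul₀ (by positivity)]
  have m1 : (997/1000:ℝ)^3 + (997/1000)^2+997/1000+1 ≤ y^3+y^2+y+1 := by gcongr
  have m2 : (997/1000:ℝ)^5 * ((997/1000:ℝ)^3 + (997/1000)^2+997/1000+1)^2 ≤ y^5 * (y^3+y^2+y+1)^2 := by
    gcongr
  have m3 : (5/4)*y^7+(5/2)*y^6+(15/4)*y^5+5*y^4+4*y^3+3*y^2+2*y+1 ≤
      (5/4)*(1003/1000:ℝ)^7+(5/2)*(1003/1000)^6+(15/4)*(1003/1000)^5+5*(1003/1000)^4+4*(1003/1000)^3+3*(1003/1000)^2+2*(1003/1000)+1 := by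
    gcongr
  have m5 : 0 ≤ (3/2)*(y^5 * (y^3+y^2+y+1)^2) - ((5/4)*y^7+(5/2)*y^6+(15/4)*y^5+5*y^4+4*y^3+3*y^2+2*y+1) := by
    norm_num at m2 m3 ⊢
    linarith
  have := mul_nonneg (sq_nonneg (y-1)) m5
  have e : (y-1)^2*((3/2)*(y^5 * (y^3+y^2+y+1)^2) - ((5/4)*y^7+(5/2)*y^6+(15/4)*y^5+5*y^4+4*y^3+3*y^2+2*y+1))
    = (1 - 5 / 4 * (y ^ 4 - 1) + 3 / 2 * (y ^ 4 - 1) ^ 2) * y^5 - 1 := by ring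
  linarith

lemma quart {u : ℝ} (hu : |u| ≤ 1/100) : 0 < (1+u)^(1/4:ℝ) ∧ ((1+u)^(1/4:ℝ))^4 = 1 + u := by
  have := abs_le.1 hu
  refine ⟨Real.rpow_pos_of_pos (by linarith) _, ?_⟩
  rw [← Real.rpow_natCast, ← Real.rpow_mul (by linarith)]; norm_num

lemma num1 {u : ℝ} (hu : |u| ≤ 1/100) : (1+u)^(-(1/4:ℝ)) ≤ 1 - (1/4)*u + (1/4)*u^2 := by
  obtain ⟨h1, h2⟩ := quart hu
  have h := abs_le.1 hu
  have := poly1 h1 (by rw [h2]; linarith) (by rw [h2]; linarith)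
  rw [h2, ← Real.rpow_neg (by linarith)] at this
  convert this using 1; ring
lemma num5 {u : ℝ} (hu : |u| ≤ 1/100) : (1+u)^(-(5/4:ℝ)) ≤ 1 - (5/4)*u + (3/2)*u^2 := by
  obtain ⟨h1, h2⟩ := quart hu
  have h := abs_le.1 hu
  have := poly5 h1 (by rw [h2]; linarith) (by rw [h2]; linarith)
  rw [h2, ← Real.rpow_natCast, ← Real.rpow_mul (by linarith), ← Real.rpow_neg (by linarith)] at this
  convert this using 1
  · norm_num
  · ring

lemma lapN {d : ℕ} {s q : ℝ} (hq : 0 ≤ q) (H : ∀ u : ℝ, |u| ≤ 1/100 → (1+u)^(-s) ≤ 1 - s*u + q*u^2)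
    (t : Fin d → ℝ) {a N : ℝ} (ha : 10100 ≤ a) (hN : N = ∑ i, t i ^ 2 + a) :
    N^(-s) * ((2*d*s - 8*q)/N - 2*d*q/N^2) ≤
      ∑ i, ((N^(-s) - (N + 2*t i + 1)^(-s)) + (N^(-s) - (N - 2*t i + 1)^(-s))) := by
  have hNa : a ≤ N := by rw [hN]; linarith [Finset.sum_nonneg (fun i (_ : i ∈ Finset.univ) => sq_nonneg (t i))]
  have hN0 : 0 < N := by linarith
  have one : ∀ v : ℝ, (2*|v| + 1)*100 ≤ N → N^(-s) * (s*((2*v+1)/N) - q*((2*v+1)/N)^2) ≤ N^(-s) - (N+2*v+1)^(-s) := by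
    intro v hv
    have hu : |(2*v+1)/N| ≤ 1/100 := by
      rw [abs_div, abs_of_pos hN0, div_le_iff₀ hN0]
      have := abs_add_le (2*v) 1
      rw [abs_mul] at this; norm_num at this; linarith
    have h := H _ hu
    have e : N+2*v+1 = N*(1+(2*v+1)/N) := by field_simp; ring
    have := abs_le.1 hu
    rw [e, Real.mul_rpow hN0.le (by linarith)]
    have := mul_le_mul_of_nonneg_left h (Real.rpow_nonneg hN0.le (-s))
    nlinarith
  have ht : ∀ i, (2*|t i| + 1)*100 ≤ N := by
    intro i
    have h1 : t i^2 ≤ ∑ i, t i^2 := Finset.single_le_sum (fun i _ => sq_nonneg (t i)) (Finset.mem_univ i)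
    have : |t i|^2 = t i^2 := sq_abs _
    nlinarith [sq_nonneg (|t i| - 100)]
  calc N^(-s) * ((2*d*s - 8*q)/N - 2*d*q/N^2)
      ≤ N^(-s) * (∑ i, ((s*((2*t i+1)/N) - q*((2*t i+1)/N)^2) + (s*((2*(-t i)+1)/N) - q*((2*(-t i)+1)/N)^2))) := by
        refine mul_le_mul_of_nonneg_left ?_ (Real.rpow_nonneg hN0.le _)
        have e : ∑ i, ((s*((2*t i+1)/N) - q*((2*t i+1)/N)^2) + (s*((2*(-t i)+1)/N) - q*((2*(-t i)+1)/N)^2))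
          = ∑ i, (2*s/N - 2*q/N^2 - 8*q/N^2 * t i^2) := Finset.sum_congr rfl fun i _ => by field_simp; ring
        rw [e, Finset.sum_sub_distrib, ← Finset.mul_sum]
        simp only [Finset.sum_const, Finset.card_univ, Fintype.card_fin, nsmul_eq_mul]
        have : ∑ i, t i^2 = N - a := by rw [hN]; ring
        rw [this]
        have : 8*q/N^2*(N-a) ≤ 8*q/N := by
          rw [div_mul_eq_mul_div, div_le_div_iff₀ (by positivity) hN0]
          nlinarith [mul_nonneg (mul_nonneg hq (by linarith : 0 ≤ a)) hN0.le]
        have e2 : (2*d*s - 8*q)/N - 2*d*q/N^2 = d*(2*s/N - 2*q/N^2) - 8*q/N := by field_simp; ring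
        rw [e2]; linarith
    _ = ∑ i, (N^(-s) * (s*((2*t i+1)/N) - q*((2*t i+1)/N)^2) + N^(-s)*(s*((2*(-t i)+1)/N) - q*((2*(-t i)+1)/N)^2)) := by
        rw [Finset.mul_sum]; exact Finset.sum_congr rfl fun i _ => by ring
    _ ≤ _ := Finset.sum_le_sum fun i _ => by
        have h1 := one (t i) (ht i)
        have h2 := one (-t i) (by rw [abs_neg]; exact ht i)
        have e : N + 2*(-t i) + 1 = N - 2*t i + 1 := by ring
        rw [e] at h2
        exact add_le_add h1 h2

lemma lap1 {d : ℕ} (hd : 5 ≤ d) (t : Fin d → ℝ) {a N : ℝ} (ha : 10100 + 12*d ≤ a) (hN : N = ∑ i, t i ^ 2 + a) :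
    (1/4) * N^(-(5/4:ℝ)) ≤
      ∑ i, ((N^(-(1/4:ℝ)) - (N + 2*t i + 1)^(-(1/4:ℝ))) + (N^(-(1/4:ℝ)) - (N - 2*t i + 1)^(-(1/4:ℝ)))) := by
  have hd' : (5:ℝ) ≤ d := by exact_mod_cast hd
  have hNa : a ≤ N := by rw [hN]; linarith [Finset.sum_nonneg (fun i (_ : i ∈ Finset.univ) => sq_nonneg (t i))]
  have hN0 : 0 < N := by linarith
  refine le_trans ?_ (lapN (s := 1/4) (q := 1/4) (by norm_num) (fun u hu => num1 hu) t (by linarith) hN)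
  have e : N^(-(5/4:ℝ)) = N^(-(1/4:ℝ)) * (1/N) := by
    rw [one_div N, ← Real.rpow_neg_one, ← Real.rpow_add hN0]; norm_num
  rw [e, mul_left_comm]
  refine mul_le_mul_of_nonneg_left ?_ (Real.rpow_nonneg hN0.le _)
  rw [div_sub_div _ _ hN0.ne' (by positivity), mul_one_div, div_le_div_iff₀ hN0 (by positivity)]
  have : 0 ≤ N^2 * (N * ((d:ℝ)/2 - 9/4) - d/2) := by
    refine mul_nonneg (by positivity) ?_
    nlinarith
  nlinarith
lemma lap5 {d : ℕ} (hd : 5 ≤ d) (t : Fin d → ℝ) {a N : ℝ} (ha : 10100 + 12*d ≤ a) (hN : N = ∑ i, t i ^ 2 + a) :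
    (1/4) * N^(-(9/4:ℝ)) ≤
      ∑ i, ((N^(-(5/4:ℝ)) - (N + 2*t i + 1)^(-(5/4:ℝ))) + (N^(-(5/4:ℝ)) - (N - 2*t i + 1)^(-(5/4:ℝ)))) := by
  have hd' : (5:ℝ) ≤ d := by exact_mod_cast hd
  have hNa : a ≤ N := by rw [hN]; linarith [Finset.sum_nonneg (fun i (_ : i ∈ Finset.univ) => sq_nonneg (t i))]
  have hN0 : 0 < N := by linarith
  refine le_trans ?_ (lapN (s := 5/4) (q := 3/2) (by norm_num) (fun u hu => num5 hu) t (by linarith) hN)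
  have e : N^(-(9/4:ℝ)) = N^(-(5/4:ℝ)) * (1/N) := by
    rw [one_div N, ← Real.rpow_neg_one, ← Real.rpow_add hN0]; norm_num
  rw [e, mul_left_comm]
  refine mul_le_mul_of_nonneg_left ?_ (Real.rpow_nonneg hN0.le _)
  rw [div_sub_div _ _ hN0.ne' (by positivity), mul_one_div, div_le_div_iff₀ hN0 (by positivity)]
  have : 0 ≤ N^2 * (N * ((5:ℝ)/2*d - 12 - 1/4) - 3*d) := by
    refine mul_nonneg (by positivity) ?_
    nlinarith
  nlinarith
end Num

section Lat
variable {d : ℕ} {X : Type} [Fintype X] [DecidableEq X]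

lemma adj_iff (x y : V d) : adj x y ↔ ∃ i, y = x + Pi.single i 1 ∨ y = x - Pi.single i 1 := by
  constructor
  · intro h
    unfold adj at h
    have hne : ∃ i, x i ≠ y i := by
      by_contra h'; push Not at h'
      simp [h'] at h
    obtain ⟨i, hi⟩ := hne
    have h1 : 1 ≤ |x i - y i| := Int.one_le_abs (sub_ne_zero.2 hi)
    have h2 := Finset.add_sum_erase Finset.univ (fun i => |x i - y i|) (Finset.mem_univ i)
    have h3 : ∀ j ∈ Finset.univ.erase i, 0 ≤ |x j - y j| := fun j _ => abs_nonneg _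
    have h4 : ∑ j ∈ Finset.univ.erase i, |x j - y j| = 0 :=
      le_antisymm (by linarith) (Finset.sum_nonneg h3)
    have h5 := (Finset.sum_eq_zero_iff_of_nonneg h3).1 h4
    have h6 : |x i - y i| = 1 := by rw [h4] at h2; linarith
    refine ⟨i, ?_⟩
    have h7 : ∀ j, j ≠ i → x j = y j := fun j hj => by
      have := abs_eq_zero.1 (h5 j (by simp [hj])); linarith
    rcases abs_eq (by norm_num) |>.1 h6 with h | h
    · right; ext j
      by_cases hj : j = i
      · subst hj; simp; linarith
      · simp [hj, h7 j hj]
    · left; ext j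
      by_cases hj : j = i
      · subst hj; simp; linarith
      · simp [hj, h7 j hj]
  · rintro ⟨i, rfl | rfl⟩ <;> unfold adj
    · simp [Pi.single_apply, apply_ite]
    · simp [Pi.single_apply, apply_ite]

lemma adj_symm {x y : V d} (h : adj x y) : adj y x := by
  unfold adj at *; simpa only [abs_sub_comm] using h

structure Lat (pos : X → V d) (A : Finset X) : Prop where
  inj : Function.Injective pos
  nb : ∀ x ∈ A, ∀ v, adj (pos x) v → ∃ y, pos y = v

noncomputable def cc (pos : X → V d) (x y : X) : ℝ := ind (adj (pos x) (pos y))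
noncomputable def sq (x w : V d) : ℝ := ∑ i, ((x i : ℝ) - w i)^2

lemma cc_nonneg (pos : X → V d) (x y : X) : 0 ≤ cc pos x y := ind_nonneg _
lemma cc_symm (pos : X → V d) (x y : X) : cc pos x y = cc pos y x :=
  le_antisymm (ind_mono adj_symm) (ind_mono adj_symm)

lemma lat_sum {pos : X → V d} {A : Finset X} (h : Lat pos A) {x : X} (hx : x ∈ A) (g : V d → ℝ) :
    ∑ y, cc pos x y * g (pos y) = ∑ i, (g (pos x + Pi.single i 1) + g (pos x - Pi.single i 1)) := by
  have h1 : ∀ b : Fin d × Bool, ∃ y, pos y = if b.2 then pos x + Pi.single b.1 1 else pos x - Pi.single b.1 1 := by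
    intro b
    refine h.nb x hx _ ((adj_iff _ _).2 ⟨b.1, ?_⟩)
    cases b.2 <;> simp
  choose e he using h1
  have hinj : Function.Injective e := by
    rintro ⟨i, b⟩ ⟨j, b'⟩ hij
    have hh : pos (e (i, b)) = pos (e (j, b')) := by rw [hij]
    rw [he, he] at hh
    have h2 := congrFun hh i
    by_cases hij' : i = j
    · subst hij'
      cases b <;> cases b' <;> simp at h2 ⊢
      all_goals omega
    · exfalso
      cases b <;> cases b' <;> simp [Pi.single_apply, hij'] at h2
  have := Fintype.sum_of_injective e hinj
    (fun b => g (if b.2 then pos x + Pi.single b.1 1 else pos x - Pi.single b.1 1))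
    (fun y => cc pos x y * g (pos y)) (by
      intro y hy
      rw [cc, ind_false, zero_mul]
      intro hadj
      obtain ⟨i, hi | hi⟩ := (adj_iff _ _).1 hadj
      · exact hy ⟨(i, true), h.inj (by rw [he, hi]; simp)⟩
      · exact hy ⟨(i, false), h.inj (by rw [he, hi]; simp)⟩) (by
      intro b
      rw [cc, he, ind_true, one_mul]
      refine (adj_iff _ _).2 ⟨b.1, ?_⟩
      cases b.2 <;> simp)
  rw [← this, Fintype.sum_prod_type]
  simp

lemma lat_Lap {pos : X → V d} {A : Finset X} (h : Lat pos A) {x : X} (hx : x ∈ A) (F : V d → ℝ) :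
    Lap (cc pos) (fun z => F (pos z)) x =
      ∑ i, ((F (pos x) - F (pos x + Pi.single i 1)) + (F (pos x) - F (pos x - Pi.single i 1))) :=
  lat_sum h hx (fun v => F (pos x) - F v)

lemma lat_deg {pos : X → V d} {A : Finset X} (h : Lat pos A) {x : X} (hx : x ∈ A) :
    ∑ y, cc pos x y ≤ 2 * d := by
  have := lat_sum h hx (fun _ => 1)
  simp only [mul_one] at this
  rw [this]; simp; linarith

lemma sq_add (x w : V d) (i : Fin d) : sq (x + Pi.single i 1) w = sq x w + 2 * ((x i : ℝ) - w i) + 1 := by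
  unfold sq
  rw [← Finset.add_sum_erase _ _ (Finset.mem_univ i), ← Finset.add_sum_erase (a := i) _ (fun j => ((x j : ℝ) - w j)^2) (Finset.mem_univ i)]
  have : ∑ j ∈ Finset.univ.erase i, ((((x + Pi.single i 1 : V d) j : ℤ) : ℝ) - w j)^2 =
    ∑ j ∈ Finset.univ.erase i, ((x j : ℝ) - w j)^2 := Finset.sum_congr rfl fun j hj => by
      simp [Finset.ne_of_mem_erase hj]
  rw [this]; simp; ring
lemma sq_sub (x w : V d) (i : Fin d) : sq (x - Pi.single i 1) w = sq x w - 2 * ((x i : ℝ) - w i) + 1 := by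
  unfold sq
  rw [← Finset.add_sum_erase _ _ (Finset.mem_univ i), ← Finset.add_sum_erase (a := i) _ (fun j => ((x j : ℝ) - w j)^2) (Finset.mem_univ i)]
  have : ∑ j ∈ Finset.univ.erase i, ((((x - Pi.single i 1 : V d) j : ℤ) : ℝ) - w j)^2 =
    ∑ j ∈ Finset.univ.erase i, ((x j : ℝ) - w j)^2 := Finset.sum_congr rfl fun j hj => by
      simp [Finset.ne_of_mem_erase hj]
  rw [this]; simp; ring

lemma sq_nn (x w : V d) : 0 ≤ sq x w := Finset.sum_nonneg fun _ _ => sq_nonneg _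
lemma sq_comm' (x w : V d) : sq x w = sq w x := Finset.sum_congr rfl fun _ _ => by ring
lemma sq_self' (x : V d) : sq x x = 0 := by simp [sq]

noncomputable def a0 (d : ℕ) : ℝ := 10100 + 12 * d
lemma a0_ge (d : ℕ) : 1 ≤ a0 d := by unfold a0; have : (0:ℝ) ≤ d := by positivity
                                     linarith
noncomputable def kap (x w : V d) : ℝ := (sq x w + a0 d)^(-(5/4:ℝ))
lemma kap_pos (x w : V d) : 0 < kap x w :=
  Real.rpow_pos_of_pos (by linarith [sq_nn x w, a0_ge d]) _
lemma kap_symm (x w : V d) : kap x w = kap w x := by unfold kap; rw [sq_comm']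
lemma kap_le_one (x w : V d) : kap x w ≤ 1 :=
  Real.rpow_le_one_of_one_le_of_nonpos (by linarith [sq_nn x w, a0_ge d]) (by norm_num)

lemma lat_lap1 (hd : 5 ≤ d) {pos : X → V d} {A : Finset X} (h : Lat pos A) {x : X} (hx : x ∈ A) (w : V d)
    {a : ℝ} (ha : a0 d ≤ a) :
    (1/4) * (sq (pos x) w + a)^(-(5/4:ℝ)) ≤ Lap (cc pos) (fun z => (sq (pos z) w + a)^(-(1/4:ℝ))) x := by
  rw [lat_Lap h hx (fun v => (sq v w + a)^(-(1/4:ℝ)))]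
  refine (lap1 hd (fun i => ((pos x i : ℝ) - w i)) (a := a) (N := sq (pos x) w + a) ha rfl).trans (le_of_eq ?_)
  refine Finset.sum_congr rfl fun i _ => ?_
  rw [sq_add, sq_sub]; congr 3 <;> ring
lemma lat_lap5 (hd : 5 ≤ d) {pos : X → V d} {A : Finset X} (h : Lat pos A) {x : X} (hx : x ∈ A) (w : V d) :
    (1/4) * (sq (pos x) w + a0 d)^(-(9/4:ℝ)) ≤ Lap (cc pos) (fun z => kap (pos z) w) x := by
  rw [lat_Lap h hx (fun v => kap v w)]
  refine (lap5 hd (fun i => ((pos x i : ℝ) - w i)) (a := a0 d) (N := sq (pos x) w + a0 d) le_rfl rfl).trans (le_of_eq ?_)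
  refine Finset.sum_congr rfl fun i _ => ?_
  unfold kap
  rw [sq_add, sq_sub]; congr 3 <;> ring

noncomputable def CG (d : ℕ) : ℝ := 4 * (a0 d)^(9/4:ℝ)
lemma CG_pos (d : ℕ) : 0 < CG d := by
  unfold CG; have := a0_ge d; positivity

lemma Lat.mono {pos : X → V d} {A B : Finset X} (h : Lat pos A) (hB : B ⊆ A) : Lat pos B :=
  ⟨h.inj, fun x hx => h.nb x (hB hx)⟩

/-- (a) -/
lemma lat_green (hd : 5 ≤ d) {pos : X → V d} {B : Finset X} (h : Lat pos B) (hZ : 0 < Z (cc pos) B)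
    {w : X} (hw : w ∈ B) (x : X) : Gr (cc pos) B x w ≤ CG d * kap (pos x) (pos w) := by
  have ha := a0_ge d
  refine max_le (cc_nonneg pos) hZ (f := fun x => Gr (cc pos) B x w)
    (g := fun x => CG d * kap (pos x) (pos w)) ?_ ?_ x
  · intro x hx
    rw [Gr_Lap hZ hx hw, Lap_mul]
    have h5 := lat_lap5 hd h hx (pos w)
    split_ifs with e
    · subst e
      rw [sq_self', zero_add] at h5
      have := mul_le_mul_of_nonneg_left h5 (CG_pos d).le
      refine le_trans (le_of_eq ?_) this
      unfold CG
      rw [Real.rpow_neg (by linarith)]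
      have : 0 < a0 d ^ (9/4:ℝ) := by positivity
      field_simp
    · exact mul_nonneg (CG_pos d).le (le_trans (mul_nonneg (by norm_num) (Real.rpow_nonneg (by linarith [sq_nn (pos x) (pos w)]) _)) h5)
  · intro x hx
    rw [Gr_out hx hw]; exact mul_nonneg (CG_pos d).le (kap_pos _ _).le

/-- (b) -/
lemma lat_kap (hd : 5 ≤ d) {pos : X → V d} {B : Finset X} (h : Lat pos B) (hZ : 0 < Z (cc pos) B)
    (w : V d) (x : X) : ∑ v ∈ B, Gr (cc pos) B x v * kap (pos v) w ≤ 4 := by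
  have ha := a0_ge d
  refine (Gr_super (cc_nonneg pos) hZ (φ := fun v => kap (pos v) w)
    (f := fun z => 4 * (sq (pos z) w + a0 d)^(-(1/4:ℝ))) ?_ ?_ x).trans ?_
  · intro x hx
    rw [Lap_mul]
    have := lat_lap1 hd h hx w le_rfl
    unfold kap; linarith
  · intro x hx
    have := sq_nn (pos x) w
    positivity
  · have : (sq (pos x) w + a0 d)^(-(1/4:ℝ)) ≤ 1 :=
      Real.rpow_le_one_of_one_le_of_nonpos (by linarith [sq_nn (pos x) w]) (by norm_num)
    linarith

noncomputable def C3 (d : ℕ) : ℝ := 4 * (16 * d + a0 d)^(5/4:ℝ)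
lemma C3_pos (d : ℕ) : 0 < C3 d := by
  unfold C3; have := a0_ge d; positivity

/-- (c) -/
lemma lat_ball (hd : 5 ≤ d) {pos : X → V d} {B : Finset X} (h : Lat pos B) (hZ : 0 < Z (cc pos) B)
    (w : V d) {ρ : ℕ} (hρ : 1 ≤ ρ) (x : X) :
    ∑ v ∈ B, Gr (cc pos) B x v * ind (∀ i, |pos v i - w i| ≤ 4 * (ρ:ℤ)) ≤ C3 d * ρ^2 := by
  have ha := a0_ge d
  have hρ' : (1:ℝ) ≤ ρ := by exact_mod_cast hρ
  have hρ2 : (1:ℝ) ≤ (ρ:ℝ)^2 := by nlinarith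
  have ha' : a0 d ≤ a0 d * (ρ:ℝ)^2 := by nlinarith
  set R : ℝ := (16 * d + a0 d) * (ρ:ℝ)^2 with hR
  have hR0 : 0 < R := by positivity
  refine (Gr_super (cc_nonneg pos) hZ (φ := fun v => ind (∀ i, |pos v i - w i| ≤ 4 * (ρ:ℤ)))
    (f := fun z => (4 * R^(5/4:ℝ)) * (sq (pos z) w + a0 d * (ρ:ℝ)^2)^(-(1/4:ℝ))) ?_ ?_ x).trans ?_
  · intro x hx
    rw [Lap_mul]
    have h1 := lat_lap1 hd h hx w ha'
    have hs := sq_nn (pos x) w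
    have hN : 0 < sq (pos x) w + a0 d * (ρ:ℝ)^2 := by positivity
    have h2 := mul_le_mul_of_nonneg_left h1 (by positivity : 0 ≤ 4 * R^(5/4:ℝ))
    refine le_trans ?_ h2
    by_cases hv : ∀ i, |pos x i - w i| ≤ 4 * (ρ:ℤ)
    · rw [ind_true hv]
      have hle : sq (pos x) w + a0 d * (ρ:ℝ)^2 ≤ R := by
        have : sq (pos x) w ≤ ∑ i : Fin d, 16 * (ρ:ℝ)^2 := by
          refine Finset.sum_le_sum fun i _ => ?_
          have h3 : |(pos x i : ℝ) - w i| ≤ 4 * ρ := by exact_mod_cast hv i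
          have := sq_le_sq' (by linarith [abs_nonneg ((pos x i : ℝ) - w i)]) h3
          rw [sq_abs] at this; linarith
        simp at this
        rw [hR]; linarith
      have h4 : R^(-(5/4:ℝ)) ≤ (sq (pos x) w + a0 d * (ρ:ℝ)^2)^(-(5/4:ℝ)) :=
        Real.rpow_le_rpow_of_nonpos hN hle (by norm_num)
      have h5 : R^(5/4:ℝ) * R^(-(5/4:ℝ)) = 1 := by rw [← Real.rpow_add hR0]; simp
      have := mul_le_mul_of_nonneg_left h4 (Real.rpow_nonneg hR0.le (5/4))
      linarith
    · rw [ind_false hv]; positivity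
  · intro x hx
    have := sq_nn (pos x) w
    positivity
  · have hs := sq_nn (pos x) w
    have h1 : (sq (pos x) w + a0 d * (ρ:ℝ)^2)^(-(1/4:ℝ)) ≤ ((ρ:ℝ)^2)^(-(1/4:ℝ)) :=
      Real.rpow_le_rpow_of_nonpos (by positivity) (by nlinarith) (by norm_num)
    have h2 := mul_le_mul_of_nonneg_left h1 (by positivity : 0 ≤ 4 * R^(5/4:ℝ))
    refine h2.trans (le_of_eq ?_)
    rw [hR, Real.mul_rpow (by positivity) (by positivity), C3]
    have : ((ρ:ℝ)^2)^(5/4:ℝ) * ((ρ:ℝ)^2)^(-(1/4:ℝ)) = (ρ:ℝ)^2 := by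
      rw [← Real.rpow_add (by positivity)]; norm_num
    calc _ = 4 * (16 * d + a0 d)^(5/4:ℝ) * (((ρ:ℝ)^2)^(5/4:ℝ) * ((ρ:ℝ)^2)^(-(1/4:ℝ))) := by ring
      _ = _ := by rw [this]

/-- (d) -/
lemma lat_exit (hd : 5 ≤ d) {pos : X → V d} {B : Finset X} (h : Lat pos B) (hZ : 0 < Z (cc pos) B)
    {w : X} (hw : w ∈ B) {ρ : ℕ} (hB : ∀ x, x ∉ B → (ρ:ℝ)^2 ≤ sq (pos x) (pos w)) :
    (ρ:ℝ)^2 / (2*d) ≤ ∑ x ∈ B, Gr (cc pos) B x w := by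
  have hd' : (5:ℝ) ≤ d := by exact_mod_cast hd
  have := Gr_sub (cc_nonneg pos) hZ (φ := fun _ => 1)
    (f := fun z => (1/(2*(d:ℝ))) * ((ρ:ℝ)^2 - sq (pos z) (pos w))) (fun x hx => by
      rw [Lap_mul, lat_Lap h hx (fun v => (ρ:ℝ)^2 - sq v (pos w))]
      simp only [sq_add, sq_sub]
      refine le_of_eq ?_
      have : ∀ i : Fin d, ((ρ:ℝ)^2 - sq (pos x) (pos w) - ((ρ:ℝ)^2 - (sq (pos x) (pos w) + 2 * ((pos x i : ℝ) - pos w i) + 1)) +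
        ((ρ:ℝ)^2 - sq (pos x) (pos w) - ((ρ:ℝ)^2 - (sq (pos x) (pos w) - 2 * ((pos x i : ℝ) - pos w i) + 1)))) = 2 := fun i => by ring
      simp only [this]
      simp; field_simp)
    (fun x hx => mul_nonpos_of_nonneg_of_nonpos (by positivity) (by linarith [hB x hx])) w
  rw [sq_self'] at this
  simp only [mul_one] at this
  refine le_trans (le_of_eq (by ring)) (this.trans (le_of_eq ?_))
  exact Finset.sum_congr rfl fun x hx => Gr_symm (cc_symm pos) hZ hw hx

end Lat

section Cells
variable {X : Type} [Fintype X] [DecidableEq X]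

lemma att_res {Γ : Set X} {B : Finset X} (hΓ : ∀ g ∈ Γ, g ∉ B) {ℓ : ℕ} {D : Finset X}
    (hD : ∀ x ∈ D, x ∉ B → x ∈ Γ) (p : X → X) {x : X} (h : attS Γ ℓ (res B p) x) :
    attS Γ ℓ p x := by
  obtain ⟨k, ⟨hk, hkΓ⟩, hmin⟩ := first_hit (P := fun k => k ≤ ℓ ∧ (res B p)^[k] x ∈ Γ) h
  refine ⟨k, hk, ?_⟩
  have : p^[k] x = (res B p)^[k] x := iter_congr fun j hj => by
    have hjB : (res B p)^[j] x ∈ B := by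
      by_contra hnB
      have hfix : ∀ i, (res B p)^[i] ((res B p)^[j] x) = (res B p)^[j] x := by
        intro i
        exact Function.iterate_fixed (by simp [res, hnB]) i
      have e : k = (k - j) + j := by omega
      rw [e, Function.iterate_add_apply, hfix] at hkΓ
      exact hmin j hj ⟨by omega, hkΓ⟩
    simp [res, hjB]
  rw [this]; exact hkΓ

lemma cells_est {ι : Type} {c : X → X → ℝ} (hc : ∀ x y, 0 ≤ c x y) {A : Finset X} (hZ : 0 < Z c A)
    (Γ : Finset X) (s : Finset ι) (D : ι → Finset X) (hDA : ∀ i ∈ s, D i ⊆ A)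
    (hd : ∀ i ∈ s, ∀ j ∈ s, i ≠ j → ∀ x ∈ D i, ∀ y ∈ D j, x ≠ y ∧ c x y = 0)
    {ℓ : ℕ} {t : ℝ} (ht : 0 < t) (e : ι → ℝ)
    (he : ∀ i ∈ s, S c (D i \ Γ) (fun p => Real.exp (- (VS (D i) ↑Γ ℓ p / t))) ≤
      Real.exp (- e i) * Z c (D i \ Γ)) :
    S c (A \ Γ) (fun p => ind (VS A ↑Γ ℓ p ≤ t)) ≤ Real.exp (1 - ∑ i ∈ s, e i) * Z c (A \ Γ) := by
  set B' := s.biUnion (fun i => D i \ Γ) with hB'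
  have hB'A : B' ⊆ A \ Γ := by
    intro x hx
    obtain ⟨i, hi, hx⟩ := Finset.mem_biUnion.1 hx
    have := Finset.mem_sdiff.1 hx
    exact Finset.mem_sdiff.2 ⟨hDA i hi this.1, this.2⟩
  have hZA : 0 < Z c (A \ Γ) := Z_pos_mono hc Finset.sdiff_subset hZ
  have hZB' : 0 < Z c B' := Z_pos_mono hc hB'A hZA
  set f : (X → X) → ℝ := fun p => Real.exp (- (VS A ↑Γ ℓ p / t))
  have hdom := domination hc (Γ := (↑Γ : Set X)) (f := f) (by
    intro p p' h
    refine Real.exp_le_exp.2 (neg_le_neg (div_le_div_of_nonneg_right ?_ ht.le))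
    exact Finset.sum_le_sum fun x _ => ind_mono fun ⟨k, hk, h'⟩ => ⟨k, hk, h x k h'⟩)
    (fun p => (Real.exp_pos _).le) _ (A \ Γ) le_rfl
    (fun g hg h => (Finset.mem_sdiff.1 h).2 hg) hZA B' hB'A
  have hbi := S_biUnion hc s (fun i => D i \ Γ) (fun i p => Real.exp (- (VS (D i) ↑Γ ℓ p / t)))
    (fun i p => (Real.exp_pos _).le) (fun i hi j hj hij x hx y hy =>
      hd i hi j hj hij x (Finset.mem_sdiff.1 hx).1 y (Finset.mem_sdiff.1 hy).1)
  have h1 : S c B' f ≤ S c B' (fun p => ∏ i ∈ s, Real.exp (- (VS (D i) ↑Γ ℓ (res (D i \ Γ) p) / t))) := by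
    refine S_mono hc fun p hp => ?_
    rw [← Real.exp_sum, Finset.sum_neg_distrib, ← Finset.sum_div]
    refine Real.exp_le_exp.2 (neg_le_neg (div_le_div_of_nonneg_right ?_ ht.le))
    calc ∑ i ∈ s, VS (D i) ↑Γ ℓ (res (D i \ Γ) p)
        ≤ ∑ i ∈ s, ∑ x ∈ D i, ind (attS ↑Γ ℓ p x) := by
          refine Finset.sum_le_sum fun i _ => Finset.sum_le_sum fun x hx => ind_mono ?_
          exact att_res (D := D i) (fun g hg h => (Finset.mem_sdiff.1 h).2 hg) (fun x hx h => by
            by_contra h'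
            exact h (Finset.mem_sdiff.2 ⟨hx, h'⟩)) p
      _ = ∑ x ∈ s.biUnion D, ind (attS ↑Γ ℓ p x) := by
          rw [Finset.sum_biUnion]
          intro i hi j hj hij
          exact Finset.disjoint_left.2 fun x hx hx' => (hd i hi j hj hij x hx x hx').1 rfl
      _ ≤ _ := Finset.sum_le_sum_of_subset_of_nonneg (Finset.biUnion_subset.2 hDA)
          fun _ _ _ => ind_nonneg _
  have h2 : S c B' f ≤ Real.exp (- ∑ i ∈ s, e i) * Z c B' := by
    refine h1.trans (hbi.1.trans ?_)
    calc _ ≤ ∏ i ∈ s, (Real.exp (- e i) * Z c (D i \ Γ)) :=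
          Finset.prod_le_prod (fun i _ => S_nonneg hc fun _ _ => (Real.exp_pos _).le) he
      _ = Real.exp (- ∑ i ∈ s, e i) * ∏ i ∈ s, Z c (D i \ Γ) := by
          rw [Finset.prod_mul_distrib, ← Real.exp_sum, Finset.sum_neg_distrib]
      _ ≤ _ := mul_le_mul_of_nonneg_left hbi.2 (Real.exp_pos _).le
  have h3 : S c (A \ Γ) f ≤ Real.exp (- ∑ i ∈ s, e i) * Z c (A \ Γ) := by
    have : S c (A \ Γ) f * Z c B' ≤ (Real.exp (- ∑ i ∈ s, e i) * Z c (A \ Γ)) * Z c B' := by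
      have := mul_le_mul_of_nonneg_right h2 hZA.le
      linarith
    exact le_of_mul_le_mul_right this hZB'
  calc S c (A \ Γ) (fun p => ind (VS A ↑Γ ℓ p ≤ t)) ≤ S c (A \ Γ) (fun p => Real.exp 1 * f p) := by
        refine S_mono hc fun p _ => ?_
        by_cases h : VS A ↑Γ ℓ p ≤ t
        · rw [ind_true h, ← Real.exp_add]
          have : VS A ↑Γ ℓ p / t ≤ 1 := (div_le_one ht).2 h
          exact Real.one_le_exp (by linarith)
        · rw [ind_false h]; positivity
    _ = Real.exp 1 * S c (A \ Γ) f := S_mul _ _ _ _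
    _ ≤ Real.exp 1 * (Real.exp (- ∑ i ∈ s, e i) * Z c (A \ Γ)) :=
        mul_le_mul_of_nonneg_left h3 (Real.exp_pos _).le
    _ = _ := by rw [← mul_assoc, ← Real.exp_add, sub_eq_add_neg]
end Cells

section Core
variable {d : ℕ} {X : Type} [Fintype X] [DecidableEq X]

noncomputable def kp (ρ : ℕ) (w v : V d) : ℝ :=
  kap w v + ((ρ:ℝ)^2)⁻¹ * ind (∀ i, |w i - v i| ≤ 4 * (ρ:ℤ))

lemma kp_nonneg (ρ : ℕ) (w v : V d) : 0 ≤ kp ρ w v :=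
  add_nonneg (kap_pos _ _).le (mul_nonneg (by positivity) (ind_nonneg _))
lemma kp_symm (ρ : ℕ) (w v : V d) : kp ρ w v = kp ρ v w := by
  unfold kp; rw [kap_symm]; simp only [abs_sub_comm]
lemma kp_le {ρ : ℕ} (hρ : 1 ≤ ρ) (w v : V d) : kp ρ w v ≤ 2 := by
  have hρ' : (1:ℝ) ≤ ρ := by exact_mod_cast hρ
  have h1 : ((ρ:ℝ)^2)⁻¹ ≤ 1 := inv_le_one_of_one_le₀ (by nlinarith)
  have h2 := mul_le_mul h1 (ind_le_one (∀ i, |w i - v i| ≤ 4 * (ρ:ℤ))) (ind_nonneg _) zero_le_one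
  have := kap_le_one w v
  unfold kp; linarith

noncomputable def aa (d : ℕ) : ℝ := (2 * d * C3 d)^2

/-- estimate for one cell family with a fixed shift -/
lemma shift_est (hd : 5 ≤ d) {pos : X → V d} {A : Finset X} (hL : Lat pos A) (hZ : 0 < Z (cc pos) A)
    {L : ℕ} (hA : ∀ x, (∀ i, |pos x i| ≤ (L:ℤ)) → x ∈ A) {Γ : Finset X} {M ρ : ℕ}
    (hρ : 1 ≤ ρ) (hΓM : ∀ w ∈ Γ, ∀ i, |pos w i| ≤ (M:ℤ)) (hLM : M + ρ ≤ L) {t U : ℝ}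
    (ht : (ρ:ℝ)^4 ≤ t) (hM0 : 0 < M) (hM : 2 * (2 * d) * (C3 d * ρ^2) ≤ M) (hU : 0 < U)
    {g : Finset X} (hgΓ : g ⊆ Γ) (hg : ∀ w ∈ g, ∑ v ∈ Γ, kp ρ (pos w) (pos v) ≤ U)
    (s : V d) (hs : ∀ w ∈ g, ∀ i, (ρ:ℤ) ≤ (pos w i - s i) % (4 * ρ) ∧ (pos w i - s i) % (4 * ρ) ≤ 3 * ρ) :
    S (cc pos) (A \ Γ) (fun p => ind (VS A ↑Γ M p ≤ t)) ≤
      Real.exp (1 - g.card * ρ^2 / (2 * d * CG d * U * t) / (4 * (2 + aa d))) * Z (cc pos) (A \ Γ) := by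
  have hd' : (5:ℝ) ≤ d := by exact_mod_cast hd
  have hρ' : (1:ℝ) ≤ ρ := by exact_mod_cast hρ
  have hρZ : (1:ℤ) ≤ ρ := by exact_mod_cast hρ
  have ht0 : 0 < t := lt_of_lt_of_le (by positivity) ht
  have hCG := CG_pos d
  have hCG1 : 1 ≤ CG d := by
    have h0 : 1 ≤ a0 d ^ (9/4:ℝ) := Real.one_le_rpow (a0_ge d) (by norm_num)
    unfold CG; linarith
  have hC3 := C3_pos d
  have hc := cc_nonneg pos
  set zf : X → V d := fun w i => (pos w i - s i) / (4 * ρ) with hzf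
  set D : V d → Finset X := fun z => A.filter (fun x => ∀ i, 0 < pos x i - s i - 4 * ρ * z i ∧
    pos x i - s i - 4 * ρ * z i < 4 * ρ) with hD
  have hDA : ∀ z, D z ⊆ A := fun z => Finset.filter_subset _ _
  have memA : ∀ w ∈ Γ, w ∈ A := fun w hw => hA w fun i => (hΓM w hw i).trans (by exact_mod_cast (by omega))
  have mcoord : ∀ w ∈ g, ∀ i, (ρ:ℤ) ≤ pos w i - s i - 4 * ρ * zf w i ∧ pos w i - s i - 4 * ρ * zf w i ≤ 3 * ρ := by
    intro w hw i
    have h1 := hs w hw i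
    have h2 := Int.emod_add_mul_ediv (pos w i - s i) (4 * ρ)
    simp only [hzf]
    constructor <;> linarith [h1.1, h1.2]
  have memD : ∀ w ∈ g, w ∈ D (zf w) := by
    intro w hw
    refine Finset.mem_filter.2 ⟨memA w (hgΓ hw), fun i => ?_⟩
    have := mcoord w hw i
    constructor <;> linarith
  have Dclose : ∀ z, ∀ x ∈ D z, ∀ y ∈ D z, ∀ i, |pos x i - pos y i| ≤ 4 * (ρ:ℤ) := by
    intro z x hx y hy i
    have h1 := (Finset.mem_filter.1 hx).2 i
    have h2 := (Finset.mem_filter.1 hy).2 i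
    rw [abs_le]; constructor <;> linarith [h1.1, h1.2, h2.1, h2.2]
  set gz : V d → Finset X := fun z => g.filter (fun w => zf w = z) with hgz
  have gzD : ∀ z, gz z ⊆ D z := by
    intro z w hw
    obtain ⟨h1, h2⟩ := Finset.mem_filter.1 hw
    rw [← h2]; exact memD w h1
  have gzΓ : ∀ z, gz z ⊆ Γ := fun z => (Finset.filter_subset _ _).trans hgΓ
  set θ : V d → ℝ := fun z => (gz z).card * ρ^2 / (2 * d * CG d * U * t) with hθ
  have hθ0 : ∀ z, 0 ≤ θ z := fun z => by positivity
  have hcard : ∀ z, ((gz z).card : ℝ) ≤ U * ρ^2 := by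
    intro z
    rcases (gz z).eq_empty_or_nonempty with h | ⟨w, hw⟩
    · rw [h]; simp; positivity
    · have h1 : ∑ v ∈ gz z, ((ρ:ℝ)^2)⁻¹ ≤ U := by
        refine le_trans ?_ (hg w (Finset.filter_subset _ _ hw))
        refine le_trans ?_ (Finset.sum_le_sum_of_subset_of_nonneg (gzΓ z) fun v _ _ => kp_nonneg _ _ _)
        refine Finset.sum_le_sum fun v hv => ?_
        unfold kp
        rw [ind_true (Dclose z w (gzD z hw) v (gzD z hv))]
        linarith [kap_pos (pos w) (pos v)]
      rw [Finset.sum_const, nsmul_eq_mul, ← div_eq_mul_inv, div_le_iff₀ (by positivity)] at h1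
      exact h1
  have hθ1 : ∀ z, θ z ≤ 1 := by
    intro z
    simp only [hθ]
    rw [div_le_one (by positivity)]
    calc ((gz z).card : ℝ) * ρ^2 ≤ U * ρ^2 * ρ^2 := mul_le_mul_of_nonneg_right (hcard z) (by positivity)
      _ = 1 * U * ρ^4 := by ring
      _ ≤ (2 * d * CG d) * U * t := by gcongr; nlinarith
      _ = _ := by ring
  have key : ∀ z ∈ g.image zf, S (cc pos) (D z \ Γ) (fun p => Real.exp (- (VS (D z) ↑Γ M p / t))) ≤
      Real.exp (- (θ z / (4 * (2 + aa d)))) * Z (cc pos) (D z \ Γ) := by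
    intro z _
    have hLD := hL.mono (hDA z)
    have hZD := Z_pos_mono hc (hDA z) hZ
    have hdeg : ∀ x ∈ D z, ∑ y, cc pos x y ≤ 2 * d := fun x hx => lat_deg hLD hx
    have hT : ∀ w ∈ D z, ∑ x ∈ D z, Gr (cc pos) (D z) x w ≤ C3 d * ρ^2 := by
      intro w hw
      refine le_trans (le_of_eq ?_) (lat_ball hd hLD hZD (pos w) hρ w)
      refine Finset.sum_congr rfl fun x hx => ?_
      rw [ind_true (Dclose z x hx w hw), mul_one, Gr_symm (cc_symm pos) hZD hx hw]
    have hH : θ z * t ≤ ∑ x ∈ D z, PP (cc pos) (D z \ Γ) ↑Γ x := by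
      refine le_trans (le_of_eq ?_) (region_H hc hZD (gzΓ z) (gzD z) (m := CG d * U)
        (b := (ρ:ℝ)^2 / (2*d)) (by positivity) ?_ ?_)
      · simp only [hθ]; field_simp
      · intro w hw
        calc ∑ v ∈ gz z, Gr (cc pos) (D z) w v ≤ ∑ v ∈ gz z, CG d * kp ρ (pos w) (pos v) := by
              refine Finset.sum_le_sum fun v hv => (lat_green hd hLD hZD (gzD z hv) w).trans ?_
              refine mul_le_mul_of_nonneg_left ?_ hCG.le
              unfold kp
              linarith [mul_nonneg (by positivity : 0 ≤ ((ρ:ℝ)^2)⁻¹) (ind_nonneg (∀ i, |pos w i - pos v i| ≤ 4 * (ρ:ℤ)))]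
          _ ≤ ∑ v ∈ Γ, CG d * kp ρ (pos w) (pos v) :=
              Finset.sum_le_sum_of_subset_of_nonneg (gzΓ z) fun v _ _ => mul_nonneg hCG.le (kp_nonneg _ _ _)
          _ ≤ _ := by
              rw [← Finset.mul_sum]
              exact mul_le_mul_of_nonneg_left (hg w (Finset.filter_subset _ _ hw)) hCG.le
      · intro w hw
        refine lat_exit hd hLD hZD (gzD z hw) fun x hx => ?_
        obtain ⟨hwg, hwz⟩ := Finset.mem_filter.1 hw
        have : ∃ i, (ρ:ℤ) ≤ |pos x i - pos w i| := by
          by_cases hxA : x ∈ A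
          · have : ¬ ∀ i, 0 < pos x i - s i - 4 * ρ * z i ∧ pos x i - s i - 4 * ρ * z i < 4 * ρ :=
              fun h => hx (Finset.mem_filter.2 ⟨hxA, h⟩)
            push Not at this
            obtain ⟨i, hi⟩ := this
            refine ⟨i, ?_⟩
            have hm := mcoord w hwg i
            rw [hwz] at hm
            by_cases h0 : 0 < pos x i - s i - 4 * ρ * z i
            · have := hi h0
              exact le_trans (by linarith [hm.2]) (le_abs_self _)
            · exact le_trans (by linarith [hm.1]) (neg_le_abs _)
          · have : ¬ ∀ i, |pos x i| ≤ (L:ℤ) := fun h => hxA (hA x h)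
            push Not at this
            obtain ⟨i, hi⟩ := this
            refine ⟨i, ?_⟩
            have h1 := hΓM w (hgΓ hwg) i
            have h2 := abs_sub_abs_le_abs_sub (pos x i) (pos w i)
            have h3 : ((M:ℤ) + ρ) ≤ L := by exact_mod_cast hLM
            linarith
        obtain ⟨i, hi⟩ := this
        have hi' : (ρ:ℝ) ≤ |(pos x i : ℝ) - pos w i| := by exact_mod_cast hi
        calc (ρ:ℝ)^2 ≤ |(pos x i : ℝ) - pos w i|^2 := by gcongr
          _ = ((pos x i : ℝ) - pos w i)^2 := sq_abs _
          _ ≤ _ := Finset.single_le_sum (f := fun i => ((pos x i : ℝ) - pos w i)^2)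
              (fun i _ => sq_nonneg _) (Finset.mem_univ i)
    refine (region_exp hc hZD (Δ := 2*d) (by positivity) hdeg (T := C3 d * ρ^2) (by positivity) hT Γ hM0 hM ht0
      (a := aa d) ?_ (hθ0 z) hH).trans ?_
    · unfold aa
      calc (2 * d * (C3 d * (ρ:ℝ)^2))^2 = (2 * d * C3 d)^2 * ρ^4 := by ring
        _ ≤ _ := by gcongr
    · refine mul_le_mul_of_nonneg_right (Real.exp_le_exp.2 (neg_le_neg ?_)) (Z_nonneg hc _)
      have : 0 ≤ aa d := sq_nonneg _
      have h1 := hθ1 z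
      have h2 := hθ0 z
      exact div_le_div_of_nonneg_left h2 (by positivity) (by linarith)
  have := cells_est hc hZ Γ (g.image zf) D (fun z _ => hDA z) (by
    intro z _ z' _ hne x hx y hy
    have : ∃ i, z i ≠ z' i := by
      by_contra h; push Not at h; exact hne (funext h)
    obtain ⟨i, hi⟩ := this
    have h1 := (Finset.mem_filter.1 hx).2 i
    have h2 := (Finset.mem_filter.1 hy).2 i
    have hdist : 2 ≤ |pos x i - pos y i| := by
      rcases lt_or_gt_of_ne hi with hlt | hlt
      · have : 4 * (ρ:ℤ) * (z i + 1) ≤ 4 * ρ * z' i := by gcongr; omega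
        refine le_trans ?_ (neg_le_abs _)
        linarith [h1.1, h1.2, h2.1, h2.2, Int.add_one_le_iff.2 h1.2, Int.add_one_le_iff.2 h2.1]
      · have : 4 * (ρ:ℤ) * (z' i + 1) ≤ 4 * ρ * z i := by gcongr; omega
        refine le_trans ?_ (le_abs_self _)
        linarith [h1.1, h1.2, h2.1, h2.2, Int.add_one_le_iff.2 h2.2, Int.add_one_le_iff.2 h1.1]
    constructor
    · rintro rfl; simp at hdist
    · rw [cc, ind_false]
      intro hadj
      unfold adj at hadj
      have := Finset.single_le_sum (f := fun i => |pos x i - pos y i|) (fun i _ => abs_nonneg _) (Finset.mem_univ i)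
      linarith) ht0 (fun z => θ z / (4 * (2 + aa d))) key
  refine this.trans (le_of_eq ?_)
  congr 3
  rw [← Finset.sum_div]
  congr 1
  simp only [hθ]
  rw [← Finset.sum_div, ← Finset.sum_mul]
  congr 2
  rw [Finset.card_eq_sum_card_image zf g]
  push_cast
  rfl

lemma main_est (hd : 5 ≤ d) {pos : X → V d} {A : Finset X} (hL : Lat pos A) (hZ : 0 < Z (cc pos) A)
    {L : ℕ} (hA : ∀ x, (∀ i, |pos x i| ≤ (L:ℤ)) → x ∈ A) {Γ : Finset X} {M ρ : ℕ}
    (hρ : 1 ≤ ρ) (hΓM : ∀ w ∈ Γ, ∀ i, |pos w i| ≤ (M:ℤ)) (hLM : M + ρ ≤ L) {t U : ℝ}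
    (ht : (ρ:ℝ)^4 ≤ t) (hM0 : 0 < M) (hM : 2 * (2 * d) * (C3 d * ρ^2) ≤ M) (hU : 0 < U)
    {g : Finset X} (hgΓ : g ⊆ Γ) (hg : ∀ w ∈ g, ∑ v ∈ Γ, kp ρ (pos w) (pos v) ≤ U) :
    S (cc pos) (A \ Γ) (fun p => ind (VS A ↑Γ M p ≤ t)) ≤
      Real.exp (1 - (g.card / 2^d) * ρ^2 / (2 * d * CG d * U * t) / (4 * (2 + aa d))) * Z (cc pos) (A \ Γ) := by
  have hρZ : (1:ℤ) ≤ ρ := by exact_mod_cast hρ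
  have ht0 : 0 < t := lt_of_lt_of_le (by positivity) ht
  have hCG := CG_pos d
  set good : ℤ → Prop := fun u => (ρ:ℤ) ≤ u % (4 * ρ) ∧ u % (4 * ρ) ≤ 3 * ρ with hgood
  have hsh : ∀ u, good u ∨ good (u - 2 * ρ) := by
    intro u
    by_cases h : good u
    · exact Or.inl h
    · right
      have h4 : (0:ℤ) < 4 * ρ := by linarith
      have h0 := Int.emod_nonneg u h4.ne'
      have h1 := Int.emod_lt_of_pos u h4
      have h2 := Int.emod_add_mul_ediv u (4 * ρ)
      simp only [hgood] at h ⊢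
      set m := u % (4 * ρ)
      set k := u / (4 * ρ)
      by_cases hm : (ρ:ℤ) ≤ m
      · have hm3 : 3 * (ρ:ℤ) < m := by by_contra h'; push Not at h'; exact h ⟨hm, h'⟩
        have e : (u - 2 * ρ) % (4 * ρ) = m - 2 * ρ := by
          rw [show u - 2 * (ρ:ℤ) = (m - 2 * ρ) + 4 * ρ * k by linarith, Int.add_mul_emod_self_left]
          exact Int.emod_eq_of_lt (by linarith) (by linarith)
        rw [e]; constructor <;> linarith
      · push Not at hm
        have e : (u - 2 * ρ) % (4 * ρ) = m + 2 * ρ := by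
          rw [show u - 2 * (ρ:ℤ) = (m + 2 * ρ) + 4 * ρ * (k - 1) by linarith, Int.add_mul_emod_self_left]
          exact Int.emod_eq_of_lt (by linarith) (by linarith)
        rw [e]; constructor <;> linarith
  set σ : X → (Fin d → Bool) := fun w i => decide (good (pos w i)) with hσ
  have hpig : ∃ b : Fin d → Bool, (g.card : ℝ) / 2^d ≤ ((g.filter (fun w => σ w = b)).card : ℝ) := by
    obtain ⟨b, _, hb⟩ := Finset.exists_le_card_fiber_of_nsmul_le_card_of_maps_to (s := g) (t := Finset.univ)
      (f := σ) (b := (g.card : ℝ) / 2^d) (fun _ _ => Finset.mem_univ _) ⟨fun _ => true, Finset.mem_univ _⟩ (by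
        simp; rw [mul_div_cancel₀]; positivity)
    exact ⟨b, hb⟩
  obtain ⟨b, hb⟩ := hpig
  refine (shift_est hd hL hZ hA hρ hΓM hLM ht hM0 hM hU (g := g.filter (fun w => σ w = b))
    ((Finset.filter_subset _ _).trans hgΓ) (fun w hw => hg w (Finset.filter_subset _ _ hw))
    (fun i => if b i then 0 else 2 * ρ) ?_).trans ?_
  · intro w hw i
    obtain ⟨_, h⟩ := Finset.mem_filter.1 hw
    have hi := congrFun h i
    simp only [hσ] at hi
    rcases hsh (pos w i) with h1 | h1
    · have : b i = true := by rw [← hi]; simpa using h1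
      simp only [this, if_true, sub_zero]; exact h1
    · by_cases h2 : good (pos w i)
      · have : b i = true := by rw [← hi]; simpa using h2
        simp only [this, if_true, sub_zero]; exact h2
      · have : b i = false := by rw [← hi]; simpa using h2
        simp only [this]; exact h1
  · refine mul_le_mul_of_nonneg_right (Real.exp_le_exp.2 ?_) (Z_nonneg (cc_nonneg pos) _)
    have : 0 ≤ aa d := sq_nonneg _
    gcongr

end Core

section CoreA
variable {X : Type} [Fintype X] [DecidableEq X] {d : ℕ}

noncomputable def Cg (d : ℕ) : ℝ := 2 * (2 * d + 1) * (2 * (4 * CG d + 1) * (2 * d))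

lemma Cg_nonneg (d : ℕ) : 0 ≤ Cg d := by
  have := CG_pos d
  unfold Cg; positivity

lemma reachW (hd : 5 ≤ d) {pos : X → V d} {A : Finset X} (hL : Lat pos A) (hZ : 0 < Z (cc pos) A)
    {y0 : X} (hy : y0 ∉ A) (o : X) {M : ℕ} (hM : 1 ≤ M) :
    ∃ hw : X → ℝ, (∀ w, 0 ≤ hw w) ∧ (∀ w ∈ A, ∀ B ⊆ A, w ∉ B →
      S (cc pos) B (fun p => ind (∃ k ∈ Set.Iic M, p^[k] o = w)) ≤ hw w * Z (cc pos) B) ∧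
      ∑ w ∈ A, hw w ≤ Cg d * M := by
  have hc := cc_nonneg pos
  have hCG := CG_pos d
  have hd' : (5:ℝ) ≤ d := by exact_mod_cast hd
  have hM' : (1:ℝ) ≤ M := by exact_mod_cast hM
  set Cv := 4 * CG d + 1 with hCv
  set ε : ℝ := 1 / (2 * M * Cv * (2 * d)) with hε
  have hCvp : 0 < Cv := by positivity
  have hε0 : 0 < ε := by positivity
  have hε1 : ε ≤ 1 := by
    rw [hε, div_le_one (by positivity)]
    have h1 : (1:ℝ) ≤ 2 * M := by linarith
    have h2 : (1:ℝ) ≤ Cv := by rw [hCv]; linarith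
    have h3 : (1:ℝ) ≤ 2 * d := by linarith
    exact one_le_mul_of_one_le_of_one_le (one_le_mul_of_one_le_of_one_le h1 h2) h3
  have hce := ce_nonneg hc y0 hε0.le
  refine ⟨fun w => 2 * (2 * d + ε) * Gr (ce (cc pos) y0 ε) A o w, fun w => ?_, fun w hw B hB hwB => ?_, ?_⟩
  · have := Gr_nonneg hce A o w
    positivity
  · refine kill_reach hc hε0.le hZ hy (Cv := Cv) (by positivity) (fun x hx => lat_deg hL hx) (by positivity) hM
      (le_of_eq ?_) ?_ hB o hw hwB
    · rw [hε]; field_simp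
    · intro B hB w hw
      have hLB := hL.mono hB
      have hZB := Z_pos_mono hc hB hZ
      have h1 := lat_kap hd hLB hZB (pos w) w
      calc ∑ z ∈ B, Gr (cc pos) B w z * Gr (cc pos) B z w
          ≤ ∑ z ∈ B, CG d * (Gr (cc pos) B w z * kap (pos z) (pos w)) := by
            refine Finset.sum_le_sum fun z hz => ?_
            have := mul_le_mul_of_nonneg_left (lat_green hd hLB hZB hw z) (Gr_nonneg hc B w z)
            linarith
        _ = CG d * ∑ z ∈ B, (Gr (cc pos) B w z * kap (pos z) (pos w)) := by rw [Finset.mul_sum]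
        _ ≤ CG d * 4 := mul_le_mul_of_nonneg_left h1 hCG.le
        _ ≤ Cv := by rw [hCv]; linarith
  · have h := ce_sum hc hε0 hZ hy o
    rw [← Finset.mul_sum]
    calc 2 * (2 * d + ε) * ∑ w ∈ A, Gr (ce (cc pos) y0 ε) A o w
        ≤ 2 * (2 * d + 1) * (1 / ε) := by
          refine mul_le_mul (by linarith) h (Finset.sum_nonneg fun w _ => Gr_nonneg hce A o w) (by positivity)
      _ = Cg d * M := by rw [hε, Cg, ← hCv]; field_simp

noncomputable def c0 (d : ℕ) : ℝ := 1 / (4 * d * (4 + C3 d))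
lemma c0_nonneg (d : ℕ) : 0 ≤ c0 d := by
  have := C3_pos d
  unfold c0; positivity
lemma c0_pos (hd : 5 ≤ d) : 0 < c0 d := by
  have := C3_pos d
  have hd' : (5:ℝ) ≤ d := by exact_mod_cast hd
  unfold c0; positivity
lemma c0_le (hd : 5 ≤ d) : c0 d ≤ 1 / 2 := by
  have := C3_pos d
  have hd' : (5:ℝ) ≤ d := by exact_mod_cast hd
  unfold c0
  rw [div_le_div_iff₀ (by positivity) (by norm_num)]
  nlinarith

noncomputable def HH (pos : X → V d) (A : Finset X) (o : X) (M ρ : ℕ) (p : X → X) : ℝ :=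
  ∑ w ∈ A, ind (∃ k ∈ Set.Iic M, p^[k] o = w) * Qf (fun v => c0 d * kp ρ (pos w) (pos v)) A p w

lemma E_HH (hd : 5 ≤ d) {pos : X → V d} {A : Finset X} (hL : Lat pos A) (hZ : 0 < Z (cc pos) A)
    {o : X} {M ρ : ℕ} (hρ : 1 ≤ ρ) {hw : X → ℝ} (h0 : ∀ w, 0 ≤ hw w)
    (h1 : ∀ w ∈ A, ∀ B ⊆ A, w ∉ B →
      S (cc pos) B (fun p => ind (∃ k ∈ Set.Iic M, p^[k] o = w)) ≤ hw w * Z (cc pos) B)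
    (h2 : ∑ w ∈ A, hw w ≤ Cg d * M) :
    S (cc pos) A (HH pos A o M ρ) ≤ 2 * (Cg d * M) * Z (cc pos) A := by
  have hc := cc_nonneg pos
  have hd' : (5:ℝ) ≤ d := by exact_mod_cast hd
  have hρ' : (1:ℝ) ≤ ρ := by exact_mod_cast hρ
  have hC3 := C3_pos d
  unfold HH
  rw [S_sum]
  have hψ : ∀ w v, 0 ≤ c0 d * kp ρ (pos w) (pos v) := fun w v => mul_nonneg (c0_nonneg d) (kp_nonneg _ _ _)
  have key : ∀ w ∈ A, S (cc pos) A (fun p => ind (∃ k ∈ Set.Iic M, p^[k] o = w) *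
      Qf (fun v => c0 d * kp ρ (pos w) (pos v)) A p w) ≤ hw w * (2 * Z (cc pos) A) := by
    intro w hwA
    refine (K_ineq hc hwA (isLowerSet_Iic M) (fun p => Qf_pos (hψ w) A p w) ?_ (h := hw w) ?_).trans ?_
    · intro p p' h
      unfold Qf; rw [Pa_eq_of_iter h]
    · intro π hπ hwπ
      exact h1 w hwA _ Finset.sdiff_subset (by simp [hwπ])
    · refine mul_le_mul_of_nonneg_left (E_Qf hc hZ (Δ := 2 * d) (by positivity) (fun x hx => lat_deg hL hx) (hψ w) ?_ w) (h0 w)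
      intro x
      have e1 := lat_kap hd hL hZ (pos w) x
      have e2 := lat_ball hd hL hZ (pos w) hρ x
      calc ∑ v ∈ A, c0 d * kp ρ (pos w) (pos v) * (2 * d * Gr (cc pos) A x v)
          = c0 d * (2 * d) * (∑ v ∈ A, Gr (cc pos) A x v * kap (pos v) (pos w) +
            ((ρ:ℝ)^2)⁻¹ * ∑ v ∈ A, Gr (cc pos) A x v * ind (∀ i, |pos v i - pos w i| ≤ 4 * (ρ:ℤ))) := by
            rw [Finset.mul_sum, ← Finset.sum_add_distrib, Finset.mul_sum]
            refine Finset.sum_congr rfl fun v _ => ?_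
            rw [kp_symm]; unfold kp; ring
        _ ≤ c0 d * (2 * d) * (4 + ((ρ:ℝ)^2)⁻¹ * (C3 d * ρ^2)) := by
            have := c0_nonneg d
            gcongr
        _ = 1 / 2 := by
            unfold c0; field_simp; ring
  calc _ ≤ ∑ w ∈ A, hw w * (2 * Z (cc pos) A) := Finset.sum_le_sum key
    _ = (∑ w ∈ A, hw w) * (2 * Z (cc pos) A) := by rw [Finset.sum_mul]
    _ ≤ (Cg d * M) * (2 * Z (cc pos) A) := mul_le_mul_of_nonneg_right h2 (by positivity)
    _ = _ := by ring

lemma markov_HH {c : X → X → ℝ} (hc : ∀ x y, 0 ≤ c x y) {A : Finset X} {H : (X → X) → ℝ} (hH : ∀ p, 0 ≤ H p)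
    {a b : ℝ} (ha : 0 < a) (h : S c A H ≤ b * Z c A) :
    S c A (fun p => ind (a < H p)) ≤ b / a * Z c A := by
  have : S c A (fun p => ind (a < H p)) ≤ a⁻¹ * S c A H := by
    rw [← S_mul]
    refine S_mono hc fun p _ => ?_
    by_cases h : a < H p
    · rw [ind_true h, inv_mul_eq_div, le_div_iff₀ ha]; linarith
    · rw [ind_false h]; exact mul_nonneg (by positivity) (hH p)
  refine this.trans ((mul_le_mul_of_nonneg_left h (by positivity)).trans (le_of_eq ?_))
  field_simp
end CoreA

section CoreB
variable {X : Type} [Fintype X] [DecidableEq X] {d : ℕ}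

def Adm (pos : X → V d) (A : Finset X) (p : X → X) : Prop :=
  IsF A p ∧ ∀ x ∈ A, adj (pos x) (pos (p x))

lemma S_mono_adm {pos : X → V d} {A : Finset X} {Φ Ψ : (X → X) → ℝ}
    (h : ∀ p, Adm pos A p → Φ p ≤ Ψ p) : S (cc pos) A Φ ≤ S (cc pos) A Ψ := by
  unfold S
  refine Finset.sum_le_sum fun p hp => ?_
  by_cases ha : ∀ x ∈ A, adj (pos x) (pos (p x))
  · exact mul_le_mul_of_nonneg_left (h p ⟨mem_FF.1 hp, ha⟩) (wt_nonneg (cc_nonneg pos) _ _)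
  · push Not at ha
    obtain ⟨x, hx, hx'⟩ := ha
    have : wt (cc pos) A p = 0 := by
      unfold wt
      exact Finset.prod_eq_zero hx (by unfold cc; exact ind_false hx')
    simp [this]

lemma adj_bd {x y : V d} (h : adj x y) (i : Fin d) : |y i| ≤ |x i| + 1 := by
  have h1 : |x i - y i| ≤ 1 := by
    unfold adj at h
    rw [← h]
    exact Finset.single_le_sum (f := fun i => |x i - y i|) (fun _ _ => abs_nonneg _) (Finset.mem_univ i)
  have := abs_sub_abs_le_abs_sub (y i) (x i)
  rw [abs_sub_comm] at this
  linarith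

lemma path_pos {pos : X → V d} {A : Finset X} {p : X → X} (hp : Adm pos A p) {o : X} (ho : pos o = 0)
    (k : ℕ) (i : Fin d) : |pos (p^[k] o) i| ≤ (k:ℤ) := by
  induction k with
  | zero => simp [ho]
  | succ k ih =>
    rw [Function.iterate_succ_apply']
    by_cases hA : p^[k] o ∈ A
    · have := adj_bd (hp.2 _ hA) i
      push_cast; linarith
    · rw [hp.1.1 _ hA]; push_cast; linarith

lemma path_mem {pos : X → V d} {A : Finset X} {p : X → X} (hp : Adm pos A p) {o : X} (ho : pos o = 0)
    {L : ℕ} (hA : ∀ x, (∀ i, |pos x i| ≤ (L:ℤ)) → x ∈ A) {k : ℕ} (hk : k ≤ L) : p^[k] o ∈ A :=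
  hA _ fun i => (path_pos hp ho k i).trans (by exact_mod_cast hk)

lemma path_ne {A : Finset X} {p : X → X} (hp : IsF A p) {o : X} {i j : ℕ} (hij : i < j)
    (hi : p^[i] o ∈ A) : p^[i] o ≠ p^[j] o := by
  intro h
  refine hp.no_cycle hi ⟨j - i - 1, ?_⟩
  rw [← Function.iterate_succ_apply' p i o, ← Function.iterate_add_apply]
  rw [show j - i - 1 + (i + 1) = j by omega, h]

lemma path_inj {pos : X → V d} {A : Finset X} {p : X → X} (hp : Adm pos A p) {o : X} (ho : pos o = 0)
    {L : ℕ} (hA : ∀ x, (∀ i, |pos x i| ≤ (L:ℤ)) → x ∈ A) {i j : ℕ} (hi : i ≤ L) (hj : j ≤ L)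
    (h : p^[i] o = p^[j] o) : i = j := by
  rcases lt_trichotomy i j with hij | hij | hij
  · exact absurd h (path_ne hp.1 hij (path_mem hp ho hA hi))
  · exact hij
  · exact absurd h.symm (path_ne hp.1 hij (path_mem hp ho hA hj))

lemma exp_half {x : ℝ} (h0 : 0 ≤ x) (h1 : x ≤ 1) : Real.exp (x / 2) ≤ 1 + x := by
  have h := Real.one_sub_le_exp_neg (x / 2)
  rw [Real.exp_neg] at h
  have hp := Real.exp_pos (x / 2)
  have : (1 - x / 2) * Real.exp (x / 2) ≤ 1 := by
    calc _ ≤ (Real.exp (x / 2))⁻¹ * Real.exp (x / 2) := by gcongr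
      _ = 1 := by field_simp
  by_contra hlt; push Not at hlt
  nlinarith

lemma energy (hd : 5 ≤ d) {pos : X → V d} {A : Finset X} {p : X → X} (hp : Adm pos A p) {o : X} (ho : pos o = 0)
    {L : ℕ} (hA : ∀ x, (∀ i, |pos x i| ≤ (L:ℤ)) → x ∈ A) {M ρ : ℕ} (hML : M ≤ L) (hρ : 1 ≤ ρ) {K : ℝ}
    (hH : HH pos A o M ρ p ≤ Real.exp K * M) {Γ : Finset X}
    (hΓ : Γ ⊆ (Finset.range M).image (fun k => p^[k] o)) :
    ∑ w ∈ Γ, ∑ v ∈ Γ, kp ρ (pos w) (pos v) ≤ 4 / c0 d * K * M := by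
  have hc0 := c0_pos hd
  set ψ : X → X → ℝ := fun w v => c0 d * kp ρ (pos w) (pos v) with hψd
  have hψ : ∀ w v, 0 ≤ ψ w v := fun w v => mul_nonneg (c0_nonneg d) (kp_nonneg _ _ _)
  have hψ1 : ∀ w v, ψ w v ≤ 1 := fun w v => by
    have := c0_le hd
    have h2 := kp_le hρ (pos w) (pos v)
    have h3 := kp_nonneg ρ (pos w) (pos v)
    simp only [hψd]; nlinarith
  set γ : ℕ → X := fun k => p^[k] o with hγ
  have hinj : Set.InjOn γ (Finset.range M) := fun i hi j hj h =>
    path_inj hp ho hA (by simp at hi; omega) (by simp at hj; omega) h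
  have hQ : ∑ j ∈ Finset.range M, Qf (ψ (γ j)) A p (γ j) ≤ HH pos A o M ρ p := by
    rw [← Finset.sum_image (f := fun w => Qf (ψ w) A p w) hinj]
    unfold HH
    have hsub : (Finset.range M).image γ ⊆ A := by
      intro x hx
      obtain ⟨k, hk, rfl⟩ := Finset.mem_image.1 hx
      exact path_mem hp ho hA (by simp at hk; omega)
    refine (Finset.sum_le_sum fun w hw => ?_).trans
      (Finset.sum_le_sum_of_subset_of_nonneg hsub fun w _ _ => mul_nonneg (ind_nonneg _) (Qf_pos (hψ w) A p w))
    obtain ⟨k, hk, rfl⟩ := Finset.mem_image.1 hw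
    rw [ind_true ⟨k, by simp at hk ⊢; omega, rfl⟩, one_mul]
  set u : ℕ → ℝ := fun j => ∑ v ∈ Pa A p (γ j), ψ (γ j) v / 2 with hu
  have hQu : ∀ j, Real.exp (u j) ≤ Qf (ψ (γ j)) A p (γ j) := by
    intro j
    simp only [hu]
    rw [Real.exp_sum]
    unfold Qf
    exact Finset.prod_le_prod (fun _ _ => (Real.exp_pos _).le) fun v _ => exp_half (hψ _ _) (hψ1 _ _)
  have hsum : ∑ j ∈ Finset.range M, u j ≤ K * M := by
    have h1 : ∀ j, u j ≤ K - 1 + Real.exp (-K) * Qf (ψ (γ j)) A p (γ j) := by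
      intro j
      have a := Real.add_one_le_exp (u j - K)
      rw [sub_eq_add_neg, add_comm, Real.exp_add, mul_comm] at a
      have b := mul_le_mul_of_nonneg_left (hQu j) (Real.exp_pos (-K)).le
      linarith
    calc ∑ j ∈ Finset.range M, u j ≤ ∑ j ∈ Finset.range M, (K - 1 + Real.exp (-K) * Qf (ψ (γ j)) A p (γ j)) :=
          Finset.sum_le_sum fun j _ => h1 j
      _ = M * (K - 1) + Real.exp (-K) * ∑ j ∈ Finset.range M, Qf (ψ (γ j)) A p (γ j) := by
          rw [Finset.sum_add_distrib, ← Finset.mul_sum]; simp; ring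
      _ ≤ M * (K - 1) + Real.exp (-K) * (Real.exp K * M) := by
          have := (Real.exp_pos (-K)).le
          gcongr; exact hQ.trans hH
      _ = K * M := by rw [← mul_assoc, ← Real.exp_add]; simp; ring
  set Γ' := (Finset.range M).image γ with hΓ'
  have hkp := fun w v : X => kp_nonneg ρ (pos w) (pos v)
  have hΓA : Γ' ⊆ A := by
      intro x hx
      obtain ⟨k, hk, rfl⟩ := Finset.mem_image.1 hx
      exact path_mem hp ho hA (by simp at hk; omega)
  have htot : ∀ w ∈ Γ', ∀ v ∈ Γ', rch p w v ∨ rch p v w := by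
    intro w hw v hv
    obtain ⟨i, -, rfl⟩ := Finset.mem_image.1 hw
    obtain ⟨j, -, rfl⟩ := Finset.mem_image.1 hv
    exact rch_total ⟨i, rfl⟩ ⟨j, rfl⟩
  set k : X → X → ℝ := fun w v => kp ρ (pos w) (pos v) with hk
  have e0 : ∑ w ∈ Γ', ∑ v ∈ Γ', ind (rch p w v) * k w v = ∑ w ∈ Γ', ∑ v ∈ Γ', ind (rch p v w) * k w v := by
    rw [Finset.sum_comm]
    exact Finset.sum_congr rfl fun w _ => Finset.sum_congr rfl fun v _ => by simp only [hk]; rw [kp_symm]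
  calc ∑ w ∈ Γ, ∑ v ∈ Γ, k w v ≤ ∑ w ∈ Γ', ∑ v ∈ Γ', k w v := by
        refine (Finset.sum_le_sum fun w _ => Finset.sum_le_sum_of_subset_of_nonneg hΓ fun v _ _ => hkp w v).trans ?_
        exact Finset.sum_le_sum_of_subset_of_nonneg hΓ fun w _ _ => Finset.sum_nonneg fun v _ => hkp w v
    _ ≤ ∑ w ∈ Γ', ∑ v ∈ Γ', (ind (rch p w v) * k w v + ind (rch p v w) * k w v) := by
        refine Finset.sum_le_sum fun w hw => Finset.sum_le_sum fun v hv => ?_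
        rcases htot w hw v hv with h | h
        · rw [ind_true h]; have := mul_nonneg (ind_nonneg (rch p v w)) (hkp w v); linarith
        · rw [ind_true h]; have := mul_nonneg (ind_nonneg (rch p w v)) (hkp w v); linarith
    _ = 2 * ∑ w ∈ Γ', ∑ v ∈ Γ', ind (rch p w v) * k w v := by
        simp only [Finset.sum_add_distrib]; rw [← e0]; ring
    _ ≤ 2 * ∑ w ∈ Γ', ∑ v ∈ Pa A p w, k w v := by
        gcongr with w hw
        calc ∑ v ∈ Γ', ind (rch p w v) * k w v ≤ ∑ v ∈ A, ind (rch p w v) * k w v :=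
              Finset.sum_le_sum_of_subset_of_nonneg hΓA fun v _ _ => mul_nonneg (ind_nonneg _) (hkp w v)
          _ = _ := by
              unfold Pa; rw [Finset.sum_filter]
              refine Finset.sum_congr rfl fun v _ => ?_
              by_cases h : rch p w v
              · rw [ind_true h, if_pos h, one_mul]
              · rw [ind_false h, if_neg h, zero_mul]
    _ = 4 / c0 d * ∑ j ∈ Finset.range M, u j := by
        rw [hΓ', Finset.sum_image hinj, Finset.mul_sum, Finset.mul_sum]
        refine Finset.sum_congr rfl fun j _ => ?_
        simp only [hu, hψd, hk]
        rw [Finset.mul_sum, Finset.mul_sum]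
        refine Finset.sum_congr rfl fun v _ => ?_
        field_simp; ring
    _ ≤ 4 / c0 d * (K * M) := by gcongr
    _ = _ := by ring
end CoreB

section CoreC
variable {X : Type} [Fintype X] [DecidableEq X] {d : ℕ}

def gd (pos : X → V d) (A : Finset X) (M ρ h : ℕ) (E : ℝ) (Γ : Finset X) : Prop :=
  Γ ⊆ A ∧ (∀ w ∈ Γ, ∀ i, |pos w i| ≤ (M:ℤ)) ∧ h ≤ Γ.card ∧
    ∑ w ∈ Γ, ∑ v ∈ Γ, kp ρ (pos w) (pos v) ≤ E

noncomputable def Ga (A : Finset X) (o e : X) (q : X → X) : Finset X := insert e (Pa (A.erase e) q o)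

def BB (pos : X → V d) (A : Finset X) (o : X) (M ρ h : ℕ) (E t : ℝ) (e : X) (q : X → X) : Prop :=
  (∃ k ∈ Set.Iic M, q^[k] o = e) ∧ gd pos A M ρ h E (Ga A o e q) ∧ VS A ↑(Ga A o e q) M q ≤ t

noncomputable def nbr (n : ℕ) (o : X) (p : X → X) : Finset X :=
  Finset.univ.filter (fun x => ∃ i j, i + j ≤ n ∧ p^[i] o = p^[j] x)

lemma dec1 (hd : 5 ≤ d) {pos : X → V d} {A : Finset X} {p : X → X} (hp : Adm pos A p) {o : X} (ho : pos o = 0)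
    {L : ℕ} (hA : ∀ x, (∀ i, |pos x i| ≤ (L:ℤ)) → x ∈ A) {h ρ n : ℕ} (hML : 2 * h ≤ L) (hn : 4 * h ≤ n)
    (hρ : 1 ≤ ρ) {K t : ℝ}
    (hH : HH pos A o (2 * h) ρ p ≤ Real.exp K * (2 * h : ℕ)) (hb : ((nbr n o p).card : ℝ) ≤ t) :
    (h:ℝ) ≤ ∑ e ∈ A, ind (BB pos A o (2 * h) ρ h (4 / c0 d * K * (2 * h : ℕ)) t e (Function.update p e e)) := by
  set γ : ℕ → X := fun k => p^[k] o with hγ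
  have key : ∀ m, h ≤ m → m < 2 * h →
      BB pos A o (2 * h) ρ h (4 / c0 d * K * (2 * h : ℕ)) t (γ m) (Function.update p (γ m) (γ m)) := by
    intro m hm1 hm2
    set e := γ m with he
    set q := Function.update p e e with hq
    have hqe : q e = e := by simp [hq]
    have hne : ∀ j < m, γ j ≠ e := fun j hj h => by
      have := path_inj hp ho hA (by omega) (by omega) h
      omega
    have hit : ∀ k ≤ m, q^[k] o = γ k := fun k hk => iter_congr fun j hj => by
      rw [hq, Function.update_of_ne (hne j (by omega))]
    have hit2 : ∀ k, m ≤ k → q^[k] o = e := fun k hk => by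
      rw [show k = (k - m) + m by omega, Function.iterate_add_apply, hit m le_rfl]
      exact Function.iterate_fixed hqe _
    have hΓ : Ga A o e q = (Finset.range (m + 1)).image γ := by
      ext x
      simp only [Ga, Finset.mem_insert, mem_Pa, Finset.mem_erase, Finset.mem_image, Finset.mem_range]
      constructor
      · rintro (rfl | ⟨⟨hx, hxA⟩, k, hk⟩)
        · exact ⟨m, by omega, rfl⟩
        · rcases le_or_gt m k with hmk | hmk
          · exact absurd (hk.symm.trans (hit2 k hmk)) hx
          · exact ⟨k, by omega, by rw [← hk, hit k hmk.le]⟩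
      · rintro ⟨k, hk, rfl⟩
        rcases Nat.lt_or_ge k m with h' | h'
        · exact Or.inr ⟨⟨hne k h', path_mem hp ho hA (by omega)⟩, k, hit k h'.le⟩
        · left; rw [he]; congr 1; omega
    refine ⟨⟨m, by simp; omega, hit m le_rfl⟩, ?_, ?_⟩
    · rw [hΓ]
      refine ⟨?_, ?_, ?_, ?_⟩
      · intro x hx
        obtain ⟨k, hk, rfl⟩ := Finset.mem_image.1 hx
        exact path_mem hp ho hA (by simp at hk; omega)
      · intro x hx i
        obtain ⟨k, hk, rfl⟩ := Finset.mem_image.1 hx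
        refine (path_pos hp ho k i).trans ?_
        simp at hk; exact_mod_cast (by omega : k ≤ 2 * h)
      · rw [Finset.card_image_of_injOn, Finset.card_range]
        · omega
        · intro i hi j hj hij
          simp at hi hj
          exact path_inj hp ho hA (by omega) (by omega) hij
      · refine energy hd hp ho hA hML hρ hH (Finset.image_subset_image ?_)
        exact Finset.range_subset_range.2 (by omega)
    · refine le_trans ?_ hb
      rw [hΓ]
      unfold VS
      calc ∑ x ∈ A, ind (attS (↑((Finset.range (m + 1)).image γ)) (2 * h) q x)
          ≤ ∑ x ∈ A, if x ∈ nbr n o p then (1:ℝ) else 0 := by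
            refine Finset.sum_le_sum fun x _ => ?_
            by_cases hx : attS (↑((Finset.range (m + 1)).image γ)) (2 * h) q x
            · rw [ind_true hx, if_pos]
              obtain ⟨k, ⟨hk1, hk2⟩, hk3⟩ := first_hit (P := fun k => k ≤ 2 * h ∧ q^[k] x ∈ ((Finset.range (m + 1)).image γ))
                (by obtain ⟨k, hk, hk'⟩ := hx; exact ⟨k, hk, by simpa using hk'⟩)
              have hpq : p^[k] x = q^[k] x := iter_congr fun j hj => by
                have hj' := hk3 j hj
                have : q^[j] x ≠ e := fun he' => hj' ⟨by omega, by
                  rw [he']; exact Finset.mem_image.2 ⟨m, by simp, rfl⟩⟩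
                rw [hq, Function.update_of_ne (by rw [← hq]; exact this)]
              obtain ⟨i, hi, hi'⟩ := Finset.mem_image.1 hk2
              simp at hi
              simp only [nbr, Finset.mem_filter, Finset.mem_univ, true_and]
              exact ⟨i, k, by omega, by rw [hpq]; exact hi'⟩
            · rw [ind_false hx]; split_ifs <;> norm_num
        _ ≤ ∑ x, if x ∈ nbr n o p then (1:ℝ) else 0 :=
            Finset.sum_le_sum_of_subset_of_nonneg (Finset.subset_univ _) fun x _ _ => by split_ifs <;> norm_num
        _ = (nbr n o p).card := by simp
  have hinj : Set.InjOn γ (Finset.Ico h (2 * h)) := fun i hi j hj hij => by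
    simp at hi hj
    exact path_inj hp ho hA (by omega) (by omega) hij
  have hsub : (Finset.Ico h (2 * h)).image γ ⊆ A := by
    intro x hx
    obtain ⟨k, hk, rfl⟩ := Finset.mem_image.1 hx
    exact path_mem hp ho hA (by simp at hk; omega)
  refine le_trans ?_ (Finset.sum_le_sum_of_subset_of_nonneg hsub fun _ _ _ => ind_nonneg _)
  rw [Finset.sum_image hinj]
  calc (h:ℝ) = ∑ m ∈ Finset.Ico h (2 * h), (1:ℝ) := by simp; norm_cast; omega
    _ ≤ _ := Finset.sum_le_sum fun m hm => by
      simp at hm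
      rw [ind_true (key m hm.1 hm.2)]

lemma dec2 {c : X → X → ℝ} (hc : ∀ x y, 0 ≤ c x y) {A : Finset X} {e : X} (he : e ∈ A) {Δ : ℝ}
    (hΔ : ∑ y, c e y ≤ Δ) (P : (X → X) → Prop) :
    S c A (fun p => ind (P (Function.update p e e))) ≤ Δ * S c (A.erase e) (fun q => ind (P q)) := by
  rw [S_step c he]
  have h0 : 0 ≤ S c (A.erase e) (fun q => ind (P q)) := S_nonneg hc fun q _ => ind_nonneg _
  refine le_trans ?_ (mul_le_mul_of_nonneg_right hΔ h0)
  rw [Finset.sum_mul]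
  refine Finset.sum_le_sum fun y _ => mul_le_mul_of_nonneg_left ?_ (hc e y)
  refine S_mono hc fun q hq => ?_
  have : Function.update (Function.update q e y) e e = q := by
    rw [Function.update_idem]
    have := hq.1 e (by simp)
    conv_lhs => rw [← this]
    rw [this]
    funext z
    by_cases hz : z = e
    · subst hz; simp [this]
    · simp [hz]
  rw [this]
  have := mul_le_mul_of_nonneg_right (ind_le_one (¬ rch q y e)) (ind_nonneg (P q))
  linarith

lemma dec3 {pos : X → V d} {A : Finset X} {o : X} {M ρ h : ℕ} {E t ε : ℝ} (hε : 0 ≤ ε)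
    (hm : ∀ Γ, gd pos A M ρ h E Γ → S (cc pos) (A \ Γ) (fun p => ind (VS A ↑Γ M p ≤ t)) ≤ ε * Z (cc pos) (A \ Γ))
    (e : X) :
    S (cc pos) (A.erase e) (fun q => ind (BB pos A o M ρ h E t e q)) ≤
      ε * S (cc pos) (A.erase e) (fun q => ind (∃ k ∈ Set.Iic M, q^[k] o = e)) := by
  have hc := cc_nonneg pos
  rw [← S_mul]
  refine S_path_le hc o fun η hη => ?_
  obtain ⟨hη1, hη2⟩ := EE_spec hη
  set π := Pa (A.erase e) η o with hπ
  by_cases hg : (∃ k ∈ Set.Iic M, η^[k] o = e) ∧ gd pos A M ρ h E (insert e π)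
  · have hΓ : A.erase e \ π = A \ insert e π := by
      ext x; simp only [Finset.mem_sdiff, Finset.mem_erase, Finset.mem_insert]; tauto
    calc S (cc pos) (A.erase e \ π) (fun q => ind (BB pos A o M ρ h E t e (glue π η q)))
        ≤ S (cc pos) (A.erase e \ π) (fun q => ind (VS A ↑(insert e π) M q ≤ t)) := by
          refine S_mono hc fun q hq => ind_mono ?_
          rintro ⟨-, -, h3⟩
          have hGa : Ga A o e (glue π η q) = insert e π := by
            unfold Ga; rw [Pa_eq_of_iter (hη2 q hq).2]
          rw [hGa] at h3
          refine le_trans ?_ h3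
          unfold VS
          refine Finset.sum_le_sum fun x _ => ind_mono fun hx => ?_
          obtain ⟨k, ⟨hk1, hk2⟩, hk3⟩ := first_hit (P := fun k => k ≤ M ∧ q^[k] x ∈ (↑(insert e π) : Set X)) hx
          refine ⟨k, hk1, ?_⟩
          rw [glue_first' fun i hi hiπ => hk3 i hi ⟨by omega, by simp [hiπ]⟩]
          exact hk2
      _ ≤ ε * Z (cc pos) (A.erase e \ π) := by rw [hΓ]; exact hm _ hg.2
      _ = S (cc pos) (A.erase e \ π) (fun q => ε * ind (∃ k ∈ Set.Iic M, (glue π η q)^[k] o = e)) := by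
          rw [S_mul]; unfold Z; congr 1
          refine S_congr fun q hq => ?_
          rw [ind_true]
          obtain ⟨k, hk, hk'⟩ := hg.1
          exact ⟨k, hk, by rw [(hη2 q hq).2, hk']⟩
  · refine S_mono hc fun q hq => ?_
    rw [ind_false]
    · exact mul_nonneg hε (ind_nonneg _)
    · rintro ⟨⟨k, hk, hk'⟩, h2, -⟩
      have hGa : Ga A o e (glue π η q) = insert e π := by
            unfold Ga; rw [Pa_eq_of_iter (hη2 q hq).2]
      rw [hGa] at h2
      rw [(hη2 q hq).2] at hk'
      exact hg ⟨⟨k, hk, hk'⟩, h2⟩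

lemma core1 (hd : 5 ≤ d) {pos : X → V d} {A : Finset X} (hL : Lat pos A) (hZ : 0 < Z (cc pos) A)
    {y0 o : X} (hy : y0 ∉ A) (ho : pos o = 0)
    {L : ℕ} (hA : ∀ x, (∀ i, |pos x i| ≤ (L:ℤ)) → x ∈ A) {h ρ n : ℕ} (hh : 1 ≤ h) (hML : 2 * h ≤ L) (hn : 4 * h ≤ n)
    (hρ : 1 ≤ ρ) {K t ε : ℝ} (hε : 0 ≤ ε)
    (hm : ∀ Γ, gd pos A (2 * h) ρ h (4 / c0 d * K * (2 * h : ℕ)) Γ →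
      S (cc pos) (A \ Γ) (fun p => ind (VS A ↑Γ (2 * h) p ≤ t)) ≤ ε * Z (cc pos) (A \ Γ)) :
    S (cc pos) A (fun p => ind (((nbr n o p).card : ℝ) ≤ t)) ≤
      (4 * d * CG d * Cg d * ε + 2 * Cg d * Real.exp (-K)) * Z (cc pos) A := by
  have hc := cc_nonneg pos
  have hh' : (1:ℝ) ≤ h := by exact_mod_cast hh
  have hM : (1:ℕ) ≤ 2 * h := by omega
  have hCG := CG_pos d
  have hCg := Cg_nonneg d
  obtain ⟨hw, w0, w1, w2⟩ := reachW hd hL hZ hy o hM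
  have hE2 := E_HH hd hL hZ hρ w0 w1 w2
  have hHn : ∀ p, 0 ≤ HH pos A o (2 * h) ρ p := fun p => Finset.sum_nonneg fun w _ =>
    mul_nonneg (ind_nonneg _) (Qf_pos (fun v => mul_nonneg (c0_nonneg d) (kp_nonneg _ _ _)) _ _ _)
  have hM2 := markov_HH hc hHn (a := Real.exp K * (2 * h : ℕ)) (by positivity) hE2
  set E := 4 / c0 d * K * (2 * h : ℕ) with hE
  have hmain : S (cc pos) A (fun p => (h:ℝ)⁻¹ * ∑ e ∈ A, ind (BB pos A o (2 * h) ρ h E t e (Function.update p e e)))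
      ≤ 4 * d * CG d * Cg d * ε * Z (cc pos) A := by
    rw [S_mul, S_sum]
    have : ∀ e ∈ A, S (cc pos) A (fun p => ind (BB pos A o (2 * h) ρ h E t e (Function.update p e e))) ≤
        2 * d * ε * CG d * Z (cc pos) A * hw e := by
      intro e he
      have a1 := dec2 hc he (lat_deg hL he) (fun q => BB pos A o (2 * h) ρ h E t e q)
      have a2 := dec3 (o := o) hε hm e
      have a3 := w1 e he (A.erase e) (Finset.erase_subset _ _) (by simp)
      have a4 : Z (cc pos) (A.erase e) ≤ CG d * Z (cc pos) A := by
        have b1 := Gr_diag (cc pos) A e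
        have b2 := lat_green hd hL hZ he e
        have b3 := mul_le_mul_of_nonneg_left (kap_le_one (pos e) (pos e)) hCG.le
        rw [b1] at b2
        rw [← div_le_iff₀ hZ]; linarith
      calc _ ≤ _ := a1
        _ ≤ 2 * d * (ε * (hw e * (CG d * Z (cc pos) A))) := by
          have := w0 e
          refine mul_le_mul_of_nonneg_left (a2.trans (mul_le_mul_of_nonneg_left (a3.trans ?_) hε)) (by positivity)
          gcongr
        _ = _ := by ring
    calc _ ≤ (h:ℝ)⁻¹ * ∑ e ∈ A, 2 * d * ε * CG d * Z (cc pos) A * hw e := by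
          gcongr with e he; exact this e he
      _ = (h:ℝ)⁻¹ * (2 * d * ε * CG d * Z (cc pos) A * ∑ e ∈ A, hw e) := by congr 1; rw [Finset.mul_sum]
      _ ≤ (h:ℝ)⁻¹ * (2 * d * ε * CG d * Z (cc pos) A * (Cg d * (2 * h : ℕ))) := by gcongr
      _ = _ := by push_cast; field_simp; ring
  have hfin : S (cc pos) A (fun p => ind (((nbr n o p).card : ℝ) ≤ t)) ≤
      S (cc pos) A (fun p => (h:ℝ)⁻¹ * ∑ e ∈ A, ind (BB pos A o (2 * h) ρ h E t e (Function.update p e e))) +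
      S (cc pos) A (fun p => ind (Real.exp K * (2 * h : ℕ) < HH pos A o (2 * h) ρ p)) := by
    rw [← S_add]
    refine S_mono_adm fun p hp => ?_
    have nn : 0 ≤ (h:ℝ)⁻¹ * ∑ e ∈ A, ind (BB pos A o (2 * h) ρ h E t e (Function.update p e e)) :=
      mul_nonneg (by positivity) (Finset.sum_nonneg fun _ _ => ind_nonneg _)
    by_cases hb : ((nbr n o p).card : ℝ) ≤ t
    · by_cases hH : Real.exp K * (2 * h : ℕ) < HH pos A o (2 * h) ρ p
      · rw [ind_true hb, ind_true hH]; linarith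
      · rw [ind_true hb, ind_false hH, add_zero]
        push Not at hH
        have := dec1 hd hp ho hA hML hn hρ hH hb
        rw [inv_mul_eq_div, le_div_iff₀ (by positivity)]; linarith
    · rw [ind_false hb]; exact add_nonneg nn (ind_nonneg _)
  refine hfin.trans ((add_le_add hmain hM2).trans (le_of_eq ?_))
  rw [Real.exp_neg]
  have := Real.exp_pos K
  have h3 : ((2 * h : ℕ):ℝ) ≠ 0 := by positivity
  field_simp
end CoreC

section CoreD
variable {X : Type} [Fintype X] [DecidableEq X] {d : ℕ}

noncomputable def c1 (d : ℕ) : ℝ := (2 * 2^d * (2 * d) * CG d * (16 / c0 d) * (4 * (2 + aa d)))⁻¹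
lemma aa_nonneg (d : ℕ) : 0 ≤ aa d := by unfold aa; positivity
lemma c1_pos (hd : 5 ≤ d) : 0 < c1 d := by
  have := c0_pos hd
  have := CG_pos d
  have := aa_nonneg d
  have hd' : (5:ℝ) ≤ d := by exact_mod_cast hd
  unfold c1; positivity

lemma core_eps (hd : 5 ≤ d) {pos : X → V d} {A : Finset X} (hL : Lat pos A) (hZ : 0 < Z (cc pos) A)
    {L : ℕ} (hA : ∀ x, (∀ i, |pos x i| ≤ (L:ℤ)) → x ∈ A) {h ρ n : ℕ} (hh : 1 ≤ h)
    (hρ : 1 ≤ ρ) (hLM : 2 * h + ρ ≤ L) {K t s : ℝ} (hK : 0 < K) (hs : 0 < s) (hst : s^2 = t)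
    (h1 : (ρ:ℝ)^2 ≤ s) (h2 : s ≤ 4 * (ρ:ℝ)^2) (hM : 2 * (2 * d) * (C3 d * ρ^2) ≤ (2 * h : ℕ))
    (hhn : (n:ℝ) / 8 ≤ h) (hns : s * K^2 ≤ n)
    {Γ : Finset X} (hΓ : gd pos A (2 * h) ρ h (4 / c0 d * K * (2 * h : ℕ)) Γ) :
      S (cc pos) (A \ Γ) (fun p => ind (VS A ↑Γ (2 * h) p ≤ t)) ≤
        Real.exp (1 - c1 d * K / 32) * Z (cc pos) (A \ Γ) := by
  have hc0 := c0_pos hd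
  have hCG := CG_pos d
  have haa := aa_nonneg d
  have hd' : (5:ℝ) ≤ d := by exact_mod_cast hd
  have hh' : (1:ℝ) ≤ h := by exact_mod_cast hh
  have ht : 0 < t := by rw [← hst]; positivity
  obtain ⟨-, g2, g3, g4⟩ := hΓ
  set U : ℝ := 16 / c0 d * K with hU
  have hU0 : 0 < U := by positivity
  set g := Γ.filter (fun w => ∑ v ∈ Γ, kp ρ (pos w) (pos v) ≤ U) with hg
  have hgc : (h:ℝ) / 2 ≤ g.card := by
    have e1 : ((Γ.filter (fun w => ¬ ∑ v ∈ Γ, kp ρ (pos w) (pos v) ≤ U)).card : ℝ) * U ≤ 4 / c0 d * K * (2 * h : ℕ) := by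
      refine le_trans ?_ g4
      rw [← nsmul_eq_mul, ← Finset.sum_const]
      refine (Finset.sum_le_sum fun w hw => ?_).trans
        (Finset.sum_le_sum_of_subset_of_nonneg (Finset.filter_subset _ _) fun w _ _ =>
          Finset.sum_nonneg fun v _ => kp_nonneg _ _ _)
      have := (Finset.mem_filter.1 hw).2
      push Not at this
      exact this.le
    have e2 : (Γ.filter (fun w => ¬ ∑ v ∈ Γ, kp ρ (pos w) (pos v) ≤ U)).card = Γ.card - g.card := by
      have := Finset.card_filter_add_card_filter_not (s := Γ) (fun w => ∑ v ∈ Γ, kp ρ (pos w) (pos v) ≤ U)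
      rw [← hg] at this
      omega
    have e3 : g.card ≤ Γ.card := Finset.card_le_card (Finset.filter_subset _ _)
    rw [e2, Nat.cast_sub e3] at e1
    have e4 : (h:ℝ) ≤ Γ.card := by exact_mod_cast g3
    have e5 : 4 / c0 d * K * (2 * h : ℕ) = ((h:ℝ) / 2) * U := by rw [hU]; push_cast; field_simp; ring
    rw [e5] at e1
    have := le_of_mul_le_mul_right e1 hU0
    linarith
  refine (main_est hd hL hZ hA hρ g2 hLM (t := t) (U := U) ?_ (by omega) hM hU0 (Finset.filter_subset _ _)
    (g := g) (fun w hw => (Finset.mem_filter.1 hw).2)).trans ?_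
  · rw [← hst]
    calc (ρ:ℝ)^4 = ((ρ:ℝ)^2)^2 := by ring
      _ ≤ s^2 := by gcongr
  · refine mul_le_mul_of_nonneg_right (Real.exp_le_exp.2 ?_) (Z_nonneg (cc_nonneg pos) _)
    have key : c1 d * K / 32 ≤ (g.card / 2^d) * ρ^2 / (2 * d * CG d * U * t) / (4 * (2 + aa d)) := by
      calc c1 d * K / 32 ≤ c1 d * ((n:ℝ) / 8 * (s / 4) / (K * t)) := by
            rw [mul_div_assoc]
            refine mul_le_mul_of_nonneg_left ?_ (c1_pos hd).le
            rw [← hst, div_le_div_iff₀ (by norm_num) (by positivity)]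
            have := mul_le_mul_of_nonneg_right hns hs.le
            nlinarith
        _ ≤ c1 d * ((2 * g.card) * (ρ:ℝ)^2 / (K * t)) := by
            have := (c1_pos hd).le
            gcongr
            · linarith
            · linarith
        _ = _ := by rw [c1, hU]; field_simp
    linarith

lemma nbr_ge {pos : X → V d} {A : Finset X} {p : X → X} (hp : Adm pos A p) {o : X} (ho : pos o = 0)
    {L n : ℕ} (hA : ∀ x, (∀ i, |pos x i| ≤ (L:ℤ)) → x ∈ A) (hn : n ≤ L) : n + 1 ≤ (nbr n o p).card := by
  calc n + 1 = ((Finset.range (n+1)).image (fun k => p^[k] o)).card := by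
        rw [Finset.card_image_of_injOn, Finset.card_range]
        intro i hi j hj hij
        simp at hi hj
        exact path_inj hp ho hA (by omega) (by omega) hij
    _ ≤ _ := Finset.card_le_card fun x hx => by
        obtain ⟨k, hk, rfl⟩ := Finset.mem_image.1 hx
        simp at hk
        simp only [nbr, Finset.mem_filter, Finset.mem_univ, true_and]
        exact ⟨k, 0, by omega, rfl⟩

set_option maxHeartbeats 800000 in
theorem core (hd : 5 ≤ d) : ∃ c C : ℝ, 0 < c ∧ 0 < C ∧
    ∀ (X : Type) [Fintype X] [DecidableEq X] (pos : X → V d) (A : Finset X), Lat pos A → 0 < Z (cc pos) A →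
    ∀ (y0 o : X), y0 ∉ A → pos o = 0 → ∀ (n L : ℕ), 1 ≤ n → 2 * n ≤ L →
    (∀ x, (∀ i, |pos x i| ≤ (L:ℤ)) → x ∈ A) → ∀ lam : ℝ, 0 < lam →
    S (cc pos) A (fun p => ind (((nbr n o p).card : ℝ) ≤ lam * (n:ℝ)^2)) ≤
      (C * Real.exp (-c * lam^(-(1/5:ℝ)))) * Z (cc pos) A := by
  have hCG := CG_pos d
  have hCg := Cg_nonneg d
  have hc1 := c1_pos hd
  have hC3 := C3_pos d
  have hd' : (5:ℝ) ≤ d := by exact_mod_cast hd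
  set c : ℝ := min (c1 d / 32) 1 with hc
  have hc0 : 0 < c := lt_min (by positivity) one_pos
  set K0 : ℝ := 8 + (16 * d * C3 d)^2 with hK0
  have hK0p : 0 < K0 := by positivity
  set C : ℝ := Real.exp (c * K0) + 4 * d * CG d * Cg d * Real.exp 1 + 2 * Cg d with hC
  have hCe := Real.exp_pos (c * K0)
  have hC2 : 0 ≤ 4 * d * CG d * Cg d * Real.exp 1 := by positivity
  have hC0 : 0 < C := by positivity
  refine ⟨c, C, hc0, hC0, ?_⟩
  intro X _ _ pos A hL hZ y0 o hy ho n L hn hnL hA lam hlam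
  have hcc := cc_nonneg pos
  set K : ℝ := lam^(-(1/5:ℝ)) with hK
  have hKp : 0 < K := Real.rpow_pos_of_pos hlam _
  have hK5 : lam * K^5 = 1 := by
    have : K^5 = lam⁻¹ := by
      rw [hK, ← Real.rpow_natCast, ← Real.rpow_mul hlam.le, ← Real.rpow_neg_one]; norm_num
    rw [this, mul_inv_cancel₀ hlam.ne']
  have hn' : (1:ℝ) ≤ n := by exact_mod_cast hn
  rcases le_or_gt K K0 with hKK | hKK
  · have : S (cc pos) A (fun p => ind (((nbr n o p).card : ℝ) ≤ lam * (n:ℝ)^2)) ≤ Z (cc pos) A :=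
      S_mono hcc fun p _ => ind_le_one _
    refine this.trans (le_mul_of_one_le_left hZ.le ?_)
    have h1 : Real.exp (c * K0) * Real.exp (-c * K) ≤ C * Real.exp (-c * K) := by
      gcongr; linarith
    refine le_trans ?_ h1
    rw [← Real.exp_add]
    refine Real.one_le_exp ?_
    nlinarith
  have hK8 : 8 ≤ K := by nlinarith [sq_nonneg (16 * d * C3 d)]
  have hK1 : 1 ≤ K := by linarith
  rcases lt_or_ge (n:ℝ) (K^5) with hnK | hnK
  · have : S (cc pos) A (fun p => ind (((nbr n o p).card : ℝ) ≤ lam * (n:ℝ)^2)) ≤ S (cc pos) A (fun _ => 0) := by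
      refine S_mono_adm fun p hp => ?_
      rw [ind_false]
      push Not
      have h1 : ((n:ℝ) + 1) ≤ (nbr n o p).card := by exact_mod_cast nbr_ge hp ho hA (by omega)
      have h2 : lam * n < lam * K^5 := by gcongr
      nlinarith
    refine this.trans ?_
    have : S (cc pos) A (fun _ => 0) = 0 := by unfold S; simp
    rw [this]; positivity
  set t := lam * (n:ℝ)^2 with ht
  set s := Real.sqrt t with hs
  have ht1 : 1 ≤ t := by
    have : lam * K^5 ≤ lam * n := by gcongr
    nlinarith
  have hs1 : 1 ≤ s := Real.one_le_sqrt.2 ht1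
  have hst : s^2 = t := Real.sq_sqrt (by linarith)
  have hsn : s^2 * K^5 = n^2 := by
    rw [hst, ht]; linear_combination (n:ℝ)^2 * hK5
  set ρ := ⌊Real.sqrt s⌋₊ with hρ
  have hss : Real.sqrt s ^ 2 = s := Real.sq_sqrt (by linarith)
  have hss1 : 1 ≤ Real.sqrt s := Real.one_le_sqrt.2 hs1
  have hρ1 : 1 ≤ ρ := Nat.one_le_floor_iff _ |>.2 hss1
  have hρ1' : (1:ℝ) ≤ ρ := by exact_mod_cast hρ1
  have hρs : (ρ:ℝ) ≤ Real.sqrt s := Nat.floor_le (by linarith)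
  have hρs2 : Real.sqrt s < ρ + 1 := Nat.lt_floor_add_one _
  have r1 : (ρ:ℝ)^2 ≤ s := by rw [← hss]; gcongr
  have r2 : s ≤ 4 * (ρ:ℝ)^2 := by
    rw [← hss, show 4 * (ρ:ℝ)^2 = (2 * ρ)^2 by ring]
    gcongr; linarith
  have hK45 : K ≤ K^5 := le_self_pow₀ hK1 (by norm_num)
  have n8 : (8:ℝ) ≤ n := by linarith
  have n8' : 8 ≤ n := by exact_mod_cast n8
  set h := n / 4 with hh
  have hhn : (n:ℝ) / 8 ≤ h := by
    have : n ≤ 8 * h := by omega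
    have : (n:ℝ) ≤ 8 * h := by exact_mod_cast this
    linarith
  have hns : s * K^2 ≤ n := by
    refine le_of_sq_le_sq ?_ (by linarith)
    rw [← hsn, mul_pow, ← pow_mul]
    gcongr
    norm_num
  have hnC : 16 * d * C3 d * s ≤ n := by
    refine le_of_sq_le_sq ?_ (by linarith)
    rw [← hsn, mul_pow, mul_comm]
    gcongr
    linarith
  have hsn' : s ≤ n := (le_mul_of_one_le_right (by linarith) (one_le_pow₀ hK1)).trans hns
  have hρn : ρ ≤ n := by
    have h1 : (ρ:ℝ) ≤ (ρ:ℝ)^2 := le_self_pow₀ hρ1' (by norm_num)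
    have : (ρ:ℝ) ≤ n := by linarith
    exact_mod_cast this
  have := core1 hd hL hZ hy ho hA (h := h) (ρ := ρ) (n := n) (K := K) (t := t) (ε := Real.exp (1 - c1 d * K / 32))
    (by omega) (by omega) (by omega) hρ1 (Real.exp_pos _).le (fun Γ hΓ =>
      core_eps (n := n) hd hL hZ hA (by omega) hρ1 (by omega) hKp (by linarith) hst r1 r2 ?_ hhn hns hΓ)
  · refine this.trans (mul_le_mul_of_nonneg_right ?_ hZ.le)
    have e1 : Real.exp (1 - c1 d * K / 32) ≤ Real.exp 1 * Real.exp (-c * K) := by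
      rw [← Real.exp_add]
      refine Real.exp_le_exp.2 ?_
      have := mul_le_mul_of_nonneg_right (min_le_left (c1 d / 32) 1) hKp.le
      rw [← hc] at this
      linarith
    have e2 : Real.exp (-K) ≤ Real.exp (-c * K) := by
      refine Real.exp_le_exp.2 ?_
      have := mul_le_mul_of_nonneg_right (min_le_right (c1 d / 32) 1) hKp.le
      rw [← hc] at this
      linarith
    calc 4 * d * CG d * Cg d * Real.exp (1 - c1 d * K / 32) + 2 * Cg d * Real.exp (-K)
        ≤ 4 * d * CG d * Cg d * (Real.exp 1 * Real.exp (-c * K)) + 2 * Cg d * Real.exp (-c * K) := by gcongr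
      _ = (4 * d * CG d * Cg d * Real.exp 1 + 2 * Cg d) * Real.exp (-c * K) := by ring
      _ ≤ C * Real.exp (-c * K) := by gcongr; linarith
  · push_cast
    have : d * C3 d * (ρ:ℝ)^2 ≤ d * C3 d * s := by gcongr
    linarith
end CoreD

section Bij
variable {X : Type} [Fintype X] [DecidableEq X] {d : ℕ}

def tau (pos : X → V d) (A : Finset X) (p : X → X) : Set (Sym2 (V d)) :=
  (fun x => s(pos x, pos (p x))) '' (A : Set X)

def Rk (pos : X → V d) (A : Finset X) (T : Set (Sym2 (V d))) : ℕ → X → Prop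
  | 0, x => x ∉ A
  | k + 1, x => ∃ y, adj (pos x) (pos y) ∧ s(pos x, pos y) ∈ T ∧ Rk pos A T k y

lemma tau_path {pos : X → V d} {A : Finset X} (hL : Lat pos A) {p : X → X} (hp : Adm pos A p) (k : ℕ) :
    ∀ x, p^[k] x ∉ A → ∃ l : List (V d),
          l.Chain' (fun u w => adj u w ∧ s(u, w) ∈ tau pos A p) ∧
          l.head? = some (pos x) ∧ ∃ y, l.getLast? = some y ∧ y ∉ pos '' (A : Set X) := by
  have out : ∀ x, x ∉ A → ∃ l : List (V d),
          l.Chain' (fun u w => adj u w ∧ s(u, w) ∈ tau pos A p) ∧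
          l.head? = some (pos x) ∧ ∃ y, l.getLast? = some y ∧ y ∉ pos '' (A : Set X) := by
    intro x hx
    refine ⟨[pos x], by simp [List.Chain'], rfl, pos x, rfl, ?_⟩
    rintro ⟨y, hy, hyx⟩
    exact hx (hL.inj hyx ▸ hy)
  induction k with
  | zero => exact out
  | succ k ih =>
    intro x hx
    by_cases hxA : x ∈ A
    · obtain ⟨l, h1, h2, y, h3, h4⟩ := ih (p x) hx
      cases l with
      | nil => simp at h2
      | cons a l =>
        simp at h2; subst h2
        refine ⟨pos x :: pos (p x) :: l, ?_, rfl, y, ?_, h4⟩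
        · exact List.isChain_cons_cons.2 ⟨⟨hp.2 x hxA, x, hxA, rfl⟩, h1⟩
        · rw [List.getLast?_cons_cons]; exact h3
    · exact out x hxA

lemma tau_injOn {pos : X → V d} {A : Finset X} (hL : Lat pos A) {p : X → X} (hp : Adm pos A p) :
    Set.InjOn (fun x => s(pos x, pos (p x))) (A : Set X) := by
  intro x hx y hy h
  simp only [Sym2.eq_iff] at h
  rcases h with h | h
  · exact hL.inj h.1
  · have h1 := hL.inj h.1
    have h2 := hL.inj h.2
    exact absurd ⟨1, by simp [h2, ← h1]⟩ (hp.1.no_cycle hx)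

lemma tau_mem {pos : X → V d} {A : Finset X} (hL : Lat pos A) {p : X → X} (hp : Adm pos A p) :
    tau pos A p ∈ wiredSpanningTrees (pos '' (A : Set X)) := by
  refine ⟨?_, ?_, ?_⟩
  · rintro _ ⟨x, hx, rfl⟩
    exact ⟨⟨pos x, pos (p x), rfl, hp.2 x hx⟩, pos x, by simp, x, hx, rfl⟩
  · unfold tau
    rw [Set.ncard_image_of_injOn (tau_injOn hL hp), Set.ncard_image_of_injective _ hL.inj]
  · rintro _ ⟨x, -, rfl⟩
    obtain ⟨k, hk⟩ := hp.1.2 x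
    exact tau_path hL hp k x hk

lemma tau_inj {pos : X → V d} {A : Finset X} (hL : Lat pos A) {p p' : X → X} (hp : Adm pos A p)
    (hp' : Adm pos A p') (h : tau pos A p = tau pos A p') : p = p' := by
  have step : ∀ x ∈ A, p x ≠ p' x → p' x ∈ A ∧ p (p' x) ≠ p' (p' x) := by
    intro x hx hne
    have : s(pos x, pos (p' x)) ∈ tau pos A p := by rw [h]; exact ⟨x, hx, rfl⟩
    obtain ⟨y, hy, hyx⟩ := this
    simp only [Sym2.eq_iff] at hyx
    rcases hyx with hyx | hyx
    · have h1 := hL.inj hyx.1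
      have h2 := hL.inj hyx.2
      subst h1; exact absurd h2 hne
    · have h1 := hL.inj hyx.1
      have h2 := hL.inj hyx.2
      rw [← h1]
      refine ⟨hy, ?_⟩
      rw [h2]
      intro hxx
      exact hp'.1.no_cycle hx ⟨1, by rw [← h1]; simpa using hxx.symm⟩
  funext x
  by_contra hne
  have hx : x ∈ A := by
    by_contra hx
    exact hne (by rw [hp.1.1 x hx, hp'.1.1 x hx])
  have : ∀ k, p'^[k] x ∈ A ∧ p (p'^[k] x) ≠ p' (p'^[k] x) := by
    intro k
    induction k with
    | zero => exact ⟨hx, hne⟩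
    | succ k ih => rw [Function.iterate_succ_apply']; exact step _ ih.1 ih.2
  obtain ⟨k, hk⟩ := hp'.1.2 x
  exact hk (this k).1

lemma Rk_of_list {pos : X → V d} {A : Finset X} (hL : Lat pos A) {T : Set (Sym2 (V d))} (l : List (V d)) :
    ∀ x, l.Chain' (fun u w => adj u w ∧ s(u, w) ∈ T) → l.head? = some (pos x) →
      (∃ y, l.getLast? = some y ∧ y ∉ pos '' (A : Set X)) → ∃ k, Rk pos A T k x := by
  induction l with
  | nil => intro x _ h; simp at h
  | cons a l ih =>
    intro x h1 h2 h3
    simp at h2; subst h2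
    by_cases hx : x ∈ A
    · cases l with
      | nil =>
        obtain ⟨y, hy, hyA⟩ := h3
        simp at hy; subst hy
        exact absurd ⟨x, hx, rfl⟩ hyA
      | cons b l =>
        obtain ⟨h4, h5⟩ := List.isChain_cons_cons.1 h1
        obtain ⟨y, rfl⟩ := hL.nb x hx b h4.1
        obtain ⟨k, hk⟩ := ih y h5 rfl (by simpa [List.getLast?_cons_cons] using h3)
        exact ⟨k + 1, y, h4.1, h4.2, hk⟩
    · exact ⟨0, hx⟩

lemma tau_surj {pos : X → V d} {A : Finset X} (hL : Lat pos A) (hne : A.Nonempty) {T : Set (Sym2 (V d))}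
    (hT : T ∈ wiredSpanningTrees (pos '' (A : Set X))) : ∃ p, Adm pos A p ∧ tau pos A p = T := by
  obtain ⟨-, t2, t3⟩ := hT
  have hR : ∀ x, ∃ k, Rk pos A T k x := by
    intro x
    by_cases hx : x ∈ A
    · obtain ⟨l, h1, h2, h3⟩ := t3 (pos x) ⟨x, hx, rfl⟩
      exact Rk_of_list hL l x h1 h2 h3
    · exact ⟨0, hx⟩
  set D : X → ℕ := fun x => Nat.find (hR x) with hD
  have hDs : ∀ x, Rk pos A T (D x) x := fun x => Nat.find_spec (hR x)
  have hst : ∀ x, ∃ y, if x ∈ A then adj (pos x) (pos y) ∧ s(pos x, pos y) ∈ T ∧ D y < D x else y = x := by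
    intro x
    by_cases hx : x ∈ A
    · have := hDs x
      obtain ⟨k, hk⟩ : ∃ k, D x = k + 1 := by
        cases h : D x with
        | zero => rw [h] at this; exact absurd hx this
        | succ k => exact ⟨k, rfl⟩
      rw [hk] at this
      obtain ⟨y, y1, y2, y3⟩ := this
      refine ⟨y, ?_⟩
      rw [if_pos hx]
      exact ⟨y1, y2, by rw [hk]; exact Nat.lt_succ_of_le (Nat.find_min' _ y3)⟩
    · exact ⟨x, by rw [if_neg hx]⟩
  choose p hp using hst
  have hpA : ∀ x ∈ A, adj (pos x) (pos (p x)) ∧ s(pos x, pos (p x)) ∈ T ∧ D (p x) < D x := fun x hx => by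
    have := hp x
    rwa [if_pos hx] at this
  have hF : IsF A p := by
    refine ⟨fun x hx => by have := hp x; rwa [if_neg hx] at this, ?_⟩
    have : ∀ m x, D x ≤ m → ∃ k, p^[k] x ∉ A := by
      intro m
      induction m with
      | zero =>
        intro x hx
        by_cases hxA : x ∈ A
        · have := (hpA x hxA).2.2; omega
        · exact ⟨0, hxA⟩
      | succ m ih =>
        intro x hx
        by_cases hxA : x ∈ A
        · obtain ⟨k, hk⟩ := ih (p x) (by have := (hpA x hxA).2.2; omega)
          exact ⟨k + 1, hk⟩
        · exact ⟨0, hxA⟩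
    exact fun x => this (D x) x le_rfl
  have hadm : Adm pos A p := ⟨hF, fun x hx => (hpA x hx).1⟩
  refine ⟨p, hadm, ?_⟩
  have hc := (tau_mem hL hadm).2.1
  refine Set.eq_of_subset_of_ncard_le ?_ (by rw [hc, t2]) ?_
  · rintro _ ⟨x, hx, rfl⟩
    exact (hpA x hx).2.1
  · refine Set.finite_of_ncard_pos ?_
    rw [t2, Set.ncard_image_of_injective _ hL.inj, Set.ncard_coe_finset]
    exact hne.card_pos

lemma tree_count {pos : X → V d} {A : Finset X} (hL : Lat pos A) (hne : A.Nonempty)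
    (Q : Set (Sym2 (V d)) → Prop) :
    (Set.ncard {T ∈ wiredSpanningTrees (pos '' (A : Set X)) | Q T} : ℝ) =
      S (cc pos) A (fun p => ind (Q (tau pos A p))) := by
  have h1 : {T ∈ wiredSpanningTrees (pos '' (A : Set X)) | Q T} =
      tau pos A '' ↑(Finset.univ.filter (fun p => Adm pos A p ∧ Q (tau pos A p))) := by
    ext T
    simp only [Set.mem_setOf_eq, Set.mem_image, Finset.coe_filter, Finset.mem_univ, true_and]
    constructor
    · rintro ⟨hT, hQ⟩
      obtain ⟨p, hp, rfl⟩ := tau_surj hL hne hT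
      exact ⟨p, ⟨hp, hQ⟩, rfl⟩
    · rintro ⟨p, ⟨hp, hQ⟩, rfl⟩
      exact ⟨tau_mem hL hp, hQ⟩
  rw [h1, Set.ncard_image_of_injOn, Set.ncard_coe_finset]
  · unfold S
    rw [Finset.card_filter]
    push_cast
    rw [← Finset.sum_filter_add_sum_filter_not Finset.univ (fun p => IsF A p)]
    have e2 : ∑ p ∈ Finset.univ.filter (fun p => ¬ IsF A p),
        (if Adm pos A p ∧ Q (tau pos A p) then (1:ℝ) else 0) = 0 := by
      refine Finset.sum_eq_zero fun p hp => ?_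
      rw [if_neg]
      rintro ⟨h, -⟩
      exact (Finset.mem_filter.1 hp).2 h.1
    rw [e2, add_zero]
    refine Finset.sum_congr rfl fun p hp => ?_
    have hpF : IsF A p := mem_FF.1 hp
    by_cases ha : ∀ x ∈ A, adj (pos x) (pos (p x))
    · have hw : wt (cc pos) A p = 1 := Finset.prod_eq_one fun x hx => ind_true (ha x hx)
      rw [hw, one_mul]
      by_cases hQ : Q (tau pos A p)
      · rw [ind_true hQ, if_pos ⟨⟨hpF, ha⟩, hQ⟩]
      · rw [ind_false hQ, if_neg fun h => hQ h.2]
    · rw [if_neg fun h => ha h.1.2]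
      push Not at ha
      obtain ⟨x, hx, hx'⟩ := ha
      have : wt (cc pos) A p = 0 := Finset.prod_eq_zero hx (ind_false hx')
      rw [this, zero_mul]
  · intro p hp p' hp' h
    simp at hp hp'
    exact tau_inj hL hp.1 hp'.1 h

end Bij

section Ball
variable {X : Type} [Fintype X] [DecidableEq X] {d : ℕ}

noncomputable def cfg (T : Set (Sym2 (V d))) : Config d := fun e => decide (e ∈ T)

def Wk (ω : Config d) (k : ℕ) (u v : V d) : Prop := ∃ l : List (V d),
  l.Chain' (fun u w => adj u w ∧ ω s(u, w) = true) ∧ l.head? = some u ∧ l.getLast? = some v ∧ l.length ≤ k + 1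

lemma Wk_refl (ω : Config d) (k : ℕ) (u : V d) : Wk ω k u u :=
  ⟨[u], by simp [List.Chain'], rfl, rfl, by simp⟩
lemma Wk_mono {ω : Config d} {k m : ℕ} (h : k ≤ m) {u v : V d} (hw : Wk ω k u v) : Wk ω m u v := by
  obtain ⟨l, h1, h2, h3, h4⟩ := hw
  exact ⟨l, h1, h2, h3, by omega⟩
lemma Wk_step {ω : Config d} {k : ℕ} {u v w : V d} (hw : Wk ω k u v) (ha : adj v w) (he : ω s(v, w) = true) :
    Wk ω (k + 1) u w := by
  obtain ⟨l, h1, h2, h3, h4⟩ := hw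
  refine ⟨l ++ [w], ?_, ?_, by simp, by simp; omega⟩
  · refine List.isChain_append.2 ⟨h1, by simp, ?_⟩
    intro x hx y hy
    rw [h3] at hx
    simp at hx hy
    subst hx; subst hy
    exact ⟨ha, he⟩
  · cases l with
    | nil => simp at h2
    | cons a l => simpa using h2

lemma nbr_ball {pos : X → V d} {A : Finset X} {p : X → X} (hp : Adm pos A p) {o : X}
    (ho : pos o = 0) (n : ℕ) : pos '' ↑(nbr n o p) ⊆ ballU (cfg (tau pos A p)) n := by
  have hed : ∀ x ∈ A, cfg (tau pos A p) s(pos x, pos (p x)) = true := fun x hx => by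
    simp only [cfg, decide_eq_true_eq]
    exact ⟨x, hx, rfl⟩
  have fwd : ∀ i, Wk (cfg (tau pos A p)) i (pos o) (pos (p^[i] o)) := by
    intro i
    induction i with
    | zero => exact Wk_refl _ _ _
    | succ i ih =>
      rw [Function.iterate_succ_apply']
      by_cases h : p^[i] o ∈ A
      · exact Wk_step ih (hp.2 _ h) (hed _ h)
      · rw [hp.1.1 _ h]; exact Wk_mono (by omega) ih
  have bwd : ∀ j m x, Wk (cfg (tau pos A p)) m (pos o) (pos (p^[j] x)) → Wk (cfg (tau pos A p)) (m + j) (pos o) (pos x) := by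
    intro j
    induction j with
    | zero => intro m x h; exact h
    | succ j ih =>
      intro m x h
      rw [Function.iterate_succ_apply] at h
      have h2 := ih m (p x) h
      by_cases hx : x ∈ A
      · exact Wk_step h2 (adj_symm (hp.2 x hx)) (by rw [Sym2.eq_swap]; exact hed x hx)
      · rw [hp.1.1 x hx] at h2; exact Wk_mono (by omega) h2
  rintro _ ⟨x, hx, rfl⟩
  simp only [nbr, Finset.coe_filter, Finset.mem_univ, true_and, Set.mem_setOf_eq] at hx
  obtain ⟨i, j, hij, h⟩ := hx
  have h1 := fwd i
  rw [h] at h1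
  have h2 := Wk_mono hij (bwd j i x h1)
  rw [ho] at h2
  exact h2

noncomputable def bx (d n : ℕ) : Finset (V d) := Finset.Icc (fun _ => -(n:ℤ)) (fun _ => (n:ℤ))
lemma mem_bx {n : ℕ} {v : V d} : v ∈ bx d n ↔ ∀ i, |v i| ≤ (n:ℤ) := by
  simp only [bx, Finset.mem_Icc, Pi.le_def, abs_le]
  exact forall_and.symm

noncomputable def bK (d n : ℕ) : Finset (Sym2 (V d)) := (bx d n ×ˢ bx d n).image (fun q => s(q.1, q.2))
lemma mem_bK {n : ℕ} {u v : V d} (hu : ∀ i, |u i| ≤ (n:ℤ)) (hv : ∀ i, |v i| ≤ (n:ℤ)) : s(u, v) ∈ bK d n :=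
  Finset.mem_image.2 ⟨(u, v), Finset.mem_product.2 ⟨mem_bx.2 hu, mem_bx.2 hv⟩, rfl⟩

lemma chain_box {ω ω' : Config d} {n : ℕ} (h : ∀ e ∈ bK d n, ω e = ω' e) (l : List (V d)) :
    ∀ v : V d, (∀ i, |v i| + (l.length : ℤ) ≤ n) →
      (v :: l).Chain' (fun u w => adj u w ∧ ω s(u, w) = true) →
      (v :: l).Chain' (fun u w => adj u w ∧ ω' s(u, w) = true) ∧ (∀ w, (v :: l).getLast? = some w → ∀ i, |w i| ≤ (n:ℤ)) := by
  induction l with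
  | nil =>
    intro v hv _
    refine ⟨by simp [List.Chain'], ?_⟩
    intro w hw i
    simp at hw; subst hw
    simpa using hv i
  | cons b l ih =>
    intro v hv hc
    obtain ⟨h1, h2⟩ := List.isChain_cons_cons.1 hc
    have hv1 : ∀ i, |v i| ≤ (n:ℤ) := fun i => by have := hv i; push_cast [List.length_cons] at this; omega
    have hb : ∀ i, |b i| + (l.length:ℤ) ≤ n := fun i => by
      have := hv i; have := adj_bd h1.1 i; push_cast [List.length_cons] at *; omega
    obtain ⟨h3, h4⟩ := ih b hb h2
    refine ⟨List.isChain_cons_cons.2 ⟨⟨h1.1, ?_⟩, h3⟩, ?_⟩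
    · rw [← h _ (mem_bK hv1 fun i => by have := hb i; omega)]; exact h1.2
    · intro w hw; rw [List.getLast?_cons_cons] at hw; exact h4 w hw

lemma ball_sub {ω ω' : Config d} {n : ℕ} (h : ∀ e ∈ bK d n, ω e = ω' e) :
    ballU ω n ⊆ ballU ω' n ∧ ballU ω n ⊆ ↑(bx d n) := by
  have : ∀ y ∈ ballU ω n, y ∈ ballU ω' n ∧ y ∈ bx d n := by
    rintro y ⟨l, h1, h2, h3, h4⟩
    cases l with
    | nil => simp at h2
    | cons a l =>
      simp at h2; subst h2
      obtain ⟨h5, h6⟩ := chain_box h l 0 (fun i => by simp at h4 ⊢; exact h4) h1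
      exact ⟨⟨_, h5, rfl, h3, h4⟩, mem_bx.2 (h6 y h3)⟩
  exact ⟨fun y hy => (this y hy).1, fun y hy => (this y hy).2⟩

lemma ball_eq {ω ω' : Config d} {n : ℕ} (h : ∀ e ∈ bK d n, ω e = ω' e) : ballU ω n = ballU ω' n :=
  Set.Subset.antisymm (ball_sub h).1 (ball_sub fun e he => (h e he).symm).1

lemma nbr_card {pos : X → V d} {A : Finset X} (hL : Lat pos A) {p : X → X} (hp : Adm pos A p) {o : X}
    (ho : pos o = 0) (n : ℕ) : (nbr n o p).card ≤ (ballU (cfg (tau pos A p)) n).ncard := by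
  rw [← Set.ncard_coe_finset, ← Set.ncard_image_of_injective _ hL.inj]
  refine Set.ncard_le_ncard (nbr_ball hp ho n) ?_
  exact (Finset.finite_toSet _).subset (ball_sub (fun _ _ => rfl)).2
end Ball

section Final
variable {d : ℕ}

abbrev XX (d r : ℕ) : Type := ↥(bx d (r + 1))
noncomputable def AA (d r : ℕ) : Finset (XX d r) := Finset.univ.filter (fun x => ∀ i, |x.1 i| ≤ (r:ℤ))

lemma mem_AA {r : ℕ} {x : XX d r} : x ∈ AA d r ↔ ∀ i, |x.1 i| ≤ (r:ℤ) := by simp [AA]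

lemma AA_image (r : ℕ) : Subtype.val '' (AA d r : Set (XX d r)) = cube (0 : V d) r := by
  ext v
  simp only [Set.mem_image, Finset.mem_coe, mem_AA, cube, Set.mem_setOf_eq, Pi.zero_apply, sub_zero]
  constructor
  · rintro ⟨x, hx, rfl⟩; exact hx
  · intro h
    exact ⟨⟨v, mem_bx.2 fun i => (h i).trans (by push_cast; omega)⟩, h, rfl⟩

lemma AA_lat (r : ℕ) : Lat (Subtype.val : XX d r → V d) (AA d r) := by
  refine ⟨Subtype.val_injective, ?_⟩
  intro x hx v hv
  refine ⟨⟨v, mem_bx.2 fun i => ?_⟩, rfl⟩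
  have := mem_AA.1 hx i
  have := adj_bd hv i
  push_cast; omega

lemma AA_Z (hd : 5 ≤ d) (r : ℕ) : 0 < Z (cc (Subtype.val : XX d r → V d)) (AA d r) := by
  rw [Z_pos_iff (cc_nonneg _)]
  set i0 : Fin d := ⟨0, by omega⟩
  have hmem : ∀ x : XX d r, x ∈ AA d r → x.1 + Pi.single i0 1 ∈ bx d (r + 1) := fun x hx => mem_bx.2 fun i => by
    have := mem_AA.1 hx i
    have h2 := adj_bd ((adj_iff x.1 (x.1 + Pi.single i0 1)).2 ⟨i0, Or.inl rfl⟩) i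
    push_cast; omega
  set p : XX d r → XX d r := fun x => if h : x ∈ AA d r then ⟨x.1 + Pi.single i0 1, hmem x h⟩ else x with hp
  have hpA : ∀ x ∈ AA d r, (p x).1 = x.1 + Pi.single i0 1 := fun x hx => by simp [hp, hx]
  refine ⟨p, ⟨fun x hx => by simp [hp, hx], ?_⟩, ?_⟩
  · intro x
    by_contra hcon
    push Not at hcon
    have : ∀ k : ℕ, (p^[k] x).1 i0 = x.1 i0 + k := by
      intro k
      induction k with
      | zero => simp
      | succ k ih =>
        rw [Function.iterate_succ_apply', hpA _ (hcon k)]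
        simp [ih]; ring
    have h1 := mem_AA.1 (hcon (2 * r + 1)) i0
    have h2 := mem_AA.1 (hcon 0) i0
    rw [this] at h1
    simp only [Function.iterate_zero, id] at h2
    push_cast at h1
    rw [abs_le] at h1 h2
    omega
  · intro x hx
    have : adj x.1 (p x).1 := by
      rw [hpA x hx]; exact (adj_iff _ _).2 ⟨i0, Or.inl rfl⟩
    unfold cc; rw [ind_true this]; exact one_pos

lemma prop_bound {n : ℕ} {t q : ℝ} {μ : Measure (Config d)} (hμ : IsProbabilityMeasure μ) (hU : IsUSF μ) (R : ℕ)
    (hq : ∀ r ≥ R, S (cc (Subtype.val : XX d r → V d)) (AA d r)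
      (fun p => ind (((ballU (cfg (tau Subtype.val (AA d r) p)) n).ncard : ℝ) ≤ t)) ≤
        q * Z (cc (Subtype.val : XX d r → V d)) (AA d r))
    (hZ : ∀ r, 0 < Z (cc (Subtype.val : XX d r → V d)) (AA d r)) :
    (μ {ω | ((ballU ω n).ncard : ℝ) ≤ t}).toReal ≤ q := by
  set W := (bK d n).powerset.filter (fun w : Finset (Sym2 (V d)) => ((ballU (cfg (w : Set (Sym2 (V d)))) n).ncard : ℝ) ≤ t) with hW
  have hcov : {ω : Config d | ((ballU ω n).ncard : ℝ) ≤ t} ⊆ ⋃ w ∈ (W : Set (Finset (Sym2 (V d)))), cylEvent (bK d n) (cfg (w : Set (Sym2 (V d)))) := by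
    intro ω hω
    set w := (bK d n).filter (fun e => ω e = true) with hw
    have hagr : ∀ e ∈ bK d n, ω e = cfg (w : Set (Sym2 (V d))) e := by
      intro e he
      rw [Bool.eq_iff_iff]
      simp [cfg, hw, he]
    refine Set.mem_iUnion₂.2 ⟨w, Finset.mem_filter.2 ⟨Finset.mem_powerset.2 (Finset.filter_subset _ _), ?_⟩, hagr⟩
    rw [← ball_eq hagr]; exact hω
  have h1 : (μ {ω | ((ballU ω n).ncard : ℝ) ≤ t}).toReal ≤ ∑ w ∈ W, (μ (cylEvent (bK d n) (cfg (w : Set (Sym2 (V d)))))).toReal := by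
    rw [← ENNReal.toReal_sum fun w _ => measure_ne_top _ _]
    refine ENNReal.toReal_mono ?_ ((measure_mono hcov).trans (measure_biUnion_finset_le _ _))
    exact ENNReal.sum_ne_top.2 fun w _ => measure_ne_top _ _
  refine h1.trans ?_
  have hlim := tendsto_finset_sum W fun w _ => hU (bK d n) (cfg (w : Set (Sym2 (V d))))
  refine le_of_tendsto hlim (Filter.eventually_atTop.2 ⟨R, fun r hr => ?_⟩)
  have hL := AA_lat (d := d) r
  have hne : (AA d r).Nonempty := ⟨⟨0, mem_bx.2 fun i => by simp; omega⟩, mem_AA.2 fun i => by simp⟩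
  have hZr := hZ r
  have hden : (Set.ncard (wiredSpanningTrees (cube (0 : V d) r)) : ℝ) = Z (cc (Subtype.val : XX d r → V d)) (AA d r) := by
    have := tree_count hL hne (fun _ => True)
    rw [AA_image] at this
    simp only [and_true, Set.setOf_mem_eq] at this
    rw [this]; unfold Z
    exact S_congr fun p _ => ind_true trivial
  have hnum : ∀ w : Finset (Sym2 (V d)), (Set.ncard { T ∈ wiredSpanningTrees (cube (0 : V d) r) |
            ∀ e ∈ bK d n, (e ∈ T ↔ cfg (w : Set (Sym2 (V d))) e = true) } : ℝ) =
      S (cc (Subtype.val : XX d r → V d)) (AA d r) (fun p => ind (∀ e ∈ bK d n, (e ∈ tau Subtype.val (AA d r) p ↔ cfg (w : Set (Sym2 (V d))) e = true))) := by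
    intro w
    rw [← AA_image]
    exact tree_count hL hne (fun T => ∀ e ∈ bK d n, (e ∈ T ↔ cfg (w : Set (Sym2 (V d))) e = true))
  simp only [hnum, hden]
  rw [← Finset.sum_div, ← S_sum, div_le_iff₀ hZr]
  refine le_trans ?_ (hq r hr)
  refine S_mono (cc_nonneg _) fun p _ => ?_
  set T := tau (Subtype.val : XX d r → V d) (AA d r) p with hT
  by_cases hex : ∃ w ∈ W, ∀ e ∈ bK d n, (e ∈ T ↔ cfg (w : Set (Sym2 (V d))) e = true)
  · obtain ⟨w, hw, hwe⟩ := hex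
    have hagr : ∀ e ∈ bK d n, cfg T e = cfg (w : Set (Sym2 (V d))) e := by
      intro e he
      rw [Bool.eq_iff_iff, ← hwe e he]; simp [cfg]
    have hb : ((ballU (cfg T) n).ncard : ℝ) ≤ t := by
      rw [ball_eq hagr]; exact (Finset.mem_filter.1 hw).2
    rw [ind_true hb, Finset.sum_eq_single w]
    · exact ind_le_one _
    · intro w' hw' hne
      rw [ind_false]
      intro h'
      apply hne
      have s1 := Finset.mem_powerset.1 (Finset.mem_filter.1 hw).1
      have s2 := Finset.mem_powerset.1 (Finset.mem_filter.1 hw').1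
      ext e
      constructor
      · intro he
        have := (hwe e (s2 he)).1 ((h' e (s2 he)).2 (by simp [cfg, he]))
        simpa [cfg] using this
      · intro he
        have := (h' e (s1 he)).1 ((hwe e (s1 he)).2 (by simp [cfg, he]))
        simpa [cfg] using this
    · intro h; exact absurd hw h
  · rw [Finset.sum_eq_zero]
    · exact ind_nonneg _
    · intro w hw
      exact ind_false fun h => hex ⟨w, hw, h⟩

lemma final_bd (d : ℕ) (hd : 5 ≤ d) : ∃ c C : ℝ, 0 < c ∧ 0 < C ∧
      ∀ μ : Measure (Config d), IsProbabilityMeasure μ → IsUSF μ →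
        ∀ (n : ℕ) (lam : ℝ), 1 ≤ n → 0 < lam →
          (μ {ω | ((ballU ω n).ncard : ℝ) ≤ lam * (n : ℝ) ^ 2}).toReal ≤
            C * Real.exp (-c * lam ^ (-(1 / 5 : ℝ))) := by
  obtain ⟨c, C, hc, hC, h⟩ := core hd
  refine ⟨c, C, hc, hC, fun μ hμ hU n lam hn hlam => ?_⟩
  refine prop_bound hμ hU (2 * n) (fun r hr => ?_) (AA_Z hd)
  have hi : 0 < d := by omega
  have hL := AA_lat (d := d) r
  refine le_trans (S_mono_adm fun p hp => ind_mono ?_)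
    (h (XX d r) Subtype.val (AA d r) hL (AA_Z hd r)
      ⟨fun _ => (r:ℤ) + 1, mem_bx.2 fun i => by push_cast; rw [abs_of_nonneg] <;> omega⟩
      ⟨0, mem_bx.2 fun i => by simp; omega⟩ ?_ rfl n r hn hr (fun x hx => mem_AA.2 hx) lam hlam)
  · intro hb
    refine le_trans ?_ hb
    exact_mod_cast nbr_card hL hp rfl n
  · intro hmem
    have := mem_AA.1 hmem ⟨0, hi⟩
    simp only at this
    rw [abs_of_nonneg (by omega)] at this
    omega
end Final

/-- Theorem 5.5.  Let `d ≥ 5` and let `𝒰` be the uniform spanning forest of `ℤ^d`.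
There are `c > 0` and `C`, depending only on `d`, such that for all `λ > 0` and
`n ≥ 1`, `P( |B_𝒰(0,n)| ≤ λ n² ) ≤ C exp( -c λ^{-1/5} )`. -/
theorem usf_ball_lower_tail :
    ∀ d : ℕ, 5 ≤ d → ∃ c C : ℝ, 0 < c ∧ 0 < C ∧
      ∀ μ : Measure (Config d), IsProbabilityMeasure μ → IsUSF μ →
      ∀ (n : ℕ) (lam : ℝ), 1 ≤ n → 0 < lam →
        (μ { ω | ((ballU ω n).ncard : ℝ) ≤ lam * (n : ℝ) ^ 2 }).toReal
          ≤ C * Real.exp (-c * lam ^ (-(1 / 5 : ℝ))) := by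
  intro d hd
  exact final_bd d hd

end USFPaper
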